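/- arXiv:2003.05816 — 3 statements merged into one kernel-verified Lean document; each statement's English description precedes it below -/
import Mathlib

section
/- Let T>0, let b be a tempered distribution on ℝ^d, and let w∈C([0,T],ℝ^d) be infinitely regularizing in the smooth sense, with local time L and averaging operator T_{s,t}b(x)=⟨b,L_{s,t}(·−x)⟩. Then for every x∈ℝ^d there exist a maximal time T*(x)∈(0,T]∪{∞} and a unique path y^x on [0,T*(x))∩[0,T] which is γ-Hölder continuous on compact subintervals for every γ∈(1/2,1) and satisfies, for every t<min(T*(x),T), that the Riemann sums ∑_{[u,v]∈P} T_{u,v}b(y^x_u) over partitions P of [0,t] converge to y^x_t − x as the mesh of P tends to 0. Moreover, if T*(x)<∞ then |y^x_t|→∞ as t↑T*(x), and the map x↦T*(x)^{-1} is locally bounded on ℝ^d. (The path ỹ^x := y^x + w is then the unique solution of the perturbed ODE ỹ_t = x + ∫_0^t b(ỹ_r)dr + w_t in the nonlinear-Young sense.) -/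
noncomputable section
open MeasureTheory Set Filter
open scoped ENNReal NNReal

abbrev Euc (d : ℕ) : Type := EuclideanSpace ℝ (Fin d)

/-- Occupation measure of the path `w` up to time `t`. -/
def occMeas {d : ℕ} (w : ℝ → Euc d) (t : ℝ) (A : Set (Euc d)) : ℝ≥0∞ :=
  volume {s : ℝ | s ∈ Set.Icc 0 t ∧ w s ∈ A}

/-- `L` is a local time on `[0,T]` for the path `w`. -/
def IsLocalTime {d : ℕ} (T : ℝ) (w : ℝ → Euc d) (L : ℝ → Euc d → ℝ) : Prop :=
  Measurable (Function.uncurry L) ∧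
  (∀ z, L 0 z = 0) ∧
  (∀ t z, 0 ≤ L t z) ∧
  ∀ t ∈ Set.Icc (0:ℝ) T, ∀ A : Set (Euc d), MeasurableSet A →
    occMeas w t A = ∫⁻ z in A, ENNReal.ofReal (L t z)

/-- Convergence of Riemann sums of the germ `Ξ` over partitions of `[s,t]` to the limit `I`, as
the mesh of the partition tends to `0`. -/
def RiemannConv {V : Type*} [NormedAddCommGroup V] (Xi : ℝ → ℝ → V) (s t : ℝ) (I : V) : Prop :=
  ∀ ε : ℝ, 0 < ε → ∃ δ : ℝ, 0 < δ ∧ ∀ (k : ℕ) (p : ℕ → ℝ),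
    p 0 = s → p k = t → (∀ i < k, p i ≤ p (i + 1)) → (∀ i < k, p (i + 1) - p i ≤ δ) →
    ‖(∑ i ∈ Finset.range k, Xi (p i) (p (i + 1))) - I‖ < ε

/-- `y` solves the nonlinear Young equation `y_t = x + ∫_0^t Φ(dr, y_r)` on `[0, T⋆) ∩ [0, T]`:
`y_0 = x`, `y` is `γ`-Hölder continuous on compact subintervals for every exponent `γ ∈ Γ`, and
for every `t < min(T⋆, T)` the Riemann sums `∑_{[u,v]} Φ u v (y u)` over partitions of `[0,t]`
converge to `y t − x` as the mesh tends to `0`. -/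
def IsNLYoungSolution {V : Type*} [NormedAddCommGroup V] (T : ℝ) (Γ : Set ℝ)
    (Φ : ℝ → ℝ → V → V) (x : V) (Tstar : ℝ≥0∞) (y : ℝ → V) : Prop :=
  y 0 = x ∧
  (∀ τ : ℝ, 0 ≤ τ → τ ≤ T → ENNReal.ofReal τ < Tstar →
    ∀ γ ∈ Γ, ∃ C : ℝ, ∀ u ∈ Set.Icc (0:ℝ) τ, ∀ v ∈ Set.Icc (0:ℝ) τ,
      ‖y v - y u‖ ≤ C * |v - u| ^ γ) ∧
  ∀ t : ℝ, 0 ≤ t → t < T → ENNReal.ofReal t < Tstar →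
    RiemannConv (fun u v => Φ u v (y u)) 0 t (y t - x)

section AveragedField

variable {E F : Type*} [NormedAddCommGroup E] [NormedSpace ℝ E]
  [NormedAddCommGroup F] [NormedSpace ℝ F]

/-- Local `C^{1,1}`-type bounds in space, Hölder in time, for a time-dependent field `A`. -/
structure IsLocalYoungField (T : ℝ) (A : ℝ → E → F) : Prop where
  zero : ∀ x, A 0 x = 0
  bounds : ∀ γ ∈ Set.Ioo (1/2:ℝ) 1, ∀ R : ℝ, ∃ K : ℝ, 1 ≤ K ∧ ∀ s t, 0 ≤ s → s ≤ t → t ≤ T →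
    (∀ x, ‖x‖ ≤ R → ‖A t x - A s x‖ ≤ K * (t - s) ^ γ) ∧
    (∀ x x', ‖x‖ ≤ R → ‖x'‖ ≤ R →
      ‖(A t x - A s x) - (A t x' - A s x')‖ ≤ K * (t - s) ^ γ * ‖x - x'‖) ∧
    (∀ x z k, ‖x‖ ≤ R → ‖z‖ ≤ R → ‖k‖ ≤ R →
      ‖((A t (x + k) - A s (x + k)) - (A t x - A s x)) -
        ((A t (z + k) - A s (z + k)) - (A t z - A s z))‖
        ≤ K * (t - s) ^ γ * (‖k‖ * ‖x - z‖))

/-- A continuous linear map on Schwartz space is controlled on functions supported in a fixed ball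
by the sup norms of finitely many derivatives. -/
theorem exists_norm_le_of_support_subset_ball (b : SchwartzMap E ℝ →L[ℝ] F) (ρ : ℝ) :
    ∃ (m : ℕ) (C : ℝ), 0 ≤ C ∧ ∀ (f : SchwartzMap E ℝ) (B : ℝ),
      (∀ z, ρ < ‖z‖ → f z = 0) → (∀ n ≤ m, ∀ z, ‖iteratedFDeriv ℝ n f z‖ ≤ B) →
      ‖b f‖ ≤ C * B := by
  have hcont : Continuous ((normSeminorm ℝ F).comp b.toLinearMap) := by
    change Continuous fun f => ‖b f‖
    fun_prop
  obtain ⟨S, C, -, hC⟩ := Seminorm.bound_of_continuous (schwartz_withSeminorms ℝ E ℝ) _ hcont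
  refine ⟨S.sup Prod.snd, C * (1 + |ρ|) ^ (S.sup Prod.fst), by positivity, fun f B hf hB => ?_⟩
  have hB0 : 0 ≤ B := (norm_nonneg _).trans (hB 0 zero_le 0)
  have hts : tsupport f ⊆ Metric.closedBall 0 ρ := by
    refine closure_minimal (fun z hz => ?_) Metric.isClosed_closedBall
    rw [mem_closedBall_zero_iff]
    by_contra h
    exact hz (hf z (not_le.mp h))
  have hsup : (S.sup (schwartzSeminormFamily ℝ E ℝ)) f ≤ (1 + |ρ|) ^ (S.sup Prod.fst) * B := by
    refine Seminorm.finset_sup_apply_le (by positivity) fun i hi => ?_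
    refine SchwartzMap.seminorm_le_bound ℝ i.1 i.2 f (by positivity) fun z => ?_
    by_cases hz : z ∈ tsupport f
    · have hz' : ‖z‖ ≤ 1 + |ρ| := by
        have := mem_closedBall_zero_iff.mp (hts hz)
        linarith [le_abs_self ρ]
      have h1 : ‖z‖ ^ i.1 ≤ (1 + |ρ|) ^ (S.sup Prod.fst) :=
        (pow_le_pow_left₀ (norm_nonneg z) hz' _).trans
          (pow_le_pow_right₀ (by linarith [abs_nonneg ρ]) (Finset.le_sup (f := Prod.fst) hi))
      exact mul_le_mul h1 (hB _ (Finset.le_sup (f := Prod.snd) hi) z) (norm_nonneg _)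
        (by positivity)
    · have h0 : iteratedFDeriv ℝ i.2 f z = 0 := by
        by_contra h
        exact hz (support_iteratedFDeriv_subset i.2 h)
      rw [h0, norm_zero, mul_zero]
      positivity
  calc ‖b f‖ ≤ C * (S.sup (schwartzSeminormFamily ℝ E ℝ)) f := hC f
    _ ≤ C * ((1 + |ρ|) ^ (S.sup Prod.fst) * B) := by gcongr
    _ = _ := by ring

theorem norm_iteratedFDeriv_translate_sub_le {g : E → F} (hg : ContDiff ℝ (⊤ : ℕ∞) g)
    {n : ℕ} {B : ℝ} (hB : ∀ z, ‖iteratedFDeriv ℝ (n + 1) g z‖ ≤ B) (x x' z : E) :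
    ‖iteratedFDeriv ℝ n (fun z => g (z - x) - g (z - x')) z‖ ≤ B * ‖x - x'‖ := by
  have hn : ContDiff ℝ n g := hg.of_le (by exact_mod_cast le_top)
  have h1 : ContDiff ℝ n fun z => g (z - x) := hn.comp (contDiff_id.sub contDiff_const)
  have h2 : ContDiff ℝ n fun z => g (z - x') := hn.comp (contDiff_id.sub contDiff_const)
  rw [fun_iteratedFDeriv_sub_apply h1.contDiffAt h2.contDiffAt, iteratedFDeriv_comp_sub,
    iteratedFDeriv_comp_sub]
  have hd : Differentiable ℝ (iteratedFDeriv ℝ n g) :=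
    hg.differentiable_iteratedFDeriv (by exact_mod_cast ENat.natCast_lt_top n)
  have := convex_univ.norm_image_sub_le_of_norm_fderiv_le (𝕜 := ℝ)
    (f := iteratedFDeriv ℝ n g) (C := B) (x := z - x') (y := z - x)
    (fun y _ => hd y) (fun y _ => by rw [norm_fderiv_iteratedFDeriv]; exact hB y)
    (mem_univ _) (mem_univ _)
  refine this.trans_eq ?_
  rw [sub_sub_sub_cancel_left, norm_sub_rev]

/-- The field `(t, x) ↦ ⟨b, ℓ_t(· - x)⟩` obtained by averaging a tempered distribution along
smooth compactly supported local times is locally `C^{1,1}` in space and Hölder in time. -/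
theorem isLocalYoungField_averaging {T : ℝ} {ℓ : ℝ → E → ℝ} (hzero : ∀ z, ℓ 0 z = 0)
    (hsmooth : ∀ t ∈ Set.Icc (0:ℝ) T, ContDiff ℝ (⊤:ℕ∞) (ℓ t))
    (hsupp : ∃ K : Set E, IsCompact K ∧ ∀ t ∈ Set.Icc (0:ℝ) T, tsupport (ℓ t) ⊆ K)
    (hHol : ∀ γ ∈ Set.Ioo (1/2:ℝ) 1, ∀ n : ℕ, ∃ C : ℝ, ∀ s t : ℝ, 0 ≤ s → s ≤ t → t ≤ T →
      ∀ x : E, ‖iteratedFDeriv ℝ n (fun z => ℓ t z - ℓ s z) x‖ ≤ C * (t - s) ^ γ)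
    (Ltr : ℝ → E → SchwartzMap E ℝ) (hLtr : ∀ t x z, Ltr t x z = ℓ t (z - x))
    (b : SchwartzMap E ℝ →L[ℝ] F) :
    IsLocalYoungField T fun t x => b (Ltr t x) := by
  refine ⟨fun x => ?_, fun γ hγ R => ?_⟩
  · have : Ltr 0 x = 0 := by
      ext z
      simp [hLtr, hzero]
    simp [this]
  obtain ⟨K, hK, hKs⟩ := hsupp
  obtain ⟨r, hr⟩ := hK.isBounded.exists_norm_le
  obtain ⟨m, C, hC, hb⟩ := exists_norm_le_of_support_subset_ball b (r + 2 * R)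
  choose D hD using hHol γ hγ
  set D' : ℝ := ∑ n ∈ Finset.range (m + 3), |D n| with hD'
  have hD'0 : 0 ≤ D' := Finset.sum_nonneg fun _ _ => abs_nonneg _
  refine ⟨1 + C * D', by nlinarith [mul_nonneg hC hD'0], fun s t hs hst ht => ?_⟩
  have hts : 0 ≤ (t - s) ^ γ := Real.rpow_nonneg (sub_nonneg.mpr hst) _
  set g : E → ℝ := fun z => ℓ t z - ℓ s z with hg
  have hgs : ContDiff ℝ (⊤ : ℕ∞) g :=
    (hsmooth t ⟨hs.trans hst, ht⟩).sub (hsmooth s ⟨hs, hst.trans ht⟩)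
  set B := D' * (t - s) ^ γ with hBdef
  have hgB : ∀ n ≤ m + 2, ∀ z, ‖iteratedFDeriv ℝ n g z‖ ≤ B := fun n hn z => by
    refine (hD n s t hs hst ht z).trans ?_
    refine mul_le_mul_of_nonneg_right ((le_abs_self _).trans ?_) hts
    exact Finset.single_le_sum (f := fun n => |D n|) (fun _ _ => abs_nonneg _)
      (Finset.mem_range.mpr (by omega))
  have hB0 : 0 ≤ B := mul_nonneg hD'0 hts
  have hℓ0 : ∀ u ∈ Set.Icc (0:ℝ) T, ∀ z, r < ‖z‖ → ℓ u z = 0 := fun u hu z hz => by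
    by_contra h
    exact absurd (hr z (hKs u hu (subset_tsupport _ h))) (not_le.mpr hz)
  have hg0 : ∀ z, r < ‖z‖ → g z = 0 := fun z hz => by
    simp only [hg]
    rw [hℓ0 t ⟨hs.trans hst, ht⟩ z hz, hℓ0 s ⟨hs, hst.trans ht⟩ z hz, sub_zero]
  have hg0' : ∀ y z : E, ‖y‖ ≤ 2 * R → r + 2 * R < ‖z‖ → g (z - y) = 0 := fun y z hy hz =>
    hg0 _ (by linarith [norm_sub_norm_le z y])
  have key : ∀ (f : SchwartzMap E ℝ) (G : E → ℝ) (c : ℝ), (∀ z, f z = G z) → 0 ≤ c →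
      (∀ z, r + 2 * R < ‖z‖ → G z = 0) → (∀ n ≤ m, ∀ z, ‖iteratedFDeriv ℝ n G z‖ ≤ B * c) →
      ‖b f‖ ≤ (1 + C * D') * (t - s) ^ γ * c := by
    intro f G c hfG hc h0 hn
    have hfG' : (f : E → ℝ) = G := funext hfG
    have := hb f (B * c) (by simpa only [hfG] using h0) (by simpa only [hfG'] using hn)
    refine this.trans ?_
    rw [hBdef]
    nlinarith [mul_nonneg hts hc]
  refine ⟨fun x hx => ?_, fun x x' hx hx' => ?_, fun x x' k hx hx' hk => ?_⟩
  · have hR : 0 ≤ R := (norm_nonneg x).trans hx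
    have := key (Ltr t x - Ltr s x) (fun z => g (z - x)) 1
      (fun z => by simp [hLtr, hg]) zero_le_one (fun z hz => hg0' _ _ (by linarith) hz)
      (fun n hn z => by
        rw [iteratedFDeriv_comp_sub, mul_one]
        exact hgB n (by omega) _)
    simpa only [map_sub, mul_one] using this
  · have hR : 0 ≤ R := (norm_nonneg x).trans hx
    have := key ((Ltr t x - Ltr s x) - (Ltr t x' - Ltr s x')) (fun z => g (z - x) - g (z - x'))
      ‖x - x'‖ (fun z => by simp [hLtr, hg]) (norm_nonneg _)
      (fun z hz => by rw [hg0' x z (by linarith) hz, hg0' x' z (by linarith) hz, sub_zero])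
      (fun n hn z => norm_iteratedFDeriv_translate_sub_le hgs (hgB (n + 1) (by omega)) x x' z)
    simpa only [map_sub] using this
  · have hR : 0 ≤ R := (norm_nonneg x).trans hx
    have hxk := norm_add_le x k
    have hxk' := norm_add_le x' k
    have hks : ContDiff ℝ (⊤ : ℕ∞) fun z => g (z - k) - g (z - 0) :=
      (hgs.comp (contDiff_id.sub contDiff_const)).sub (hgs.comp (contDiff_id.sub contDiff_const))
    have := key (((Ltr t (x + k) - Ltr s (x + k)) - (Ltr t x - Ltr s x)) -
        ((Ltr t (x' + k) - Ltr s (x' + k)) - (Ltr t x' - Ltr s x')))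
      (fun z => (fun z => g (z - k) - g (z - 0)) (z - x) -
        (fun z => g (z - k) - g (z - 0)) (z - x'))
      (‖k‖ * ‖x - x'‖) (fun z => by simp [hLtr, hg, sub_sub]) (by positivity)
      (fun z hz => by
        simp only [sub_sub, add_zero]
        rw [hg0' _ z (by linarith) hz, hg0' _ z (by linarith) hz, hg0' _ z (by linarith) hz,
          hg0' _ z (by linarith) hz]
        simp)
      (fun n hn z => by
        rw [← mul_assoc]
        refine norm_iteratedFDeriv_translate_sub_le hks (fun z => ?_) x x' z
        have := norm_iteratedFDeriv_translate_sub_le hgs (hgB (n + 2) (by omega)) k 0 z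
        rwa [sub_zero k] at this)
    simpa only [map_sub] using this

end AveragedField

section Gauge

/-- The gauge `r ↦ r ^ (3/4)`, whose square `r ^ (3/2)` is superadditive enough for sewing. -/
def gauge34 (r : ℝ) : ℝ := r ^ (3 / 4 : ℝ)

theorem gauge34_nonneg {r : ℝ} (hr : 0 ≤ r) : 0 ≤ gauge34 r := Real.rpow_nonneg hr _

theorem gauge34_mono {r r' : ℝ} (hr : 0 ≤ r) (h : r ≤ r') : gauge34 r ≤ gauge34 r' :=
  Real.rpow_le_rpow hr h (by norm_num)

theorem gauge34_zero : gauge34 0 = 0 := Real.zero_rpow (by norm_num)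

theorem continuous_gauge34 : Continuous gauge34 :=
  Real.continuous_rpow_const (by norm_num)

theorem gauge34_sq {r : ℝ} (hr : 0 ≤ r) : gauge34 r ^ 2 = r ^ (3 / 2 : ℝ) := by
  rw [gauge34, ← Real.rpow_natCast, ← Real.rpow_mul hr]
  norm_num

theorem two_mul_gauge34_half_sq_le {r : ℝ} (hr : 0 ≤ r) :
    2 * gauge34 (r / 2) ^ 2 ≤ 3 / 4 * gauge34 r ^ 2 := by
  rw [gauge34_sq hr, gauge34_sq (by positivity), Real.div_rpow hr (by norm_num)]
  have h0 : 0 ≤ r ^ (3 / 2 : ℝ) := Real.rpow_nonneg hr _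
  have h1 : (0:ℝ) < 2 ^ (3 / 2 : ℝ) := by positivity
  have h2 : ((2:ℝ) ^ (3 / 2 : ℝ)) ^ 2 = 8 := by
    rw [← Real.rpow_natCast, ← Real.rpow_mul (by norm_num)]
    norm_num
  have h3 : (8:ℝ) / 3 ≤ 2 ^ (3 / 2 : ℝ) := by nlinarith
  rw [← mul_div_assoc, div_le_iff₀ h1]
  nlinarith

theorem exists_gauge34_le {ε : ℝ} (hε : 0 < ε) : ∃ τ : ℝ, 0 < τ ∧ gauge34 τ ≤ ε := by
  refine ⟨ε ^ (4 / 3 : ℝ), by positivity, ?_⟩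
  rw [gauge34, ← Real.rpow_mul hε.le]
  norm_num

/-- If `f` is almost subadditive at midpoints and has order `gauge34 ^ 2`, then the constant of
that order only depends on the subadditivity defect. -/
theorem le_of_midpoint_subadditive {f : ℝ → ℝ → ℝ} {a c G D : ℝ}
    (hf : ∀ u v, a ≤ u → u ≤ v → v ≤ c → f u v ≤ G * gauge34 (v - u) ^ 2)
    (hmid : ∀ u v, a ≤ u → u ≤ v → v ≤ c →
      f u v ≤ f u ((u + v) / 2) + f ((u + v) / 2) v + D * gauge34 (v - u) ^ 2)
    (hG : 0 ≤ G) (hD : 0 ≤ D) {u v : ℝ} (hu : a ≤ u) (huv : u ≤ v) (hv : v ≤ c) :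
    f u v ≤ 4 * D * gauge34 (v - u) ^ 2 := by
  have key : ∀ n : ℕ, ∀ u v, a ≤ u → u ≤ v → v ≤ c →
      f u v ≤ (4 * D + G * (3 / 4) ^ n) * gauge34 (v - u) ^ 2 := by
    intro n
    induction n with
    | zero =>
      intro u v hu huv hv
      refine (hf u v hu huv hv).trans ?_
      have := sq_nonneg (gauge34 (v - u))
      rw [pow_zero, mul_one]
      nlinarith [mul_nonneg hD this]
    | succ n ih =>
      intro u v hu huv hv
      have h1 := ih u ((u + v) / 2) hu (by linarith) (by linarith)
      have h2 := ih ((u + v) / 2) v (by linarith) (by linarith) hv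
      rw [show (u + v) / 2 - u = (v - u) / 2 by ring] at h1
      rw [show v - (u + v) / 2 = (v - u) / 2 by ring] at h2
      have h3 := two_mul_gauge34_half_sq_le (sub_nonneg.mpr huv)
      have h4 := hmid u v hu huv hv
      have h5 : 0 ≤ 4 * D + G * (3 / 4) ^ n := by positivity
      have h6 := mul_le_mul_of_nonneg_left h3 h5
      rw [pow_succ]
      nlinarith
  have hlim : Tendsto (fun n : ℕ => (4 * D + G * (3 / 4 : ℝ) ^ n) * gauge34 (v - u) ^ 2) atTop
      (nhds ((4 * D + G * 0) * gauge34 (v - u) ^ 2)) :=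
    (((tendsto_pow_atTop_nhds_zero_of_lt_one (by norm_num) (by norm_num)).const_mul G).const_add
      (4 * D)).mul_const _
  have := ge_of_tendsto' hlim fun n => key n u v hu huv hv
  simpa using this

end Gauge

section DavieSolutions

variable {E : Type*} [NormedAddCommGroup E]

/-- `y` solves `dy = A(dt, y)` on `[a, c]` in the sense of Davie: its increments agree with those
of `A` up to an error of order `3/2`. -/
def IsDavieSolution (A : ℝ → E → E) (a c : ℝ) (y : ℝ → E) : Prop :=
  ∃ C : ℝ, 0 ≤ C ∧ ∀ u v, a ≤ u → u ≤ v → v ≤ c →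
    ‖y v - y u - (A v (y u) - A u (y u))‖ ≤ C * gauge34 (v - u) ^ 2

theorem IsLocalYoungField.exists_gauge34_bounds {T : ℝ} {A : ℝ → E → E}
    (hA : IsLocalYoungField T A) (R : ℝ) :
    ∃ K : ℝ, 1 ≤ K ∧ ∀ s t, 0 ≤ s → s ≤ t → t ≤ T →
      (∀ x, ‖x‖ ≤ R → ‖A t x - A s x‖ ≤ K * gauge34 (t - s)) ∧
      (∀ x x', ‖x‖ ≤ R → ‖x'‖ ≤ R →
        ‖(A t x - A s x) - (A t x' - A s x')‖ ≤ K * gauge34 (t - s) * ‖x - x'‖) ∧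
      (∀ p q p' q', ‖p‖ ≤ R → ‖q‖ ≤ R → ‖p'‖ ≤ R → ‖q'‖ ≤ R →
        ‖((A t p' - A s p') - (A t q' - A s q')) - ((A t p - A s p) - (A t q - A s q))‖
          ≤ K * gauge34 (t - s) * (‖(p' - q') - (p - q)‖ + ‖p' - p‖ * ‖p - q‖)) := by
  obtain ⟨K, hK, h⟩ := hA.bounds (3 / 4) ⟨by norm_num, by norm_num⟩ (3 * R)
  refine ⟨K, hK, fun s t hs hst ht => ?_⟩
  obtain ⟨h1, h2, h3⟩ := h s t hs hst ht
  refine ⟨fun x hx => h1 x (by linarith [norm_nonneg x]),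
    fun x x' hx hx' => h2 x x' (by linarith [norm_nonneg x]) (by linarith [norm_nonneg x]), ?_⟩
  intro p q p' q' hp hq hp' hq'
  have hR : 0 ≤ R := (norm_nonneg p).trans hp
  have hk : ‖p' - p‖ ≤ 2 * R := (norm_sub_le _ _).trans (by linarith)
  have hqk : ‖q + (p' - p)‖ ≤ 3 * R := (norm_add_le _ _).trans (by linarith)
  have e1 := h3 p q (p' - p) (by linarith) (by linarith) (by linarith)
  have e2 := h2 (q + (p' - p)) q' hqk (by linarith)
  rw [add_sub_cancel] at e1
  have e3 : q + (p' - p) - q' = (p' - q') - (p - q) := by abel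
  rw [e3] at e2
  calc _ = ‖((A t p' - A s p' - (A t p - A s p)) -
        (A t (q + (p' - p)) - A s (q + (p' - p)) - (A t q - A s q))) +
        (A t (q + (p' - p)) - A s (q + (p' - p)) - (A t q' - A s q'))‖ := by
        congr 1; abel
    _ ≤ K * (t - s) ^ (3 / 4 : ℝ) * (‖p' - p‖ * ‖p - q‖) +
        K * (t - s) ^ (3 / 4 : ℝ) * ‖(p' - q') - (p - q)‖ := norm_add_le_of_le e1 e2
    _ = _ := by rw [gauge34]; ring

namespace IsDavieSolution

variable {T : ℝ} {A : ℝ → E → E} {a c : ℝ} {y z : ℝ → E}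

theorem mono (h : IsDavieSolution A a c y) {a' c' : ℝ} (ha : a ≤ a') (hc : c' ≤ c) :
    IsDavieSolution A a' c' y := by
  obtain ⟨C, hC, h⟩ := h
  exact ⟨C, hC, fun u v hu huv hv => h u v (ha.trans hu) huv (hv.trans hc)⟩

theorem congr (h : IsDavieSolution A a c y) (hyz : ∀ u, a ≤ u → u ≤ c → z u = y u) :
    IsDavieSolution A a c z := by
  obtain ⟨C, hC, h⟩ := h
  refine ⟨C, hC, fun u v hu huv hv => ?_⟩
  rw [hyz u hu (huv.trans hv), hyz v (hu.trans huv) hv]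
  exact h u v hu huv hv

theorem exists_norm_le (hA : IsLocalYoungField T A) (ha : 0 ≤ a) (hc : c ≤ T)
    (h : IsDavieSolution A a c y) : ∃ R : ℝ, ∀ u, a ≤ u → u ≤ c → ‖y u‖ ≤ R := by
  obtain ⟨C, hC, h⟩ := h
  obtain ⟨K, hK, hb⟩ := hA.exists_gauge34_bounds ‖y a‖
  refine ⟨‖y a‖ + K * gauge34 (c - a) + C * gauge34 (c - a) ^ 2, fun u hu huc => ?_⟩
  have h1 := h a u le_rfl hu huc
  have h2 := (hb a u ha hu (huc.trans hc)).1 (y a) le_rfl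
  have h3 : gauge34 (u - a) ≤ gauge34 (c - a) := gauge34_mono (by linarith) (by linarith)
  have h4 : 0 ≤ gauge34 (u - a) := gauge34_nonneg (by linarith)
  calc ‖y u‖ = ‖y a + (A u (y a) - A a (y a)) + (y u - y a - (A u (y a) - A a (y a)))‖ := by
        congr 1; abel
    _ ≤ ‖y a‖ + K * gauge34 (u - a) + C * gauge34 (u - a) ^ 2 :=
        norm_add_le_of_le (norm_add_le_of_le le_rfl h2) h1
    _ ≤ _ := by gcongr

theorem exists_holder (hA : IsLocalYoungField T A) (ha : 0 ≤ a) (hc : c ≤ T)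
    (h : IsDavieSolution A a c y) {γ : ℝ} (hγ : γ ∈ Set.Ioo (1/2:ℝ) 1) :
    ∃ M : ℝ, 0 ≤ M ∧ ∀ u v, a ≤ u → u ≤ v → v ≤ c → ‖y v - y u‖ ≤ M * (v - u) ^ γ := by
  obtain ⟨R, hR⟩ := h.exists_norm_le hA ha hc
  obtain ⟨C, hC, h⟩ := h
  obtain ⟨K, hK, hb⟩ := hA.bounds γ hγ R
  refine ⟨K + C * |c - a| ^ (3 / 2 - γ), by positivity, fun u v hu huv hv => ?_⟩
  have h1 := h u v hu huv hv
  have h2 := (hb u v (ha.trans hu) huv (hv.trans hc)).1 (y u) (hR u hu (huv.trans hv))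
  have hvu : 0 ≤ v - u := sub_nonneg.mpr huv
  have h3 : gauge34 (v - u) ^ 2 ≤ |c - a| ^ (3 / 2 - γ) * (v - u) ^ γ := by
    rw [gauge34_sq hvu, show (3 / 2 : ℝ) = (3 / 2 - γ) + γ by ring,
      Real.rpow_add_of_nonneg hvu (by linarith [hγ.2]) (by linarith [hγ.1]), sub_add_cancel]
    gcongr
    · linarith [hγ.2]
    · exact le_trans (by linarith) (le_abs_self _)
  calc ‖y v - y u‖ = ‖(A v (y u) - A u (y u)) + (y v - y u - (A v (y u) - A u (y u)))‖ := by
        congr 1; abel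
    _ ≤ K * (v - u) ^ γ + C * gauge34 (v - u) ^ 2 := norm_add_le_of_le h2 h1
    _ ≤ K * (v - u) ^ γ + C * (|c - a| ^ (3 / 2 - γ) * (v - u) ^ γ) := by gcongr
    _ = _ := by ring

theorem exists_gauge34_holder (hA : IsLocalYoungField T A) (ha : 0 ≤ a) (hc : c ≤ T)
    (h : IsDavieSolution A a c y) :
    ∃ M : ℝ, 0 ≤ M ∧ ∀ u v, a ≤ u → u ≤ v → v ≤ c → ‖y v - y u‖ ≤ M * gauge34 (v - u) :=
  h.exists_holder hA ha hc ⟨by norm_num, by norm_num⟩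

/-- Solutions on adjacent intervals which agree at the common endpoint can be concatenated. -/
theorem concat (hA : IsLocalYoungField T A) {m : ℝ} (ha : 0 ≤ a) (hm : m ≤ T) (hc : c ≤ T)
    (hy : IsDavieSolution A a m y) (hy' : IsDavieSolution A m c y) :
    IsDavieSolution A a c y := by
  obtain ⟨R, hR⟩ := hy.exists_norm_le hA ha hm
  obtain ⟨M, hM, hMy⟩ := hy.exists_gauge34_holder hA ha hm
  obtain ⟨K, hK, hb⟩ := hA.exists_gauge34_bounds R
  obtain ⟨C, hC, h⟩ := hy
  obtain ⟨C', hC', h'⟩ := hy'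
  refine ⟨C + C' + K * M, by positivity, fun u v hu huv hv => ?_⟩
  have hg := sq_nonneg (gauge34 (v - u))
  have hKM : 0 ≤ K * M := by positivity
  rcases le_total v m with hvm | hmv
  · refine (h u v hu huv hvm).trans ?_
    gcongr
    linarith
  rcases le_total m u with hmu | hum
  · refine (h' u v hmu huv hv).trans ?_
    gcongr
    linarith
  have e1 := h u m hu hum le_rfl
  have e2 := h' m v le_rfl hmv hv
  have e3 := (hb m v (ha.trans (hu.trans hum)) hmv (hv.trans hc)).2.1 (y m) (y u)
    (hR m (hu.trans hum) le_rfl) (hR u hu hum)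
  have e4 := hMy u m hu hum le_rfl
  have g1 : gauge34 (m - u) ≤ gauge34 (v - u) := gauge34_mono (by linarith) (by linarith)
  have g2 : gauge34 (v - m) ≤ gauge34 (v - u) := gauge34_mono (by linarith) (by linarith)
  have g3 : 0 ≤ gauge34 (m - u) := gauge34_nonneg (by linarith)
  have g4 : 0 ≤ gauge34 (v - m) := gauge34_nonneg (by linarith)
  have g5 : 0 ≤ gauge34 (v - u) := g3.trans g1
  calc _ = ‖(y m - y u - (A m (y u) - A u (y u))) + (y v - y m - (A v (y m) - A m (y m))) +
          ((A v (y m) - A m (y m)) - (A v (y u) - A m (y u)))‖ := by congr 1; abel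
    _ ≤ C * gauge34 (m - u) ^ 2 + C' * gauge34 (v - m) ^ 2 +
        K * gauge34 (v - m) * ‖y m - y u‖ :=
        norm_add_le_of_le (norm_add_le_of_le e1 e2) e3
    _ ≤ C * gauge34 (v - u) ^ 2 + C' * gauge34 (v - u) ^ 2 +
        K * gauge34 (v - u) * (M * gauge34 (v - u)) := by
        have : ‖y m - y u‖ ≤ M * gauge34 (v - u) := e4.trans (by gcongr)
        gcongr
    _ = _ := by ring

/-- One contraction step for the difference of two solutions. -/
theorem norm_sub_sub_sub_le_half {K M H : ℝ} (hK : 1 ≤ K) (hM : 0 ≤ M) (hH : 0 ≤ H)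
    (hy : IsDavieSolution A a c y) (hz : IsDavieSolution A a c z) (hyz : y a = z a)
    (hlip : ∀ s t, a ≤ s → s ≤ t → t ≤ c →
      ‖(A t (y s) - A s (y s)) - (A t (z s) - A s (z s))‖
        ≤ K * gauge34 (t - s) * ‖y s - z s‖)
    (hfour : ∀ r s t, a ≤ r → r ≤ s → s ≤ t → t ≤ c →
      ‖((A t (y s) - A s (y s)) - (A t (z s) - A s (z s))) -
        ((A t (y r) - A s (y r)) - (A t (z r) - A s (z r)))‖
        ≤ K * gauge34 (t - s) * (‖(y s - z s) - (y r - z r)‖ + ‖y s - y r‖ * ‖y r - z r‖))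
    (hMy : ∀ u v, a ≤ u → u ≤ v → v ≤ c → ‖y v - y u‖ ≤ M * gauge34 (v - u))
    (hsmall : 10 * K * (1 + M) * gauge34 (c - a) ≤ 1)
    (hD : ∀ u v, a ≤ u → u ≤ v → v ≤ c → ‖(y v - z v) - (y u - z u)‖ ≤ H * gauge34 (v - u))
    {u v : ℝ} (hu : a ≤ u) (huv : u ≤ v) (hv : v ≤ c) :
    ‖(y v - z v) - (y u - z u)‖ ≤ H / 2 * gauge34 (v - u) := by
  obtain ⟨C, hC, h⟩ := hy
  obtain ⟨C', hC', h'⟩ := hz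
  have hτ0 : 0 ≤ gauge34 (c - a) := gauge34_nonneg (by linarith)
  have hτ1 : gauge34 (c - a) ≤ 1 := by
    have : 0 ≤ (10 * K * (1 + M) - 1) * gauge34 (c - a) := by
      refine mul_nonneg ?_ hτ0
      nlinarith
    linarith
  have hbd : ∀ s, a ≤ s → s ≤ c → ‖y s - z s‖ ≤ H * gauge34 (c - a) := fun s hs hsc => by
    have := hD a s le_rfl hs hsc
    rw [hyz, sub_self, sub_zero] at this
    refine this.trans ?_
    gcongr
    exact gauge34_mono (by linarith) (by linarith)
  have hrem := le_of_midpoint_subadditive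
    (f := fun u v => ‖((y v - z v) - (y u - z u)) -
      ((A v (y u) - A u (y u)) - (A v (z u) - A u (z u)))‖)
    (a := a) (c := c) (G := C + C') (D := K * (H * (1 + M)))
    (fun u v hu huv hv => by
      refine le_trans (le_of_eq ?_) ((norm_sub_le_of_le (h u v hu huv hv)
        (h' u v hu huv hv)).trans (by linarith))
      congr 1; abel)
    (fun u v hu huv hv => by
      set m := (u + v) / 2 with hm
      have hum : u ≤ m := by linarith
      have hmv : m ≤ v := by linarith
      have g1 : gauge34 (m - u) ≤ gauge34 (v - u) := gauge34_mono (by linarith) (by linarith)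
      have g2 : gauge34 (v - m) ≤ gauge34 (v - u) := gauge34_mono (by linarith) (by linarith)
      have g3 : 0 ≤ gauge34 (m - u) := gauge34_nonneg (by linarith)
      have g4 : 0 ≤ gauge34 (v - m) := gauge34_nonneg (by linarith)
      have g5 : 0 ≤ gauge34 (v - u) := g3.trans g1
      have e1 := hfour u m v hu hum hmv hv
      have e2 := hD u m hu hum (hmv.trans hv)
      have e3 := hMy u m hu hum (hmv.trans hv)
      have e4 : ‖y u - z u‖ ≤ H := (hbd u hu (huv.trans hv)).trans
        (mul_le_of_le_one_right hH hτ1)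
      have e5 : ‖((A v (y m) - A m (y m)) - (A v (z m) - A m (z m))) -
        ((A v (y u) - A m (y u)) - (A v (z u) - A m (z u)))‖
          ≤ K * (H * (1 + M)) * gauge34 (v - u) ^ 2 := by
        calc _ ≤ K * gauge34 (v - m) *
              (‖(y m - z m) - (y u - z u)‖ + ‖y m - y u‖ * ‖y u - z u‖) := e1
          _ ≤ K * gauge34 (v - u) * (H * gauge34 (v - u) + M * gauge34 (v - u) * H) := by
              have e2' : ‖(y m - z m) - (y u - z u)‖ ≤ H * gauge34 (v - u) :=
                e2.trans (by gcongr)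
              have e3' : ‖y m - y u‖ ≤ M * gauge34 (v - u) := e3.trans (by gcongr)
              gcongr
          _ = _ := by ring
      refine le_trans (le_of_eq ?_) (norm_add_le_of_le (norm_add_le _ _) e5)
      congr 1; abel)
    (by positivity) (by positivity) hu huv hv
  have hg0 : 0 ≤ gauge34 (v - u) := gauge34_nonneg (by linarith)
  have hg1 : gauge34 (v - u) ≤ gauge34 (c - a) := gauge34_mono (by linarith) (by linarith)
  have e1 := hlip u v hu huv hv
  have e2 := hbd u hu (huv.trans hv)
  have e3 : 0 ≤ H * K * M * gauge34 (c - a) * gauge34 (v - u) := by positivity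
  calc ‖(y v - z v) - (y u - z u)‖
      = ‖(((y v - z v) - (y u - z u)) - ((A v (y u) - A u (y u)) - (A v (z u) - A u (z u)))) +
        ((A v (y u) - A u (y u)) - (A v (z u) - A u (z u)))‖ := by congr 1; abel
    _ ≤ 4 * (K * (H * (1 + M))) * gauge34 (v - u) ^ 2 +
        K * gauge34 (v - u) * ‖y u - z u‖ := norm_add_le_of_le hrem e1
    _ ≤ 4 * (K * (H * (1 + M))) * (gauge34 (v - u) * gauge34 (c - a)) +
        K * gauge34 (v - u) * (H * gauge34 (c - a)) := by
        rw [sq]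
        gcongr
    _ ≤ H / 2 * gauge34 (v - u) * (10 * K * (1 + M) * gauge34 (c - a)) := by nlinarith
    _ ≤ H / 2 * gauge34 (v - u) * 1 := by gcongr
    _ = _ := mul_one _

/-- Solutions with the same initial value coincide. -/
theorem eq_of_eq_left (hA : IsLocalYoungField T A) (ha : 0 ≤ a) (hc : c ≤ T)
    (hy : IsDavieSolution A a c y) (hz : IsDavieSolution A a c z) (hyz : y a = z a)
    {t : ℝ} (hat : a ≤ t) (htc : t ≤ c) : y t = z t := by
  obtain ⟨Ry, hRy⟩ := hy.exists_norm_le hA ha hc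
  obtain ⟨Rz, hRz⟩ := hz.exists_norm_le hA ha hc
  obtain ⟨My, hMy0, hMy⟩ := hy.exists_gauge34_holder hA ha hc
  obtain ⟨Mz, hMz0, hMz⟩ := hz.exists_gauge34_holder hA ha hc
  obtain ⟨K, hK, hb⟩ := hA.exists_gauge34_bounds (max Ry Rz)
  obtain ⟨τ, hτ, hτs⟩ := exists_gauge34_le (ε := 1 / (10 * K * (1 + My))) (by positivity)
  have hRy' : ∀ u, a ≤ u → u ≤ c → ‖y u‖ ≤ max Ry Rz := fun u h1 h2 =>
    (hRy u h1 h2).trans (le_max_left _ _)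
  have hRz' : ∀ u, a ≤ u → u ≤ c → ‖z u‖ ≤ max Ry Rz := fun u h1 h2 =>
    (hRz u h1 h2).trans (le_max_right _ _)
  have step : ∀ a' t', a ≤ a' → a' ≤ t' → t' ≤ c → t' ≤ a' + τ → y a' = z a' →
      y t' = z t' := by
    intro a' t' haa ha't ht'c ht'τ heq
    have hsmall : 10 * K * (1 + My) * gauge34 (t' - a') ≤ 1 := by
      have h1 : gauge34 (t' - a') ≤ gauge34 τ := gauge34_mono (by linarith) (by linarith)
      have h2 := h1.trans hτs
      rwa [le_div_iff₀ (by positivity), mul_comm] at h2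
    have iter : ∀ n : ℕ, ∀ u v, a' ≤ u → u ≤ v → v ≤ t' →
        ‖(y v - z v) - (y u - z u)‖ ≤ (My + Mz) * (1 / 2) ^ n * gauge34 (v - u) := by
      intro n
      induction n with
      | zero =>
        intro u v hu huv hv
        have e1 := hMy u v (haa.trans hu) huv (hv.trans ht'c)
        have e2 := hMz u v (haa.trans hu) huv (hv.trans ht'c)
        calc ‖(y v - z v) - (y u - z u)‖ = ‖(y v - y u) - (z v - z u)‖ := by congr 1; abel
          _ ≤ My * gauge34 (v - u) + Mz * gauge34 (v - u) := norm_sub_le_of_le e1 e2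
          _ = _ := by ring
      | succ n ih =>
        intro u v hu huv hv
        have := norm_sub_sub_sub_le_half (A := A) (a := a') (c := t') (y := y) (z := z)
          hK hMy0 (H := (My + Mz) * (1 / 2) ^ n) (by positivity) (hy.mono haa ht'c)
          (hz.mono haa ht'c) heq
          (fun s t hs hst ht => (hb s t (by linarith) hst (by linarith)).2.1 _ _
            (hRy' s (by linarith) (by linarith)) (hRz' s (by linarith) (by linarith)))
          (fun r s t hr hrs hst ht => (hb s t (by linarith) hst (by linarith)).2.2 _ _ _ _
            (hRy' r (by linarith) (by linarith)) (hRz' r (by linarith) (by linarith))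
            (hRy' s (by linarith) (by linarith)) (hRz' s (by linarith) (by linarith)))
          (fun u v hu huv hv => hMy u v (by linarith) huv (by linarith))
          hsmall ih hu huv hv
        refine this.trans_eq ?_
        rw [pow_succ]
        ring
    have hlim : Tendsto (fun n : ℕ => (My + Mz) * (1 / 2 : ℝ) ^ n * gauge34 (t' - a')) atTop
        (nhds ((My + Mz) * 0 * gauge34 (t' - a'))) :=
      ((tendsto_pow_atTop_nhds_zero_of_lt_one (by norm_num) (by norm_num)).const_mul _).mul_const _
    have h0 := ge_of_tendsto' hlim fun n => iter n a' t' le_rfl ha't le_rfl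
    rw [heq, sub_self, sub_zero, mul_zero, zero_mul] at h0
    exact sub_eq_zero.mp (norm_le_zero_iff.mp h0)
  have hind : ∀ n : ℕ, ∀ t', a ≤ t' → t' ≤ c → t' ≤ a + n * τ → y t' = z t' := by
    intro n
    induction n with
    | zero =>
      intro t' h1 h2 h3
      have : t' = a := le_antisymm (by simpa using h3) h1
      rw [this, hyz]
    | succ n ih =>
      intro t' h1 h2 h3
      rcases le_total t' (a + n * τ) with h4 | h4
      · exact ih t' h1 h2 h4
      · have h5 : a ≤ a + n * τ := by
          have : 0 ≤ (n:ℝ) * τ := by positivity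
          linarith
        push_cast at h3
        exact step (a + n * τ) t' h5 h4 h2 (by linarith) (ih _ h5 (h4.trans h2) le_rfl)
  obtain ⟨n, hn⟩ := exists_nat_ge ((t - a) / τ)
  rw [div_le_iff₀ hτ] at hn
  exact hind n t hat htc (by linarith)

end IsDavieSolution

end DavieSolutions

section EulerScheme

variable {E : Type*} [NormedAddCommGroup E]

theorem norm_sub_le_of_norm_remainder_le {x x' Δ : E} {K g : ℝ} (hK : 0 ≤ K) (hg : 0 ≤ g)
    (hΔ : ‖Δ‖ ≤ K * g) (hrem : ‖x' - x - Δ‖ ≤ 20 * K ^ 2 * g ^ 2) (hsmall : 20 * K * g ≤ 1) :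
    ‖x' - x‖ ≤ 2 * K * g := by
  calc ‖x' - x‖ = ‖Δ + (x' - x - Δ)‖ := by congr 1; abel
    _ ≤ K * g + 20 * K ^ 2 * g ^ 2 := norm_add_le_of_le hΔ hrem
    _ = K * g * (1 + 20 * K * g) := by ring
    _ ≤ K * g * (1 + 1) := by gcongr
    _ = _ := by ring

/-- Davie's estimate for the remainder of an Euler scheme, uniform in the number of steps. -/
theorem norm_euler_remainder_le {a : ℕ → E → E} {x : ℕ → E} {N : ℕ} {h K : ℝ} (hh : 0 ≤ h)
    (hK : 0 ≤ K) (hx : ∀ k < N, x (k + 1) = x k + (a (k + 1) (x k) - a k (x k)))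
    (hbd : ∀ k n, k + n ≤ N → ‖a (k + n) (x k) - a k (x k)‖ ≤ K * gauge34 (n * h))
    (hlip : ∀ k p q, k + p + q ≤ N →
      ‖(a (k + p + q) (x (k + p)) - a (k + p) (x (k + p))) -
        (a (k + p + q) (x k) - a (k + p) (x k))‖ ≤ K * gauge34 (q * h) * ‖x (k + p) - x k‖)
    (hsmall : 20 * K * gauge34 (N * h) ≤ 1) (n : ℕ) :
    ∀ k, k + n ≤ N → ‖x (k + n) - x k - (a (k + n) (x k) - a k (x k))‖
      ≤ 20 * K ^ 2 * gauge34 (n * h) ^ 2 := by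
  have hmono : ∀ {i j : ℕ}, i ≤ j → gauge34 (i * h) ≤ gauge34 (j * h) := fun {i j} hij =>
    gauge34_mono (by positivity) (by gcongr)
  have hnn : ∀ i : ℕ, 0 ≤ gauge34 (i * h) := fun i => gauge34_nonneg (by positivity)
  have hsm : ∀ i ≤ N, 20 * K * gauge34 (i * h) ≤ 1 := fun i hi =>
    le_trans (by have := hmono hi; gcongr) hsmall
  induction n using Nat.strong_induction_on with
  | _ n ih =>
    intro k hkn
    rcases Nat.eq_zero_or_pos n with rfl | hn
    · simp only [Nat.add_zero, sub_self, norm_zero]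
      positivity
    obtain ⟨p, q, hpq, hp, hq⟩ : ∃ p q, n = p + 1 + q ∧ 2 * p ≤ n ∧ 2 * q ≤ n :=
      ⟨n / 2, n - n / 2 - 1, by omega, by omega, by omega⟩
    have J1 := ih p (by omega) k (by omega)
    have J2 := ih q (by omega) (k + p + 1) (by omega)
    have E0 := hx (k + p) (by omega)
    have d1 : ‖x (k + p) - x k‖ ≤ 2 * K * gauge34 (p * h) :=
      norm_sub_le_of_norm_remainder_le hK (hnn p) (hbd k p (by omega)) J1 (hsm p (by omega))
    have b1 := hbd (k + p) 1 (by omega)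
    have L1 := hlip k p 1 (by omega)
    have L2 := hlip k (p + 1) q (by omega)
    rw [← add_assoc] at L2
    have d2 : ‖x (k + p + 1) - x k‖ ≤ 2 * K * gauge34 (p * h) + K * gauge34 ((1 : ℕ) * h) := by
      calc _ = ‖(x (k + p) - x k) + (a (k + p + 1) (x (k + p)) - a (k + p) (x (k + p)))‖ := by
            rw [E0]; congr 1; abel
        _ ≤ _ := norm_add_le_of_le d1 b1
    have g0 := hnn n
    have gp : gauge34 (p * h) ≤ gauge34 (n * h) := hmono (by omega)
    have gq : gauge34 (q * h) ≤ gauge34 (n * h) := hmono (by omega)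
    have g1 : gauge34 ((1 : ℕ) * h) ≤ gauge34 (n * h) := hmono hn
    have half : ∀ i : ℕ, 2 * i ≤ n → gauge34 (i * h) ^ 2 ≤ gauge34 (n * h / 2) ^ 2 := by
      intro i hi
      have hi' : (2:ℝ) * i ≤ n := by exact_mod_cast hi
      have : (i:ℝ) * h ≤ n * h / 2 := by nlinarith
      exact pow_le_pow_left₀ (hnn i) (gauge34_mono (by positivity) this) 2
    have hhalf := two_mul_gauge34_half_sq_le (r := n * h) (by positivity)
    have L1' : ‖(a (k + p + 1) (x (k + p)) - a (k + p) (x (k + p))) -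
        (a (k + p + 1) (x k) - a (k + p) (x k))‖ ≤ 2 * K ^ 2 * gauge34 (n * h) ^ 2 := by
      calc _ ≤ K * gauge34 ((1 : ℕ) * h) * ‖x (k + p) - x k‖ := L1
        _ ≤ K * gauge34 (n * h) * (2 * K * gauge34 (n * h)) := by
          have := d1.trans (mul_le_mul_of_nonneg_left gp (by positivity))
          gcongr
        _ = _ := by ring
    have L2' : ‖(a (k + p + 1 + q) (x (k + p + 1)) - a (k + p + 1) (x (k + p + 1))) -
        (a (k + p + 1 + q) (x k) - a (k + p + 1) (x k))‖ ≤ 3 * K ^ 2 * gauge34 (n * h) ^ 2 := by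
      calc _ ≤ K * gauge34 (q * h) * ‖x (k + p + 1) - x k‖ := L2
        _ ≤ K * gauge34 (n * h) * (2 * K * gauge34 (n * h) + K * gauge34 (n * h)) := by
          have : ‖x (k + p + 1) - x k‖ ≤ 2 * K * gauge34 (n * h) + K * gauge34 (n * h) :=
            d2.trans (by gcongr)
          gcongr
        _ = _ := by ring
    have hkn' : k + n = k + p + 1 + q := by omega
    rw [hkn']
    calc _ = ‖(x (k + p) - x k - (a (k + p) (x k) - a k (x k))) +
          (x (k + p + 1 + q) - x (k + p + 1) -
            (a (k + p + 1 + q) (x (k + p + 1)) - a (k + p + 1) (x (k + p + 1)))) +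
          ((a (k + p + 1) (x (k + p)) - a (k + p) (x (k + p))) -
            (a (k + p + 1) (x k) - a (k + p) (x k))) +
          ((a (k + p + 1 + q) (x (k + p + 1)) - a (k + p + 1) (x (k + p + 1))) -
            (a (k + p + 1 + q) (x k) - a (k + p + 1) (x k)))‖ := by
          have E1 : a (k + p + 1) (x (k + p)) - a (k + p) (x (k + p)) =
            x (k + p + 1) - x (k + p) := by rw [E0]; abel
          rw [E1]; congr 1; abel
      _ ≤ 20 * K ^ 2 * gauge34 (p * h) ^ 2 + 20 * K ^ 2 * gauge34 (q * h) ^ 2 +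
          2 * K ^ 2 * gauge34 (n * h) ^ 2 + 3 * K ^ 2 * gauge34 (n * h) ^ 2 :=
        norm_add_le_of_le (norm_add_le_of_le (norm_add_le_of_le J1 J2) L1') L2'
      _ ≤ 20 * K ^ 2 * gauge34 (n * h / 2) ^ 2 + 20 * K ^ 2 * gauge34 (n * h / 2) ^ 2 +
          2 * K ^ 2 * gauge34 (n * h) ^ 2 + 3 * K ^ 2 * gauge34 (n * h) ^ 2 := by
        have h1 := half p hp
        have h2 := half q hq
        gcongr
      _ ≤ _ := by nlinarith [mul_le_mul_of_nonneg_left hhalf (sq_nonneg K)]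

/-- Euler schemes started in a fixed ball stay bounded for a uniform time and satisfy Davie's
estimate uniformly in the step size. -/
theorem IsLocalYoungField.exists_euler {T : ℝ} {A : ℝ → E → E} (hA : IsLocalYoungField T A)
    (R : ℝ) : ∃ C τ : ℝ, 0 ≤ C ∧ 0 < τ ∧ ∀ (s : ℝ) (x₀ : E) (N : ℕ) (h : ℝ), 0 ≤ s → ‖x₀‖ ≤ R →
      0 ≤ h → N * h ≤ τ → s + N * h ≤ T → ∃ x : ℕ → E, x 0 = x₀ ∧ (∀ k ≤ N, ‖x k‖ ≤ R + 1) ∧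
        ∀ k n, k + n ≤ N →
          ‖x (k + n) - x k - (A (s + (k + n : ℕ) * h) (x k) - A (s + k * h) (x k))‖
            ≤ C * gauge34 (n * h) ^ 2 := by
  obtain ⟨K, hK, hb⟩ := hA.exists_gauge34_bounds (R + 1)
  have hK0 : 0 ≤ K := by linarith
  obtain ⟨τ, hτ, hτs⟩ := exists_gauge34_le (ε := 1 / (20 * K)) (by positivity)
  refine ⟨20 * K ^ 2, τ, by positivity, hτ, fun s x₀ N h hs hx₀ hh hNτ hNT => ?_⟩
  set a : ℕ → E → E := fun k => A (s + k * h) with ha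
  let x : ℕ → E := fun k => Nat.rec x₀ (fun k xk => xk + (a (k + 1) xk - a k xk)) k
  have hx : ∀ k, x (k + 1) = x k + (a (k + 1) (x k) - a k (x k)) := fun k => rfl
  have hsm : ∀ n ≤ N, 20 * K * gauge34 (n * h) ≤ 1 := fun n hn => by
    have hn' : (n:ℝ) * h ≤ τ := le_trans (by gcongr) hNτ
    have := (gauge34_mono (by positivity) hn').trans hτs
    rwa [le_div_iff₀ (by positivity), mul_comm] at this
  have times : ∀ k n : ℕ, k + n ≤ N → 0 ≤ s + k * h ∧ s + k * h ≤ s + (k + n : ℕ) * h ∧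
      s + (k + n : ℕ) * h ≤ T ∧ s + (k + n : ℕ) * h - (s + k * h) = n * h := fun k n hkn => by
    have h1 : (0:ℝ) ≤ k * h := by positivity
    have h2 : (0:ℝ) ≤ n * h := by positivity
    have h3 : ((k + n : ℕ) : ℝ) * h ≤ N * h := by gcongr
    push_cast at h3 ⊢
    refine ⟨by linarith, by linarith, by linarith, by ring⟩
  have bd : ∀ M ≤ N, (∀ k ≤ M, ‖x k‖ ≤ R + 1) → ∀ k n, k + n ≤ M →
      ‖a (k + n) (x k) - a k (x k)‖ ≤ K * gauge34 (n * h) := fun M hM hball k n hkn => by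
    obtain ⟨t1, t2, t3, t4⟩ := times k n (by omega)
    have := (hb _ _ t1 t2 t3).1 (x k) (hball k (by omega))
    rwa [t4] at this
  have rem : ∀ M ≤ N, (∀ k ≤ M, ‖x k‖ ≤ R + 1) → ∀ k n, k + n ≤ M →
      ‖x (k + n) - x k - (a (k + n) (x k) - a k (x k))‖ ≤ 20 * K ^ 2 * gauge34 (n * h) ^ 2 := by
    intro M hM hball k n hkn
    refine norm_euler_remainder_le hh hK0 (fun k _ => hx k) (bd M hM hball)
      (fun k p q hkpq => ?_) (hsm M hM) n k hkn
    obtain ⟨t1, t2, t3, t4⟩ := times (k + p) q (by omega)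
    have := (hb _ _ t1 t2 t3).2.1 (x (k + p)) (x k) (hball _ (by omega)) (hball _ (by omega))
    rwa [t4] at this
  have ball : ∀ M ≤ N, ∀ k ≤ M, ‖x k‖ ≤ R + 1 / 2 := by
    intro M
    induction M with
    | zero =>
      intro _ k hk
      obtain rfl : k = 0 := by omega
      change ‖x₀‖ ≤ _
      linarith
    | succ M ih =>
      intro hM
      have ihM := ih (by omega)
      have hstep : ‖x (M + 1)‖ ≤ R + 1 := by
        have h2 : ‖a (M + 1) (x M) - a M (x M)‖ ≤ K * gauge34 ((1 : ℕ) * h) := by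
          obtain ⟨t1, t2, t3, t4⟩ := times M 1 hM
          have := (hb _ _ t1 t2 t3).1 (x M) ((ihM M le_rfl).trans (by linarith))
          rwa [t4] at this
        have h3 := hsm 1 (by omega)
        rw [hx]
        refine (norm_add_le_of_le (ihM M le_rfl) h2).trans ?_
        generalize gauge34 (((1 : ℕ) : ℝ) * h) = g at h3 ⊢
        linarith
      have hball : ∀ k ≤ M + 1, ‖x k‖ ≤ R + 1 := fun k hk => by
        rcases Nat.lt_or_ge M k with hk' | hk'
        · obtain rfl : k = M + 1 := by omega
          exact hstep
        · exact (ihM k hk').trans (by linarith)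
      intro k hk
      have h1 := rem (M + 1) hM hball 0 k (by omega)
      have h2 := bd (M + 1) hM hball 0 k (by omega)
      have hk0 : 0 ≤ gauge34 ((k:ℝ) * h) := gauge34_nonneg (by positivity)
      have h3 := norm_sub_le_of_norm_remainder_le hK0 hk0 h2 h1 (hsm k (by omega))
      have h4 := hsm k (by omega)
      rw [zero_add] at h3
      calc ‖x k‖ = ‖x 0 + (x k - x 0)‖ := by congr 1; abel
        _ ≤ R + 2 * K * gauge34 (k * h) := norm_add_le_of_le hx₀ h3
        _ ≤ _ := by linarith
  exact ⟨x, rfl, fun k hk => (ball N le_rfl k hk).trans (by linarith),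
    rem N le_rfl fun k hk => (ball N le_rfl k hk).trans (by linarith)⟩

theorem IsLocalYoungField.tendsto {T : ℝ} {A : ℝ → E → E} (hA : IsLocalYoungField T A)
    {ι : Type*} {l : Filter ι} {t : ι → ℝ} {x : ι → E} {t₀ : ℝ} {x₀ : E} {R : ℝ}
    (ht : ∀ i, t i ∈ Set.Icc 0 T) (ht₀ : t₀ ∈ Set.Icc 0 T) (hx : ∀ i, ‖x i‖ ≤ R) (hx₀ : ‖x₀‖ ≤ R)
    (htlim : Tendsto t l (nhds t₀)) (hxlim : Tendsto x l (nhds x₀)) :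
    Tendsto (fun i => A (t i) (x i)) l (nhds (A t₀ x₀)) := by
  obtain ⟨K, hK, hb⟩ := hA.exists_gauge34_bounds R
  have htime : ∀ r ∈ Set.Icc 0 T, ∀ r' ∈ Set.Icc 0 T, ∀ z, ‖z‖ ≤ R →
      ‖A r z - A r' z‖ ≤ K * gauge34 |r - r'| := by
    intro r hr r' hr' z hz
    rcases le_total r r' with h | h
    · rw [norm_sub_rev, abs_sub_comm, abs_of_nonneg (sub_nonneg.mpr h)]
      exact (hb r r' hr.1 h hr'.2).1 z hz
    · rw [abs_of_nonneg (sub_nonneg.mpr h)]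
      exact (hb r' r hr'.1 h hr.2).1 z hz
  have hlim : Tendsto (fun i => K * gauge34 |t i - t₀| + K * gauge34 (t₀ - 0) * ‖x i - x₀‖) l
      (nhds (K * gauge34 |t₀ - t₀| + K * gauge34 (t₀ - 0) * ‖x₀ - x₀‖)) :=
    (((continuous_gauge34.tendsto _).comp (htlim.sub_const t₀).abs).const_mul K).add
      ((hxlim.sub_const x₀).norm.const_mul _)
  rw [sub_self, abs_zero, gauge34_zero, sub_self, norm_zero, mul_zero, mul_zero, add_zero] at hlim
  rw [tendsto_iff_norm_sub_tendsto_zero]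
  refine squeeze_zero (fun _ => norm_nonneg _) (fun i => ?_) hlim
  have h1 := htime (t i) (ht i) t₀ ht₀ (x i) (hx i)
  have h2 := (hb 0 t₀ le_rfl ht₀.1 ht₀.2).2.1 (x i) x₀ (hx i) hx₀
  simp only [hA.zero, sub_zero] at h2
  rw [sub_zero]
  calc _ = ‖(A (t i) (x i) - A t₀ (x i)) + (A t₀ (x i) - A t₀ x₀)‖ := by congr 1; abel
    _ ≤ _ := norm_add_le_of_le h1 h2

/-- Local existence, for a time which is uniform over initial values in a ball. -/
theorem IsLocalYoungField.exists_isDavieSolution [ProperSpace E] {T : ℝ} {A : ℝ → E → E}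
    (hA : IsLocalYoungField T A) (R : ℝ) : ∃ τ : ℝ, 0 < τ ∧ ∀ (s : ℝ) (x₀ : E), 0 ≤ s → s ≤ T →
      ‖x₀‖ ≤ R → ∃ y : ℝ → E, y s = x₀ ∧ IsDavieSolution A s (min (s + τ) T) y := by
  obtain ⟨C, τ, hC, hτ, hE⟩ := hA.exists_euler R
  refine ⟨τ, hτ, fun s x₀ hs hsT hx₀ => ?_⟩
  set c := min (s + τ) T with hcdef
  have hsc : s ≤ c := le_min (by linarith) hsT
  have hcτ : c - s ≤ τ := by linarith [min_le_left (s + τ) T]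
  have hcT : c ≤ T := min_le_right _ _
  let h : ℕ → ℝ := fun j => (c - s) / (j + 1 : ℕ)
  have hh : ∀ j, 0 ≤ h j := fun j => div_nonneg (by linarith) (by positivity)
  have hNh : ∀ j, ((j + 1 : ℕ) : ℝ) * h j = c - s := fun j => by
    simp only [h]
    field_simp
  choose x hx0 hxR hxrem using fun j => hE s x₀ (j + 1) (h j) hs hx₀ (hh j)
    (by rw [hNh]; exact hcτ) (by rw [hNh]; linarith)
  let idx : ℕ → ℝ → ℕ := fun j t => min ⌊(t - s) / h j⌋₊ (j + 1)
  have hidx : ∀ j t, idx j t ≤ j + 1 := fun j t => min_le_right _ _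
  have hidxmono : ∀ j u v, u ≤ v → idx j u ≤ idx j v := fun j u v huv =>
    min_le_min_right _ (Nat.floor_mono (div_le_div_of_nonneg_right (by linarith) (hh j)))
  let g : ℕ → ℝ → ℝ := fun j t => s + idx j t * h j
  have hg : ∀ t, s ≤ t → t ≤ c → ∀ j, |g j t - t| ≤ h j := by
    intro t hst htc j
    rcases (hh j).eq_or_lt with h0 | h0
    · have : c - s = 0 := by rw [← hNh j, ← h0, mul_zero]
      have : t = s := by linarith
      simp [g, ← h0, this]
    · have hle : (t - s) / h j ≤ (j + 1 : ℕ) := by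
        rw [div_le_iff₀ h0, hNh]; linarith
      have hfl : idx j t = ⌊(t - s) / h j⌋₊ :=
        min_eq_left (Nat.floor_le_of_le hle)
      have h1 := Nat.floor_le (a := (t - s) / h j) (div_nonneg (by linarith) h0.le)
      have h2 := Nat.lt_floor_add_one ((t - s) / h j)
      rw [le_div_iff₀ h0] at h1
      rw [div_lt_iff₀ h0] at h2
      simp only [g, hfl]
      rw [abs_le]
      constructor <;> linarith
  have hgI : ∀ j t, g j t ∈ Set.Icc 0 T := by
    intro j t
    have h1 : (0:ℝ) ≤ idx j t * h j := mul_nonneg (by positivity) (hh j)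
    have h2 : (idx j t : ℝ) * h j ≤ c - s := by
      rw [← hNh j]
      exact mul_le_mul_of_nonneg_right (by exact_mod_cast hidx j t) (hh j)
    simp only [g]
    constructor <;> linarith
  have hhlim : Tendsto h atTop (nhds 0) := by
    have := tendsto_const_div_atTop_nhds_zero_nat (c - s)
    exact this.comp (tendsto_add_atTop_nat 1)
  have hglim : ∀ t, s ≤ t → t ≤ c → Tendsto (fun j => g j t) (hyperfilter ℕ) (nhds t) := by
    intro t hst htc
    rw [tendsto_iff_norm_sub_tendsto_zero]
    exact squeeze_zero (fun _ => norm_nonneg _) (hg t hst htc)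
      (hhlim.mono_left Nat.hyperfilter_le_atTop)
  have hlim : ∀ t, ∃ z : E, ‖z‖ ≤ R + 1 ∧
      Tendsto (fun j => x j (idx j t)) (hyperfilter ℕ) (nhds z) := by
    intro t
    obtain ⟨z, hz, hz'⟩ := (isCompact_closedBall (0 : E) (R + 1)).ultrafilter_le_nhds
      ((hyperfilter ℕ).map fun j => x j (idx j t)) (by
        rw [le_principal_iff]
        exact mem_map.mpr (univ_mem' fun j => mem_closedBall_zero_iff.mpr (hxR j _ (hidx j t))))
    exact ⟨z, mem_closedBall_zero_iff.mp hz, hz'⟩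
  choose y hyR hy using hlim
  refine ⟨y, ?_, C, hC, fun u v hu huv hv => ?_⟩
  · refine tendsto_nhds_unique (hy s) ?_
    have : ∀ j, x j (idx j s) = x₀ := fun j => by simp [idx, hx0]
    simp only [this]
    exact tendsto_const_nhds
  · have hlu := hglim u hu (huv.trans hv)
    have hlv := hglim v (hu.trans huv) hv
    have huI : u ∈ Set.Icc 0 T := ⟨by linarith, by linarith⟩
    have hvI : v ∈ Set.Icc 0 T := ⟨by linarith, by linarith⟩
    have hxb : ∀ j, ‖x j (idx j u)‖ ≤ R + 1 := fun j => hxR j _ (hidx j u)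
    have hL := (((hy v).sub (hy u)).sub
      ((hA.tendsto (fun j => hgI j v) hvI hxb (hyR u) hlv (hy u)).sub
        (hA.tendsto (fun j => hgI j u) huI hxb (hyR u) hlu (hy u)))).norm
    have hRt := (((continuous_gauge34.tendsto _).comp (hlv.sub hlu)).pow 2).const_mul C
    refine le_of_tendsto_of_tendsto' hL hRt fun j => ?_
    obtain ⟨n, hn⟩ := Nat.exists_eq_add_of_le (hidxmono j u v huv)
    have := hxrem j (idx j u) n (by rw [← hn]; exact hidx j v)
    rw [← hn] at this
    refine this.trans_eq ?_
    have hgap : (n:ℝ) * h j = g j v - g j u := by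
      simp only [g, hn]
      push_cast
      ring
    rw [hgap]
    rfl

end EulerScheme

section RiemannSums

variable {V : Type*} [NormedAddCommGroup V]

theorem mem_Icc_of_partition {k : ℕ} {p : ℕ → ℝ} {s t : ℝ} (h0 : p 0 = s) (hk : p k = t)
    (hmono : ∀ i < k, p i ≤ p (i + 1)) {i : ℕ} (hi : i ≤ k) : p i ∈ Set.Icc s t := by
  constructor
  · induction i with
    | zero => exact h0.ge
    | succ i ih => exact (ih (by omega)).trans (hmono i (by omega))
  · rw [← hk]
    induction hi using Nat.decreasingInduction with
    | self => exact le_rfl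
    | of_succ i hi ih => exact (hmono i hi).trans ih

/-- Riemann sums over `[u, v]` converge as soon as they converge over `[s, u]` and `[s, v]`. -/
theorem RiemannConv.sub {Xi : ℝ → ℝ → V} {s u v : ℝ} {I I' : V} (hsu : s ≤ u)
    (hu : RiemannConv Xi s u I) (hv : RiemannConv Xi s v I') : RiemannConv Xi u v (I' - I) := by
  intro ε hε
  obtain ⟨δ, hδ, h⟩ := hu (ε / 2) (by positivity)
  obtain ⟨δ', hδ', h'⟩ := hv (ε / 2) (by positivity)
  refine ⟨min δ δ', lt_min hδ hδ', fun k p hp0 hpk hmono hmesh => ?_⟩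
  obtain ⟨n, hn⟩ := exists_nat_gt ((u - s) / min δ δ')
  have hn0 : (0:ℝ) < n := lt_of_le_of_lt (div_nonneg (by linarith) (lt_min hδ hδ').le) hn
  have hstep : (u - s) / n ≤ min δ δ' := by
    rw [div_lt_iff₀ (lt_min hδ hδ')] at hn
    rw [div_le_iff₀ hn0]
    linarith
  set q : ℕ → ℝ := fun i => s + i * ((u - s) / n) with hq
  have hq0 : q 0 = s := by simp [hq]
  have hqn : q n = u := by simp only [hq]; field_simp; ring
  have hqs : ∀ i, q (i + 1) - q i = (u - s) / n := fun i => by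
    simp only [hq]; push_cast; ring
  have hqs0 : 0 ≤ (u - s) / n := div_nonneg (by linarith) hn0.le
  set r : ℕ → ℝ := fun i => if i < n then q i else p (i - n) with hr
  have hrl : ∀ i ≤ n, r i = q i := fun i hi => by
    rcases hi.lt_or_eq with h1 | rfl
    · simp [hr, h1]
    · simp [hr, hp0, hqn]
  have hrr : ∀ i, r (n + i) = p i := fun i => by simp [hr]
  have e1 := h n q hq0 hqn (fun i _ => by linarith [hqs i])
    (fun i _ => (hqs i).le.trans (hstep.trans (min_le_left _ _)))
  have hri : ∀ i < n + k, r i ≤ r (i + 1) ∧ r (i + 1) - r i ≤ δ' := fun i hi => by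
    rcases Nat.lt_or_ge i n with h1 | h1
    · rw [hrl i h1.le, hrl (i + 1) h1]
      exact ⟨by linarith [hqs i], (hqs i).le.trans (hstep.trans (min_le_right _ _))⟩
    · obtain ⟨j, rfl⟩ := Nat.exists_eq_add_of_le h1
      rw [add_assoc, hrr, hrr]
      exact ⟨hmono j (by omega), (hmesh j (by omega)).trans (min_le_right _ _)⟩
  have e2 := h' (n + k) r (by rw [hrl 0 (Nat.zero_le _), hq0]) (by rw [hrr, hpk])
    (fun i hi => (hri i hi).1) (fun i hi => (hri i hi).2)
  have hsum : ∑ i ∈ Finset.range (n + k), Xi (r i) (r (i + 1)) =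
      ∑ i ∈ Finset.range n, Xi (q i) (q (i + 1)) + ∑ i ∈ Finset.range k, Xi (p i) (p (i + 1)) := by
    rw [Finset.sum_range_add]
    congr 1
    · refine Finset.sum_congr rfl fun i hi => ?_
      have := Finset.mem_range.mp hi
      rw [hrl i this.le, hrl (i + 1) this]
    · refine Finset.sum_congr rfl fun i _ => ?_
      rw [add_assoc, hrr, hrr]
  rw [hsum] at e2
  calc _ = ‖(∑ i ∈ Finset.range n, Xi (q i) (q (i + 1)) +
        ∑ i ∈ Finset.range k, Xi (p i) (p (i + 1)) - I') -
        (∑ i ∈ Finset.range n, Xi (q i) (q (i + 1)) - I)‖ := by congr 1; abel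
    _ ≤ _ := norm_sub_le _ _
    _ < ε / 2 + ε / 2 := add_lt_add e2 e1
    _ = ε := add_halves ε

/-- Riemann sum over the dyadic partition of `[u, v]` into `2 ^ n` intervals. -/
def dyadicSum (Xi : ℝ → ℝ → V) (n : ℕ) (u v : ℝ) : V :=
  ∑ i ∈ Finset.range (2 ^ n),
    Xi (u + i * ((v - u) / 2 ^ n)) (u + (i + 1 : ℕ) * ((v - u) / 2 ^ n))

theorem dyadicSum_zero (Xi : ℝ → ℝ → V) (u v : ℝ) : dyadicSum Xi 0 u v = Xi u v := by
  simp [dyadicSum]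

theorem dyadicSum_succ (Xi : ℝ → ℝ → V) (n : ℕ) (u v : ℝ) :
    dyadicSum Xi (n + 1) u v =
      dyadicSum Xi n u ((u + v) / 2) + dyadicSum Xi n ((u + v) / 2) v := by
  have h2 : (2:ℝ) ^ n ≠ 0 := by positivity
  simp only [dyadicSum]
  rw [pow_succ, mul_two, Finset.sum_range_add]
  congr 1
  · refine Finset.sum_congr rfl fun i _ => ?_
    congr 1 <;> · rw [pow_succ]; field_simp; ring
  · refine Finset.sum_congr rfl fun i _ => ?_
    congr 1 <;> · rw [pow_succ]; push_cast; field_simp; ring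

/-- The sewing estimate for a germ whose Riemann sums converge. -/
theorem RiemannConv.norm_sub_le {Xi : ℝ → ℝ → V} {a c D : ℝ} {I : V} (hac : a ≤ c)
    (hD : 0 ≤ D) (hI : RiemannConv Xi a c I)
    (hXi : ∀ u v, a ≤ u → u ≤ v → v ≤ c →
      ‖Xi u ((u + v) / 2) + Xi ((u + v) / 2) v - Xi u v‖ ≤ D * gauge34 (v - u) ^ 2) :
    ‖I - Xi a c‖ ≤ 4 * D * gauge34 (c - a) ^ 2 := by
  have key : ∀ n : ℕ, ∀ u v, a ≤ u → u ≤ v → v ≤ c →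
      ‖dyadicSum Xi n u v - Xi u v‖ ≤ 4 * D * gauge34 (v - u) ^ 2 := by
    intro n
    induction n with
    | zero =>
      intro u v _ _ _
      rw [dyadicSum_zero, sub_self, norm_zero]
      positivity
    | succ n ih =>
      intro u v hu huv hv
      have h1 := ih u ((u + v) / 2) hu (by linarith) (by linarith)
      have h2 := ih ((u + v) / 2) v (by linarith) (by linarith) hv
      rw [show (u + v) / 2 - u = (v - u) / 2 by ring] at h1
      rw [show v - (u + v) / 2 = (v - u) / 2 by ring] at h2
      have h3 := two_mul_gauge34_half_sq_le (sub_nonneg.mpr huv)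
      have h4 := norm_add_le_of_le (norm_add_le_of_le h1 h2) (hXi u v hu huv hv)
      rw [dyadicSum_succ]
      calc _ = ‖(dyadicSum Xi n u ((u + v) / 2) - Xi u ((u + v) / 2)) +
            (dyadicSum Xi n ((u + v) / 2) v - Xi ((u + v) / 2) v) +
            (Xi u ((u + v) / 2) + Xi ((u + v) / 2) v - Xi u v)‖ := by congr 1; abel
        _ ≤ _ := h4
        _ ≤ _ := by nlinarith [mul_le_mul_of_nonneg_left h3 hD]
  refine le_of_forall_pos_le_add fun ε hε => ?_
  obtain ⟨δ, hδ, h⟩ := hI ε hε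
  obtain ⟨n, hn⟩ := pow_unbounded_of_one_lt ((c - a) / δ) (one_lt_two (α := ℝ))
  rw [div_lt_iff₀ hδ] at hn
  have hstep : ∀ i : ℕ, (a + (i + 1 : ℕ) * ((c - a) / 2 ^ n)) - (a + i * ((c - a) / 2 ^ n)) =
      (c - a) / 2 ^ n := fun i => by push_cast; ring
  have hpos : 0 ≤ (c - a) / 2 ^ n := div_nonneg (by linarith) (by positivity)
  have h1 := h (2 ^ n) (fun i => a + i * ((c - a) / 2 ^ n)) (by simp)
    (by push_cast; field_simp; ring) (fun i _ => by linarith [hstep i])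
    (fun i _ => by
      rw [hstep, div_le_iff₀ (by positivity)]
      linarith)
  have h2 := key n a c le_rfl hac le_rfl
  calc ‖I - Xi a c‖ = ‖(dyadicSum Xi n a c - Xi a c) - (dyadicSum Xi n a c - I)‖ := by
        congr 1; abel
    _ ≤ _ := norm_sub_le_of_le h2 h1.le

variable {T : ℝ} {A : ℝ → V → V} {c : ℝ} {y : ℝ → V}

theorem IsDavieSolution.riemannConv (hc : 0 ≤ c) (h : IsDavieSolution A 0 c y) :
    RiemannConv (fun u v => A v (y u) - A u (y u)) 0 c (y c - y 0) := by
  obtain ⟨C, hC, h⟩ := h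
  intro ε hε
  set η := ε / (C * c + 1) with hη
  have hη0 : 0 < η := by positivity
  refine ⟨η ^ 2, by positivity, fun k p hp0 hpk hmono hmesh => ?_⟩
  have htel : y c - y 0 = ∑ i ∈ Finset.range k, (y (p (i + 1)) - y (p i)) := by
    rw [Finset.sum_range_sub (fun i => y (p i)), hp0, hpk]
  rw [htel, ← Finset.sum_sub_distrib]
  have hterm : ∀ i ∈ Finset.range k,
      ‖(A (p (i + 1)) (y (p i)) - A (p i) (y (p i))) - (y (p (i + 1)) - y (p i))‖
        ≤ C * η * (p (i + 1) - p i) := by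
    intro i hi
    have hi := Finset.mem_range.mp hi
    have h1 := mem_Icc_of_partition hp0 hpk hmono hi.le
    have h2 := mem_Icc_of_partition hp0 hpk hmono (Nat.succ_le_of_lt hi)
    have h3 : 0 ≤ p (i + 1) - p i := sub_nonneg.mpr (hmono i hi)
    rw [norm_sub_rev]
    refine (h _ _ h1.1 (hmono i hi) h2.2).trans ?_
    rw [gauge34_sq h3, show (3 / 2 : ℝ) = 1 + 1 / 2 by norm_num,
      Real.rpow_add_of_nonneg h3 (by norm_num) (by norm_num), Real.rpow_one, ← Real.sqrt_eq_rpow,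
      mul_assoc C η, mul_comm η]
    have : √(p (i + 1) - p i) ≤ η := Real.sqrt_le_iff.mpr ⟨hη0.le, hmesh i hi⟩
    gcongr
  calc _ ≤ ∑ i ∈ Finset.range k, C * η * (p (i + 1) - p i) := norm_sum_le_of_le _ hterm
    _ = C * c * η := by
      rw [← Finset.mul_sum, Finset.sum_range_sub, hp0, hpk]; ring
    _ < (C * c + 1) * η := by linarith
    _ = ε := by rw [hη]; field_simp

theorem IsDavieSolution.of_riemannConv (hA : IsLocalYoungField T A) (hcT : c ≤ T) {M : ℝ}
    (hM : 0 ≤ M) (hy : ∀ u v, 0 ≤ u → u ≤ v → v ≤ c → ‖y v - y u‖ ≤ M * gauge34 (v - u))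
    (h : ∀ t, 0 ≤ t → t ≤ c →
      RiemannConv (fun u v => A v (y u) - A u (y u)) 0 t (y t - y 0)) :
    IsDavieSolution A 0 c y := by
  have hR : ∀ u, 0 ≤ u → u ≤ c → ‖y u‖ ≤ ‖y 0‖ + M * gauge34 c := fun u hu huc => by
    have h1 := hy 0 u le_rfl hu huc
    have h2 : gauge34 (u - 0) ≤ gauge34 c := gauge34_mono (by linarith) (by linarith)
    calc ‖y u‖ = ‖y 0 + (y u - y 0)‖ := by congr 1; abel
      _ ≤ ‖y 0‖ + M * gauge34 (u - 0) := norm_add_le_of_le le_rfl h1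
      _ ≤ _ := by gcongr
  obtain ⟨K, hK, hb⟩ := hA.exists_gauge34_bounds (‖y 0‖ + M * gauge34 c)
  refine ⟨4 * (K * M), by positivity, fun u v hu huv hv => ?_⟩
  have hconv := (h u hu (huv.trans hv)).sub hu (h v (hu.trans huv) hv)
  rw [sub_sub_sub_cancel_right] at hconv
  refine hconv.norm_sub_le huv (D := K * M) (by positivity) fun u' v' hu' huv' hv' => ?_
  set m := (u' + v') / 2 with hm
  have hum : u' ≤ m := by linarith
  have hmv : m ≤ v' := by linarith
  have g1 : gauge34 (m - u') ≤ gauge34 (v' - u') := gauge34_mono (by linarith) (by linarith)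
  have g2 : gauge34 (v' - m) ≤ gauge34 (v' - u') := gauge34_mono (by linarith) (by linarith)
  have g3 : 0 ≤ gauge34 (m - u') := gauge34_nonneg (by linarith)
  have g4 : 0 ≤ gauge34 (v' - u') := g3.trans g1
  have e1 := (hb m v' (by linarith) hmv (by linarith)).2.1 (y m) (y u')
    (hR m (by linarith) (by linarith)) (hR u' (by linarith) (by linarith))
  have e2 : ‖y m - y u'‖ ≤ M * gauge34 (v' - u') :=
    (hy u' m (by linarith) hum (by linarith)).trans (by gcongr)
  calc _ = ‖(A v' (y m) - A m (y m)) - (A v' (y u') - A m (y u'))‖ := by congr 1; abel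
    _ ≤ K * gauge34 (v' - m) * ‖y m - y u'‖ := e1
    _ ≤ K * gauge34 (v' - u') * (M * gauge34 (v' - u')) := by gcongr
    _ = _ := by ring

end RiemannSums

section MaximalSolution

variable {E : Type*} [NormedAddCommGroup E] {T : ℝ} {A : ℝ → E → E} {x : E} {t u : ℝ}

/-- The times `t ∈ [0, T]` up to which a Davie solution started at `x` exists. -/
def existenceTimes (T : ℝ) (A : ℝ → E → E) (x : E) : Set ℝ :=
  {t | 0 ≤ t ∧ t ≤ T ∧ ∃ y : ℝ → E, y 0 = x ∧ IsDavieSolution A 0 t y}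

open Classical in
/-- The maximal existence time, which is `⊤` if the solution lives on all of `[0, T]`. -/
def maximalTime (T : ℝ) (A : ℝ → E → E) (x : E) : ℝ≥0∞ :=
  if T ∈ existenceTimes T A x then ⊤ else ENNReal.ofReal (sSup (existenceTimes T A x))

open Classical in
/-- The maximal solution, extended by `0` beyond its existence time. -/
def maximalSolution (T : ℝ) (A : ℝ → E → E) (x : E) (t : ℝ) : E :=
  if h : t ∈ existenceTimes T A x then h.2.2.choose t else 0

theorem mem_existenceTimes_of_le (ht : t ∈ existenceTimes T A x) (hu : 0 ≤ u) (hut : u ≤ t) :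
    u ∈ existenceTimes T A x := by
  obtain ⟨-, htT, y, hy0, hy⟩ := ht
  exact ⟨hu, hut.trans htT, y, hy0, hy.mono le_rfl hut⟩

theorem bddAbove_existenceTimes : BddAbove (existenceTimes T A x) :=
  ⟨T, fun _ ht => ht.2.1⟩

theorem ofReal_le_maximalTime (ht : t ∈ existenceTimes T A x) :
    ENNReal.ofReal t ≤ maximalTime T A x := by
  unfold maximalTime
  split_ifs
  · exact le_top
  · exact ENNReal.ofReal_le_ofReal (le_csSup bddAbove_existenceTimes ht)

theorem mem_existenceTimes_of_lt_sSup (ht : 0 ≤ t) (h : t < sSup (existenceTimes T A x)) :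
    t ∈ existenceTimes T A x := by
  rcases (existenceTimes T A x).eq_empty_or_nonempty with he | hne
  · rw [he, Real.sSup_empty] at h
    exact absurd h ht.not_gt
  · obtain ⟨s, hs, hts⟩ := exists_lt_of_lt_csSup hne h
    exact mem_existenceTimes_of_le hs ht hts.le

theorem mem_existenceTimes_of_lt_maximalTime (ht : 0 ≤ t) (htT : t ≤ T)
    (h : ENNReal.ofReal t < maximalTime T A x) : t ∈ existenceTimes T A x := by
  unfold maximalTime at h
  split_ifs at h with hT
  · exact mem_existenceTimes_of_le hT ht htT
  · exact mem_existenceTimes_of_lt_sSup ht ((ENNReal.ofReal_lt_ofReal_iff_of_nonneg ht).mp h)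

namespace IsLocalYoungField

theorem maximalSolution_eq (hA : IsLocalYoungField T A) {z : ℝ → E} (htT : t ≤ T)
    (hz0 : z 0 = x) (hz : IsDavieSolution A 0 t z) (hu : 0 ≤ u) (hut : u ≤ t) :
    maximalSolution T A x u = z u := by
  have hmem : u ∈ existenceTimes T A x :=
    mem_existenceTimes_of_le ⟨hu.trans hut, htT, z, hz0, hz⟩ hu hut
  rw [maximalSolution, dif_pos hmem]
  obtain ⟨h0, h⟩ := hmem.2.2.choose_spec
  exact h.eq_of_eq_left hA le_rfl hmem.2.1 (hz.mono le_rfl hut) (h0.trans hz0.symm) hu le_rfl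

theorem isDavieSolution_maximalSolution (hA : IsLocalYoungField T A)
    (ht : t ∈ existenceTimes T A x) : IsDavieSolution A 0 t (maximalSolution T A x) := by
  obtain ⟨-, htT, z, hz0, hz⟩ := ht
  exact hz.congr fun u hu hut => hA.maximalSolution_eq htT hz0 hz hu hut

theorem maximalSolution_zero (hA : IsLocalYoungField T A) (ht : t ∈ existenceTimes T A x) :
    maximalSolution T A x 0 = x := by
  obtain ⟨ht0, htT, z, hz0, hz⟩ := ht
  rw [hA.maximalSolution_eq htT hz0 hz le_rfl ht0, hz0]

theorem mem_existenceTimes_of_extension (hA : IsLocalYoungField T A) {c : ℝ} {z : ℝ → E}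
    (ht : t ∈ existenceTimes T A x) (htc : t ≤ c) (hcT : c ≤ T)
    (hzt : z t = maximalSolution T A x t) (hz : IsDavieSolution A t c z) :
    c ∈ existenceTimes T A x := by
  classical
  refine ⟨ht.1.trans htc, hcT, fun u => if u ≤ t then maximalSolution T A x u else z u, ?_, ?_⟩
  · simp only [if_pos ht.1, hA.maximalSolution_zero ht]
  · refine IsDavieSolution.concat hA le_rfl ht.2.1 hcT
      ((hA.isDavieSolution_maximalSolution ht).congr fun u _ hu => if_pos hu)
      (hz.congr fun u hu _ => ?_)
    rcases hu.eq_or_lt with rfl | hu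
    · simp only [le_refl, if_true, hzt]
    · exact if_neg hu.not_ge

theorem exists_mem_existenceTimes [ProperSpace E] (hA : IsLocalYoungField T A) (hT : 0 < T)
    (R : ℝ) : ∃ ε, 0 < ε ∧ ∀ x, ‖x‖ ≤ R → ε ∈ existenceTimes T A x := by
  obtain ⟨τ, hτ, h⟩ := hA.exists_isDavieSolution R
  refine ⟨min τ T, lt_min hτ hT, fun x hx => ⟨(lt_min hτ hT).le, min_le_right _ _, ?_⟩⟩
  obtain ⟨y, hy0, hy⟩ := h 0 x le_rfl hT.le hx
  exact ⟨y, hy0, by rwa [zero_add] at hy⟩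

theorem tendsto_norm_maximalSolution [ProperSpace E] (hA : IsLocalYoungField T A) (hT : 0 < T)
    (hx : maximalTime T A x ≠ ⊤) :
    Tendsto (fun t => ‖maximalSolution T A x t‖)
      (nhdsWithin (maximalTime T A x).toReal (Set.Iio (maximalTime T A x).toReal)) atTop := by
  have hTx : T ∉ existenceTimes T A x := fun h => hx (if_pos h)
  obtain ⟨ε, hε, hεx⟩ := hA.exists_mem_existenceTimes hT ‖x‖
  have hσ : 0 < sSup (existenceTimes T A x) :=
    hε.trans_le (le_csSup bddAbove_existenceTimes (hεx x le_rfl))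
  have htoReal : (maximalTime T A x).toReal = sSup (existenceTimes T A x) := by
    rw [maximalTime, if_neg hTx, ENNReal.toReal_ofReal hσ.le]
  rw [htoReal]
  refine tendsto_atTop.mpr fun R => ?_
  obtain ⟨τ, hτ, h⟩ := hA.exists_isDavieSolution R
  have hlt : max 0 (sSup (existenceTimes T A x) - τ) < sSup (existenceTimes T A x) :=
    max_lt hσ (by linarith)
  filter_upwards [Ioo_mem_nhdsLT hlt] with t ht
  obtain ⟨ht0, htτ⟩ := max_lt_iff.mp ht.1
  have hmem := mem_existenceTimes_of_lt_sSup ht0.le ht.2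
  by_contra! hR
  obtain ⟨z, hz0, hz⟩ := h t (maximalSolution T A x t) ht0.le hmem.2.1 hR.le
  have hext := hA.mem_existenceTimes_of_extension hmem (le_min (by linarith) hmem.2.1)
    (min_le_right _ _) hz0 hz
  rcases min_choice (t + τ) T with hm | hm
  · rw [hm] at hext
    linarith [le_csSup bddAbove_existenceTimes hext]
  · rw [hm] at hext
    exact hTx hext

theorem isNLYoungSolution_maximalSolution [ProperSpace E] (hA : IsLocalYoungField T A)
    (hT : 0 < T) (x : E) :
    IsNLYoungSolution T (Set.Ioo (1/2:ℝ) 1) (fun u v x' => A v x' - A u x') x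
      (maximalTime T A x) (maximalSolution T A x) := by
  obtain ⟨ε, hε, hεx⟩ := hA.exists_mem_existenceTimes hT ‖x‖
  have h0 := hA.maximalSolution_zero (hεx x le_rfl)
  refine ⟨h0, fun τ hτ hτT hlt γ hγ => ?_, fun t ht htT hlt => ?_⟩
  · have hmem := mem_existenceTimes_of_lt_maximalTime hτ hτT hlt
    obtain ⟨M, -, hM⟩ :=
      (hA.isDavieSolution_maximalSolution hmem).exists_holder hA le_rfl hτT hγ
    refine ⟨M, fun u hu v hv => ?_⟩
    rcases le_total u v with huv | hvu
    · rw [abs_of_nonneg (sub_nonneg.mpr huv)]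
      exact hM u v hu.1 huv hv.2
    · rw [norm_sub_rev, abs_sub_comm, abs_of_nonneg (sub_nonneg.mpr hvu)]
      exact hM v u hv.1 hvu hu.2
  · have hmem := mem_existenceTimes_of_lt_maximalTime ht htT.le hlt
    have := (hA.isDavieSolution_maximalSolution hmem).riemannConv ht
    rwa [h0] at this

end IsLocalYoungField

namespace IsNLYoungSolution

variable {Φ : ℝ → ℝ → E → E} {Tstar : ℝ≥0∞} {y z : ℝ → E}

theorem continuousOn (hy : IsNLYoungSolution T (Set.Ioo (1/2:ℝ) 1) Φ x Tstar y) (ht : 0 ≤ t)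
    (htT : t ≤ T) (hlt : ENNReal.ofReal t < Tstar) : ContinuousOn y (Set.Icc 0 t) := by
  obtain ⟨C, hC⟩ := hy.2.1 t ht htT hlt (3 / 4) (by norm_num)
  intro u hu
  have hlim : Tendsto (fun v => C * gauge34 |v - u|) (nhdsWithin u (Set.Icc 0 t))
      (nhds (C * gauge34 |u - u|)) :=
    ((continuous_gauge34.comp (continuous_abs.comp (continuous_sub_right u))).const_mul
      C).continuousWithinAt
  rw [sub_self, abs_zero, gauge34_zero, mul_zero] at hlim
  rw [ContinuousWithinAt, tendsto_iff_norm_sub_tendsto_zero]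
  exact squeeze_zero' (Eventually.of_forall fun _ => norm_nonneg _)
    (eventually_mem_nhdsWithin.mono fun v hv => hC u hu v hv) hlim

theorem isDavieSolution (hA : IsLocalYoungField T A)
    (hz : IsNLYoungSolution T (Set.Ioo (1/2:ℝ) 1) (fun u v x' => A v x' - A u x') x Tstar z)
    (ht : 0 ≤ t) (htT : t < T) (hlt : ENNReal.ofReal t < Tstar) : IsDavieSolution A 0 t z := by
  obtain ⟨C, hC⟩ := hz.2.1 t ht htT.le hlt (3 / 4) (by norm_num)
  refine IsDavieSolution.of_riemannConv hA htT.le (abs_nonneg C) (fun u v hu huv hv => ?_)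
    fun s hs hst => ?_
  · have h := hC u ⟨hu, huv.trans hv⟩ v ⟨hu.trans huv, hv⟩
    rw [abs_of_nonneg (sub_nonneg.mpr huv)] at h
    exact h.trans (mul_le_mul_of_nonneg_right (le_abs_self C)
      (gauge34_nonneg (sub_nonneg.mpr huv)))
  · rw [hz.1]
    exact hz.2.2 s hs (hst.trans_lt htT) ((ENNReal.ofReal_le_ofReal hst).trans_lt hlt)

theorem eq_of_isLocalYoungField (hA : IsLocalYoungField T A) (hT : 0 < T)
    (hy : IsNLYoungSolution T (Set.Ioo (1/2:ℝ) 1) (fun u v x' => A v x' - A u x') x Tstar y)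
    (hz : IsNLYoungSolution T (Set.Ioo (1/2:ℝ) 1) (fun u v x' => A v x' - A u x') x Tstar z)
    (ht : 0 ≤ t) (htT : t ≤ T) (hlt : ENNReal.ofReal t < Tstar) : z t = y t := by
  have hint : ∀ s, 0 ≤ s → s < T → ENNReal.ofReal s < Tstar → z s = y s := fun s hs hsT hs' =>
    (hz.isDavieSolution hA hs hsT hs').eq_of_eq_left hA le_rfl hsT.le
      (hy.isDavieSolution hA hs hsT hs') (hz.1.trans hy.1.symm) hs le_rfl
  rcases htT.eq_or_lt with rfl | htT
  · have hsub : Set.Ico 0 t ⊆ Set.Icc 0 t := Set.Ico_subset_Icc_self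
    have heq : Set.EqOn z y (Set.Ico 0 t) := fun s hs =>
      hint s hs.1 hs.2 ((ENNReal.ofReal_le_ofReal hs.2.le).trans_lt hlt)
    exact heq.of_subset_closure (hz.continuousOn ht le_rfl hlt) (hy.continuousOn ht le_rfl hlt)
      hsub (closure_Ico hT.ne).ge ⟨ht, le_rfl⟩
  · exact hint t ht htT hlt

end IsNLYoungSolution

end MaximalSolution

/-- **Existence and uniqueness for ODEs with distributional drift perturbed by an infinitely
regularizing path.** Let `T > 0`, let `b` be an (ℝ^d-valued) tempered distribution on `ℝ^d`,
and let `w ∈ C([0,T], ℝ^d)` be infinitely regularizing in the smooth sense: it has a local time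
`ℓ` such that each `ℓ t` is `C^∞`, supported in one fixed compact set, and for every
`γ ∈ (1/2,1)` and every derivative order there is `C` with
`‖∂^α ℓ_{s,t}‖_∞ ≤ C|t−s|^γ` on `[0,T]` (the family `Ltr t x` packages the translated test
functions `ℓ t (· − x)` as Schwartz functions, so that the averaging operator is
`T_{s,t}b(x) = ⟨b, ℓ_{s,t}(· − x)⟩ = b (Ltr t x) − b (Ltr s x)`).
Then for every `x ∈ ℝ^d` there exist a maximal time `T⋆(x) ∈ (0,T] ∪ {∞}` and a unique path
`y^x` on `[0,T⋆(x)) ∩ [0,T]`, `γ`-Hölder on compact subintervals for every `γ ∈ (1/2,1)`,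
such that the Riemann sums `∑ T_{u,v}b(y^x_u)` over partitions of `[0,t]` converge to
`y^x_t − x` as the mesh tends to `0`, for every `t < min(T⋆(x), T)`.  Moreover if
`T⋆(x) < ∞` then `|y^x_t| → ∞` as `t ↑ T⋆(x)`, and `x ↦ T⋆(x)⁻¹` is locally bounded. -/
theorem stmt_0 {d : ℕ} (T : ℝ) (hT : 0 < T) (w : ℝ → Euc d)
    (hw : ContinuousOn w (Set.Icc 0 T))
    (ℓ : ℝ → Euc d → ℝ)
    (hloc : IsLocalTime T w ℓ)
    (hsmooth : ∀ t ∈ Set.Icc (0:ℝ) T, ContDiff ℝ (⊤:ℕ∞) (ℓ t))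
    (hsupp : ∃ K : Set (Euc d), IsCompact K ∧ ∀ t ∈ Set.Icc (0:ℝ) T, tsupport (ℓ t) ⊆ K)
    (hHol : ∀ γ ∈ Set.Ioo (1/2:ℝ) 1, ∀ n : ℕ, ∃ C : ℝ, ∀ s t : ℝ, 0 ≤ s → s ≤ t → t ≤ T →
      ∀ x : Euc d, ‖iteratedFDeriv ℝ n (fun z => ℓ t z - ℓ s z) x‖ ≤ C * (t - s) ^ γ)
    (Ltr : ℝ → Euc d → SchwartzMap (Euc d) ℝ)
    (hLtr : ∀ t x z, Ltr t x z = ℓ t (z - x))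
    (b : SchwartzMap (Euc d) ℝ →L[ℝ] Euc d) :
    ∃ (Tstar : Euc d → ℝ≥0∞) (y : Euc d → ℝ → Euc d),
      (∀ x, 0 < Tstar x ∧ (Tstar x ≤ ENNReal.ofReal T ∨ Tstar x = ⊤)) ∧
      (∀ x, IsNLYoungSolution T (Set.Ioo (1/2:ℝ) 1)
        (fun u v x' => b (Ltr v x') - b (Ltr u x')) x (Tstar x) (y x)) ∧
      (∀ x z, IsNLYoungSolution T (Set.Ioo (1/2:ℝ) 1)
          (fun u v x' => b (Ltr v x') - b (Ltr u x')) x (Tstar x) z →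
        ∀ t : ℝ, 0 ≤ t → t ≤ T → ENNReal.ofReal t < Tstar x → z t = y x t) ∧
      (∀ x, Tstar x ≠ ⊤ →
        Tendsto (fun t => ‖y x t‖) (nhdsWithin (Tstar x).toReal (Set.Iio (Tstar x).toReal)) atTop) ∧
      (∀ x : Euc d, ∃ r : ℝ, 0 < r ∧ ∃ ε : ℝ, 0 < ε ∧
        ∀ x' : Euc d, ‖x' - x‖ ≤ r → ENNReal.ofReal ε ≤ Tstar x') := by
  have hA := isLocalYoungField_averaging hloc.2.1 hsmooth hsupp hHol Ltr hLtr b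
  set A : ℝ → Euc d → Euc d := fun t x => b (Ltr t x)
  refine ⟨maximalTime T A, maximalSolution T A, fun x => ⟨?_, ?_⟩,
    hA.isNLYoungSolution_maximalSolution hT, fun x z hz t ht htT hlt =>
      (hA.isNLYoungSolution_maximalSolution hT x).eq_of_isLocalYoungField hA hT hz ht htT hlt,
    fun x => hA.tendsto_norm_maximalSolution hT, fun x => ?_⟩
  · obtain ⟨ε, hε, h⟩ := hA.exists_mem_existenceTimes hT ‖x‖
    exact (ENNReal.ofReal_pos.mpr hε).trans_le (ofReal_le_maximalTime (h x le_rfl))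
  · unfold maximalTime
    split_ifs
    · exact Or.inr rfl
    · exact Or.inl (ENNReal.ofReal_le_ofReal (Real.sSup_le (fun _ ht => ht.2.1) hT.le))
  · obtain ⟨ε, hε, h⟩ := hA.exists_mem_existenceTimes hT (‖x‖ + 1)
    refine ⟨1, one_pos, ε, hε, fun x' hx' => ofReal_le_maximalTime (h x' ?_)⟩
    linarith [norm_le_norm_add_norm_sub' x' x]
end
end

section
/- Let T>0, let b be a tempered distribution on ℝ^d, let w∈C([0,T],ℝ^d) be infinitely regularizing in the smooth sense, and for x∈ℝ^d let y^x be the unique maximal solution of y^x_t = x + lim_{mesh(P)→0} ∑_{[u,v]∈P} T_{u,v}b(y^x_u) with maximal existence time T*(x). If U⊆ℝ^d is open and τ∈(0,T] satisfies τ<T*(x) for all x∈U, then the flow map U→C([0,τ],ℝ^d) (the Banach space of continuous paths with the supremum norm), x↦y^x, is infinitely Fréchet differentiable (of class C^∞). -/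
noncomputable section
open MeasureTheory Set Filter
open scoped ENNReal NNReal

namespace NLYoung

open scoped Topology ContDiff

/-- The Hölder gauge `h ↦ h ^ (3/4)` used to measure time increments. -/
def gauge (h : ℝ) : ℝ := h ^ (3 / 4 : ℝ)

lemma gauge_nonneg {h : ℝ} (hh : 0 ≤ h) : 0 ≤ gauge h := Real.rpow_nonneg hh _

lemma gauge_pos {h : ℝ} (hh : 0 < h) : 0 < gauge h := Real.rpow_pos_of_pos hh _

@[simp] lemma gauge_zero : gauge 0 = 0 := Real.zero_rpow (by norm_num)

lemma gauge_mono {h k : ℝ} (hh : 0 ≤ h) (hk : h ≤ k) : gauge h ≤ gauge k :=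
  Real.rpow_le_rpow hh hk (by norm_num)

lemma continuous_gauge : Continuous gauge :=
  Real.continuous_rpow_const (by norm_num)

lemma gauge_sq {h : ℝ} (hh : 0 ≤ h) : gauge h ^ 2 = h ^ (3 / 2 : ℝ) := by
  rw [gauge, ← Real.rpow_natCast, ← Real.rpow_mul hh]; norm_num

lemma two_mul_gauge_half_sq {h : ℝ} (hh : 0 ≤ h) :
    2 * gauge (h / 2) ^ 2 ≤ 3 / 4 * gauge h ^ 2 := by
  rw [gauge_sq (by positivity), gauge_sq hh, Real.div_rpow hh (by norm_num)]
  have h1 : (8 / 3 : ℝ) ≤ 2 ^ (3 / 2 : ℝ) := by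
    have h2 : ((2 : ℝ) ^ (3 / 2 : ℝ)) ^ 2 = 8 := by
      rw [← Real.rpow_natCast, ← Real.rpow_mul (by norm_num)]; norm_num
    have h3 : (0 : ℝ) < 2 ^ (3 / 2 : ℝ) := by positivity
    nlinarith
  have h4 : 0 ≤ h ^ (3 / 2 : ℝ) := Real.rpow_nonneg hh _
  rw [mul_div_assoc', div_le_iff₀ (by positivity)]
  nlinarith

lemma exists_mul_gauge_le (C : ℝ) {ε : ℝ} (hε : 0 < ε) :
    ∃ η : ℝ, 0 < η ∧ C * gauge η ≤ ε := by
  have h : Tendsto (fun η => C * gauge η) (𝓝 0) (𝓝 (C * gauge 0)) :=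
    (continuous_const.mul continuous_gauge).tendsto 0
  rw [gauge_zero, mul_zero] at h
  have h1 := (h.mono_left (nhdsWithin_le_nhds (s := Ioi 0))).eventually (Iio_mem_nhds hε)
  obtain ⟨η, h2, h3⟩ := (h1.and self_mem_nhdsWithin).exists
  exact ⟨η, h3, le_of_lt h2⟩

/-- An affine self-improving bound with contraction factor `q < 1` improves to its fixed point. -/
lemma bound_of_self_improving {ι : Type*} {f g : ι → ℝ} {q M K₀ : ℝ} (hg : ∀ i, 0 ≤ g i)
    (hq0 : 0 ≤ q) (hq1 : q < 1) (hM : 0 ≤ M) (h0 : ∀ i, f i ≤ K₀ * g i)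
    (hstep : ∀ K, 0 ≤ K → (∀ i, f i ≤ K * g i) → ∀ i, f i ≤ (q * K + M) * g i) (i : ι) :
    f i ≤ M / (1 - q) * g i := by
  have hq : 0 < 1 - q := by linarith
  have key : ∀ n : ℕ, ∀ i, f i ≤ (q ^ n * |K₀| + M / (1 - q)) * g i := by
    intro n
    induction n with
    | zero =>
      intro i
      refine (h0 i).trans (mul_le_mul_of_nonneg_right ?_ (hg i))
      have : 0 ≤ M / (1 - q) := by positivity
      have := le_abs_self K₀
      simp only [pow_zero, one_mul]; linarith
    | succ n ih =>
      intro i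
      refine (hstep _ (by positivity) ih i).trans_eq ?_
      field_simp
      ring
  have hlim : Tendsto (fun n : ℕ => (q ^ n * |K₀| + M / (1 - q)) * g i) atTop
      (𝓝 ((0 * |K₀| + M / (1 - q)) * g i)) :=
    (((tendsto_pow_atTop_nhds_zero_of_lt_one hq0 hq1).mul_const _).add_const _).mul_const _
  rw [zero_mul, zero_add] at hlim
  exact ge_of_tendsto' hlim (fun n => key n i)

section Sewing

variable {V : Type*} [NormedAddCommGroup V]

/-- Sewing estimate: a remainder of order `gauge ^ 2` is controlled by its midpoint defect. -/
lemma sewing_bound {a b η K₀ M : ℝ} {R : ℝ → ℝ → V} (hM : 0 ≤ M)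
    (h0 : ∀ s t, a ≤ s → s ≤ t → t ≤ b → t - s ≤ η → ‖R s t‖ ≤ K₀ * gauge (t - s) ^ 2)
    (hδ : ∀ K, 0 ≤ K →
      (∀ s t, a ≤ s → s ≤ t → t ≤ b → t - s ≤ η → ‖R s t‖ ≤ K * gauge (t - s) ^ 2) →
      ∀ s u t, a ≤ s → s ≤ u → u ≤ t → t ≤ b → t - s ≤ η →
        ‖R s t - R s u - R u t‖ ≤ (K / 8 + M) * gauge (t - s) ^ 2)
    {s t : ℝ} (has : a ≤ s) (hst : s ≤ t) (htb : t ≤ b) (hη : t - s ≤ η) :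
    ‖R s t‖ ≤ 8 * M * gauge (t - s) ^ 2 := by
  let I := {p : ℝ × ℝ // a ≤ p.1 ∧ p.1 ≤ p.2 ∧ p.2 ≤ b ∧ p.2 - p.1 ≤ η}
  have h := bound_of_self_improving (ι := I) (f := fun p => ‖R p.1.1 p.1.2‖)
    (g := fun p => gauge (p.1.2 - p.1.1) ^ 2) (q := 7 / 8) (M := M) (K₀ := K₀)
    (fun _ => sq_nonneg _) (by norm_num) (by norm_num) hM
    (fun p => h0 _ _ p.2.1 p.2.2.1 p.2.2.2.1 p.2.2.2.2) ?_ ⟨(s, t), has, hst, htb, hη⟩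
  · refine h.trans_eq ?_
    norm_num
    ring_nf
    simp
  · rintro K hK hKb ⟨⟨s, t⟩, h1, h2, h3, h4⟩
    dsimp only at h1 h2 h3 h4 ⊢
    have hKb' : ∀ s t, a ≤ s → s ≤ t → t ≤ b → t - s ≤ η →
        ‖R s t‖ ≤ K * gauge (t - s) ^ 2 :=
      fun s t e1 e2 e3 e4 => hKb ⟨(s, t), e1, e2, e3, e4⟩
    have hd := hδ K hK hKb' s ((s + t) / 2) t h1 (by linarith) (by linarith) h3 h4
    have hl := hKb' s ((s + t) / 2) h1 (by linarith) (by linarith) (by linarith)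
    have hr := hKb' ((s + t) / 2) t (by linarith) (by linarith) h3 (by linarith)
    have e1 : (s + t) / 2 - s = (t - s) / 2 := by ring
    have e2 : t - (s + t) / 2 = (t - s) / 2 := by ring
    rw [e1] at hl
    rw [e2] at hr
    have h5 := two_mul_gauge_half_sq (h := t - s) (by linarith)
    have h6 : ‖R s t‖ ≤ ‖R s t - R s ((s + t) / 2) - R ((s + t) / 2) t‖ +
        ‖R s ((s + t) / 2)‖ + ‖R ((s + t) / 2) t‖ := by
      have : R s t = (R s t - R s ((s + t) / 2) - R ((s + t) / 2) t) +
        R s ((s + t) / 2) + R ((s + t) / 2) t := by abel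
      conv_lhs => rw [this]
      exact norm_add₃_le
    nlinarith [mul_le_mul_of_nonneg_left h5 hK]

end Sewing

section Stability

variable {V : Type*} [NormedAddCommGroup V]

/-- The increment `A_t - A_s` of a time-dependent vector field. -/
def inc (A : ℝ → V → V) (s t : ℝ) (x : V) : V := A t x - A s x

lemma inc_add (A : ℝ → V → V) (s u t : ℝ) (x : V) : inc A s u x + inc A u t x = inc A s t x := by
  simp only [inc]; abel

/-- On the ball of radius `R`, the increments of `A` are bounded, Lipschitz and satisfy a
four-point estimate, all with constant `C` and Hölder dependence on time. -/
structure IncBound (τ R C : ℝ) (A : ℝ → V → V) : Prop where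
  nonneg : 0 ≤ C
  bound : ∀ s t, 0 ≤ s → s ≤ t → t ≤ τ → ∀ x, ‖x‖ ≤ R → ‖inc A s t x‖ ≤ C * gauge (t - s)
  lip : ∀ s t, 0 ≤ s → s ≤ t → t ≤ τ → ∀ x x', ‖x‖ ≤ R → ‖x'‖ ≤ R →
    ‖inc A s t x' - inc A s t x‖ ≤ C * gauge (t - s) * ‖x' - x‖
  four : ∀ s t, 0 ≤ s → s ≤ t → t ≤ τ → ∀ x x' y y', ‖x‖ ≤ R → ‖x'‖ ≤ R → ‖y‖ ≤ R → ‖y'‖ ≤ R →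
    ∀ N, ‖x - y‖ ≤ N → ‖x' - y'‖ ≤ N →
    ‖(inc A s t x' - inc A s t y') - (inc A s t x - inc A s t y)‖ ≤
      C * gauge (t - s) * (‖(x' - y') - (x - y)‖ + N * ‖x' - x‖)

/-- The remainder of the one-step Euler approximation along `z`. -/
def rem (A : ℝ → V → V) (z : ℝ → V) (s t : ℝ) : V := z t - z s - inc A s t (z s)

lemma rem_defect (A : ℝ → V → V) (z : ℝ → V) (s u t : ℝ) :
    rem A z s t - rem A z s u - rem A z u t = inc A u t (z u) - inc A u t (z s) := by
  simp only [rem, ← inc_add A s u t]; abel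

/-- `z` solves the equation driven by `A` on `[a, b]`, stays in the ball of radius `R`, and has
Euler remainders controlled by `K`. -/
structure SolOn (A : ℝ → V → V) (a b R K : ℝ) (z : ℝ → V) : Prop where
  bound : ∀ t, a ≤ t → t ≤ b → ‖z t‖ ≤ R
  rem_le : ∀ s t, a ≤ s → s ≤ t → t ≤ b → ‖rem A z s t‖ ≤ K * gauge (t - s) ^ 2

variable {A : ℝ → V → V} {τ R C η a b K K' : ℝ} {z y : ℝ → V}

lemma SolOn.mono (h : SolOn A a b R K z) {a' b' : ℝ} (ha : a ≤ a') (hb : b' ≤ b) :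
    SolOn A a' b' R K z :=
  ⟨fun t h1 h2 => h.bound t (ha.trans h1) (h2.trans hb),
    fun s t h1 h2 h3 => h.rem_le s t (ha.trans h1) h2 (h3.trans hb)⟩

lemma SolOn.mono_radius (h : SolOn A a b R K z) {R' : ℝ} (hR : R ≤ R') : SolOn A a b R' K z :=
  ⟨fun t h1 h2 => (h.bound t h1 h2).trans hR, h.rem_le⟩

lemma IncBound.uniform_rem (hA : IncBound τ R C A) (hη : 8 * C * gauge η ≤ 1)
    (ha : 0 ≤ a) (hb : b ≤ τ) (hz : SolOn A a b R K z) {s t : ℝ}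
    (has : a ≤ s) (hst : s ≤ t) (htb : t ≤ b) (hts : t - s ≤ η) :
    ‖rem A z s t‖ ≤ 8 * C ^ 2 * gauge (t - s) ^ 2 := by
  refine sewing_bound (sq_nonneg C) (fun s t h1 h2 h3 _ => hz.rem_le s t h1 h2 h3) ?_
    has hst htb hts
  intro K hK hKb s u t hs hsu hut ht htη
  have hC := hA.nonneg
  rw [rem_defect]
  have h1 := hA.lip u t (by linarith) hut (by linarith) (z s) (z u)
    (hz.bound s hs (by linarith)) (hz.bound u (by linarith) (by linarith))
  have h2 := hKb s u hs hsu (by linarith) (by linarith)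
  have h3 := hA.bound s u (by linarith) hsu (by linarith) (z s) (hz.bound s hs (by linarith))
  have h4 : ‖z u - z s‖ ≤ ‖rem A z s u‖ + ‖inc A s u (z s)‖ := by
    have : z u - z s = rem A z s u + inc A s u (z s) := by simp [rem]
    rw [this]; exact norm_add_le _ _
  have g1 := gauge_mono (h := u - s) (k := t - s) (by linarith) (by linarith)
  have g2 := gauge_mono (h := t - u) (k := t - s) (by linarith) (by linarith)
  have g3 := gauge_nonneg (h := u - s) (by linarith)
  have g4 := gauge_nonneg (h := t - u) (by linarith)
  have g5 := gauge_mono (h := t - s) (k := η) (by linarith) htη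
  set g := gauge (t - s)
  have g0 : 0 ≤ g := g3.trans g1
  have h5 : ‖z u - z s‖ ≤ K * g ^ 2 + C * g := by
    have : K * gauge (u - s) ^ 2 ≤ K * g ^ 2 := by gcongr
    have : C * gauge (u - s) ≤ C * g := by gcongr
    linarith
  have h6 : C * gauge (t - u) * ‖z u - z s‖ ≤ C * g * (K * g ^ 2 + C * g) := by gcongr
  have h7 : 8 * C * g ≤ 1 := le_trans (by gcongr) hη
  have h8 : 8 * C * g * (K * g ^ 2) ≤ 1 * (K * g ^ 2) := by gcongr
  nlinarith

lemma IncBound.sol_increment (hA : IncBound τ R C A) (hη : 8 * C * gauge η ≤ 1)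
    (ha : 0 ≤ a) (hb : b ≤ τ) (hz : SolOn A a b R K z) {s t : ℝ}
    (has : a ≤ s) (hst : s ≤ t) (htb : t ≤ b) (hts : t - s ≤ η) :
    ‖z t - z s‖ ≤ 2 * C * gauge (t - s) := by
  have h1 := hA.uniform_rem hη ha hb hz has hst htb hts
  have h2 := hA.bound s t (by linarith) hst (by linarith) (z s) (hz.bound s has (by linarith))
  have h4 : ‖z t - z s‖ ≤ ‖rem A z s t‖ + ‖inc A s t (z s)‖ := by
    have : z t - z s = rem A z s t + inc A s t (z s) := by simp [rem]
    rw [this]; exact norm_add_le _ _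
  have hC := hA.nonneg
  have g0 := gauge_nonneg (h := t - s) (by linarith)
  have g5 := gauge_mono (h := t - s) (k := η) (by linarith) hts
  have h7 : 8 * C * gauge (t - s) ≤ 1 := le_trans (by gcongr) hη
  have h8 : 8 * C * gauge (t - s) * (C * gauge (t - s)) ≤ 1 * (C * gauge (t - s)) := by gcongr
  nlinarith

lemma IncBound.diff_rem (hA : IncBound τ R C A) (hη : 8 * C * gauge η ≤ 1)
    (ha : 0 ≤ a) (hb : b ≤ τ) (hz : SolOn A a b R K z) (hy : SolOn A a b R K' y) {N : ℝ}
    (hN : ∀ t, a ≤ t → t ≤ b → ‖z t - y t‖ ≤ N) {s t : ℝ}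
    (has : a ≤ s) (hst : s ≤ t) (htb : t ≤ b) (hts : t - s ≤ η) :
    ‖rem A z s t - rem A y s t‖ ≤ 24 * C ^ 2 * N * gauge (t - s) ^ 2 := by
  have hN0 : 0 ≤ N := (norm_nonneg _).trans (hN s has (hst.trans htb))
  have hC := hA.nonneg
  have := sewing_bound (R := fun s t => rem A z s t - rem A y s t) (a := a) (b := b) (η := η)
    (K₀ := K + K') (M := 3 * C ^ 2 * N) (by positivity) ?_ ?_ has hst htb hts
  · refine this.trans_eq (by ring)
  · intro s t h1 h2 h3 _
    have := hz.rem_le s t h1 h2 h3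
    have := hy.rem_le s t h1 h2 h3
    refine (norm_sub_le _ _).trans ?_
    linarith
  intro K hK hKb s u t hs hsu hut ht htη
  have e : rem A z s t - rem A y s t - (rem A z s u - rem A y s u)
      - (rem A z u t - rem A y u t) =
      (inc A u t (z u) - inc A u t (y u)) - (inc A u t (z s) - inc A u t (y s)) := by
    have h1 := rem_defect A z s u t
    have h2 := rem_defect A y s u t
    calc _ = (rem A z s t - rem A z s u - rem A z u t) -
        (rem A y s t - rem A y s u - rem A y u t) := by abel
      _ = _ := by rw [h1, h2]; abel
  have zs := hz.bound s hs (by linarith)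
  have ys := hy.bound s hs (by linarith)
  have zu := hz.bound u (by linarith) (by linarith)
  have yu := hy.bound u (by linarith) (by linarith)
  have h1 := hA.four u t (by linarith) hut (by linarith) (z s) (z u) (y s) (y u) zs zu ys yu N
    (hN s hs (by linarith)) (hN u (by linarith) (by linarith))
  have h2 := hKb s u hs hsu (by linarith) (by linarith)
  have h3 := hA.lip s u (by linarith) hsu (by linarith) (y s) (z s) ys zs
  have h4 : ‖(z u - y u) - (z s - y s)‖ ≤ ‖rem A z s u - rem A y s u‖ +
      ‖inc A s u (z s) - inc A s u (y s)‖ := by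
    have : (z u - y u) - (z s - y s) =
      (rem A z s u - rem A y s u) + (inc A s u (z s) - inc A s u (y s)) := by
      simp only [rem]; abel
    rw [this]; exact norm_add_le _ _
  have h5 := hA.sol_increment hη ha hb hz hs hsu (by linarith) (by linarith)
  have g1 := gauge_mono (h := u - s) (k := t - s) (by linarith) (by linarith)
  have g2 := gauge_mono (h := t - u) (k := t - s) (by linarith) (by linarith)
  have g3 := gauge_nonneg (h := u - s) (by linarith)
  have g4 := gauge_nonneg (h := t - u) (by linarith)
  have g5 := gauge_mono (h := t - s) (k := η) (by linarith) htη
  rw [e]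
  refine h1.trans ?_
  have hNs := hN s hs (by linarith)
  set g := gauge (t - s)
  have g0 : 0 ≤ g := g3.trans g1
  have h6 : ‖(z u - y u) - (z s - y s)‖ ≤ K * g ^ 2 + C * g * N := by
    have : K * gauge (u - s) ^ 2 ≤ K * g ^ 2 := by gcongr
    have : C * gauge (u - s) * ‖z s - y s‖ ≤ C * g * N := by gcongr
    linarith
  have h7 : ‖z u - z s‖ ≤ 2 * C * g := h5.trans (by gcongr)
  have h8 : C * gauge (t - u) * (‖(z u - y u) - (z s - y s)‖ + N * ‖z u - z s‖) ≤
      C * g * ((K * g ^ 2 + C * g * N) + N * (2 * C * g)) := by gcongr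
  have h9 : 8 * C * g ≤ 1 := le_trans (by gcongr) hη
  have h10 : 8 * C * g * (K * g ^ 2) ≤ 1 * (K * g ^ 2) := by gcongr
  nlinarith

lemma IncBound.diff_increment (hA : IncBound τ R C A) (hη : 8 * C * gauge η ≤ 1)
    (ha : 0 ≤ a) (hb : b ≤ τ) (hz : SolOn A a b R K z) (hy : SolOn A a b R K' y) {N : ℝ}
    (hN : ∀ t, a ≤ t → t ≤ b → ‖z t - y t‖ ≤ N) {s t : ℝ}
    (has : a ≤ s) (hst : s ≤ t) (htb : t ≤ b) (hts : t - s ≤ η) :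
    ‖(z t - y t) - (z s - y s)‖ ≤ 4 * C * N * gauge (t - s) := by
  have hNs := hN s has (hst.trans htb)
  have hN0 : 0 ≤ N := (norm_nonneg _).trans hNs
  have h1 := hA.diff_rem hη ha hb hz hy hN has hst htb hts
  have h3 := hA.lip s t (by linarith) hst (by linarith) (y s) (z s)
    (hy.bound s has (by linarith)) (hz.bound s has (by linarith))
  have h4 : ‖(z t - y t) - (z s - y s)‖ ≤ ‖rem A z s t - rem A y s t‖ +
      ‖inc A s t (z s) - inc A s t (y s)‖ := by
    have : (z t - y t) - (z s - y s) =
      (rem A z s t - rem A y s t) + (inc A s t (z s) - inc A s t (y s)) := by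
      simp only [rem]; abel
    rw [this]; exact norm_add_le _ _
  have hC := hA.nonneg
  have g0 := gauge_nonneg (h := t - s) (by linarith)
  have g5 := gauge_mono (h := t - s) (k := η) (by linarith) hts
  have h7 : 8 * C * gauge (t - s) ≤ 1 := le_trans (by gcongr) hη
  have h8 : 8 * C * gauge (t - s) * (C * N * gauge (t - s)) ≤ 1 * (C * N * gauge (t - s)) := by
    gcongr
  have h9 : C * gauge (t - s) * ‖z s - y s‖ ≤ C * gauge (t - s) * N := by gcongr
  nlinarith

lemma IncBound.diff_le_short (hA : IncBound τ R C A) (hη : 8 * C * gauge η ≤ 1)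
    (ha : 0 ≤ a) (hb : b ≤ τ) (hz : SolOn A a b R K z) (hy : SolOn A a b R K' y)
    (hab : b - a ≤ η) {t : ℝ} (hat : a ≤ t) (htb : t ≤ b) :
    ‖z t - y t‖ ≤ 2 * ‖z a - y a‖ := by
  have h := bound_of_self_improving (ι := Icc a b) (f := fun t => ‖z t - y t‖)
    (g := fun _ => 1) (q := 1 / 2) (M := ‖z a - y a‖) (K₀ := 2 * R)
    (fun _ => zero_le_one) (by norm_num) (by norm_num) (norm_nonneg _) ?_ ?_ ⟨t, hat, htb⟩
  · refine h.trans_eq ?_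
    norm_num
    ring
  · rintro ⟨t, h1, h2⟩
    have := hz.bound t h1 h2
    have := hy.bound t h1 h2
    refine (norm_sub_le _ _).trans ?_
    dsimp only
    linarith
  · rintro N hN0 hN ⟨t, h1, h2⟩
    have h3 := hA.diff_increment hη ha hb hz hy (N := N)
      (fun t h1 h2 => by simpa using hN ⟨t, h1, h2⟩) le_rfl h1 h2 (by linarith)
    have h4 := norm_le_norm_add_norm_sub' (z t - y t) (z a - y a)
    have hC := hA.nonneg
    have g5 := gauge_mono (h := t - a) (k := η) (by linarith) (by linarith)
    have h7 : 8 * C * gauge (t - a) ≤ 1 := le_trans (by gcongr) hη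
    have h8 : 8 * C * gauge (t - a) * N ≤ 1 * N := by gcongr
    dsimp only
    nlinarith

/-- Stability of solutions that stay in a fixed ball. -/
lemma IncBound.stability (hA : IncBound τ R C A) :
    ∃ L η : ℝ, 0 ≤ L ∧ 0 < η ∧ ∀ b ≤ τ, ∀ K K' z y, SolOn A 0 b R K z → SolOn A 0 b R K' y →
      (∀ t, 0 ≤ t → t ≤ b → ‖z t - y t‖ ≤ L * ‖z 0 - y 0‖) ∧
      ∀ s t, 0 ≤ s → s ≤ t → t ≤ b → t - s ≤ η →
        ‖(z t - y t) - (z s - y s)‖ ≤ L * ‖z 0 - y 0‖ * gauge (t - s) ∧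
        ‖rem A z s t - rem A y s t‖ ≤ L * ‖z 0 - y 0‖ * gauge (t - s) ^ 2 := by
  obtain ⟨η, hη0, hη⟩ := exists_mul_gauge_le (8 * C) one_pos
  obtain ⟨m, hm⟩ := exists_nat_ge (τ / η)
  have hC := hA.nonneg
  have hpos : (0 : ℝ) < 2 ^ m := by positivity
  refine ⟨2 ^ m * (1 + 4 * C + 24 * C ^ 2), η, by positivity, hη0, ?_⟩
  intro b hb K K' z y hz hy
  have key : ∀ j : ℕ, ∀ t, 0 ≤ t → t ≤ b → t ≤ j * η → ‖z t - y t‖ ≤ 2 ^ j * ‖z 0 - y 0‖ := by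
    intro j
    induction j with
    | zero =>
      intro t h1 h2 h3
      have : t = 0 := by simp at h3; linarith
      simp [this]
    | succ j ih =>
      intro t h1 h2 h3
      push_cast at h3
      rcases le_total t (j * η) with h | h
      · refine (ih t h1 h2 h).trans ?_
        gcongr
        · norm_num
        · exact Nat.le_succ j
      · have hj : 0 ≤ (j : ℝ) * η := by positivity
        have h4 := hA.diff_le_short hη hj (h2.trans hb) (hz.mono hj h2) (hy.mono hj h2)
          (by linarith) h le_rfl
        have h5 := ih (j * η) hj (h.trans h2) le_rfl
        rw [pow_succ]
        linarith
  have hN : ∀ t, 0 ≤ t → t ≤ b → ‖z t - y t‖ ≤ 2 ^ m * ‖z 0 - y 0‖ := fun t h1 h2 =>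
    key m t h1 h2 ((h2.trans hb).trans (by rwa [div_le_iff₀ hη0] at hm))
  have hD := norm_nonneg (z 0 - y 0)
  refine ⟨fun t h1 h2 => (hN t h1 h2).trans ?_, fun s t h1 h2 h3 h4 => ⟨?_, ?_⟩⟩
  · gcongr
    have : 0 ≤ 4 * C + 24 * C ^ 2 := by positivity
    nlinarith
  · refine (hA.diff_increment hη le_rfl hb hz hy hN h1 h2 h3 h4).trans ?_
    have g0 := gauge_nonneg (h := t - s) (by linarith)
    have : 0 ≤ (1 + 24 * C ^ 2) * (2 ^ m * ‖z 0 - y 0‖ * gauge (t - s)) := by positivity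
    linarith
  · refine (hA.diff_rem hη le_rfl hb hz hy hN h1 h2 h3 h4).trans ?_
    have : 0 ≤ (1 + 4 * C) * (2 ^ m * ‖z 0 - y 0‖ * gauge (t - s) ^ 2) := by positivity
    linarith

lemma IncBound.continuousOn_sol (hA : IncBound τ R C A) (hz : SolOn A 0 τ R K z) :
    ContinuousOn z (Icc 0 τ) := by
  obtain ⟨η, hη0, hη⟩ := exists_mul_gauge_le (8 * C) one_pos
  have hsym : ∀ s ∈ Icc 0 τ, ∀ t ∈ Icc 0 τ, |t - s| ≤ η →
      ‖z t - z s‖ ≤ 2 * C * gauge |t - s| := by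
    intro s hs t ht h
    rcases le_total s t with hst | hst
    · rw [abs_of_nonneg (by linarith)] at h ⊢
      exact hA.sol_increment hη le_rfl le_rfl hz hs.1 hst ht.2 h
    · rw [abs_sub_comm, abs_of_nonneg (by linarith)] at h ⊢
      rw [norm_sub_rev]
      exact hA.sol_increment hη le_rfl le_rfl hz ht.1 hst hs.2 h
  intro s hs
  rw [ContinuousWithinAt, tendsto_iff_norm_sub_tendsto_zero]
  have h1 : Tendsto (fun t : ℝ => |t - s|) (𝓝[Icc 0 τ] s) (𝓝 0) := by
    have : Tendsto (fun t : ℝ => |t - s|) (𝓝 s) (𝓝 |s - s|) :=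
      (continuous_abs.comp (continuous_id.sub continuous_const)).tendsto s
    simp only [sub_self, abs_zero] at this
    exact this.mono_left nhdsWithin_le_nhds
  have h2 : Tendsto (fun t : ℝ => 2 * C * gauge |t - s|) (𝓝[Icc 0 τ] s) (𝓝 0) := by
    have := ((continuous_gauge.tendsto 0).comp h1).const_mul (2 * C)
    simpa using this
  refine squeeze_zero' (Eventually.of_forall fun _ => norm_nonneg _) ?_ h2
  filter_upwards [self_mem_nhdsWithin, h1.eventually (Iic_mem_nhds hη0)] with t ht h
  exact hsym s hs t ht h

end Stability

section Regular

variable {V : Type*} [NormedAddCommGroup V] [NormedSpace ℝ V]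

/-- A time-dependent vector field on `[0, τ]`, smooth in space, all of whose space derivatives are
Hölder continuous in time, locally uniformly in space. -/
structure RegField (τ : ℝ) (A : ℝ → V → V) : Prop where
  smooth : ∀ t, 0 ≤ t → t ≤ τ → ContDiff ℝ ∞ (A t)
  bound : ∀ (n : ℕ) (R : ℝ), ∃ C : ℝ, ∀ s t, 0 ≤ s → s ≤ t → t ≤ τ → ∀ x, ‖x‖ ≤ R →
    ‖iteratedFDeriv ℝ n (inc A s t) x‖ ≤ C * gauge (t - s)

lemma four_point {F : V → V} {B : Set V} {M : ℝ} (hB : Convex ℝ B) (hF : Differentiable ℝ F)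
    (hM : ∀ x ∈ B, ‖fderiv ℝ F x‖ ≤ M)
    (hL : ∀ x ∈ B, ∀ x' ∈ B, ‖fderiv ℝ F x - fderiv ℝ F x'‖ ≤ M * ‖x - x'‖)
    {x x' y y' : V} (hx : x ∈ B) (hx' : x' ∈ B) (hy : y ∈ B) (hy' : y' ∈ B) {N : ℝ}
    (hN : ‖x - y‖ ≤ N) (hN' : ‖x' - y'‖ ≤ N) :
    ‖(F x' - F y') - (F x - F y)‖ ≤ M * (‖(x' - y') - (x - y)‖ + N * ‖x' - x‖) := by
  have hM0 : 0 ≤ M := (norm_nonneg _).trans (hM x hx)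
  let p : ℝ → V := fun l => x + l • (x' - x)
  let r : ℝ → V := fun l => y + l • (y' - y)
  have hp : ∀ l, HasDerivAt p (x' - x) l := fun l => by
    have h := ((hasDerivAt_id l).smul_const (x' - x)).const_add x
    rw [one_smul] at h
    exact h
  have hr : ∀ l, HasDerivAt r (y' - y) l := fun l => by
    have h := ((hasDerivAt_id l).smul_const (y' - y)).const_add y
    rw [one_smul] at h
    exact h
  have hg : ∀ l, HasDerivAt (fun l => F (p l) - F (r l))
      (fderiv ℝ F (p l) (x' - x) - fderiv ℝ F (r l) (y' - y)) l := fun l =>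
    ((hF _).hasFDerivAt.comp_hasDerivAt l (hp l)).sub
      ((hF _).hasFDerivAt.comp_hasDerivAt l (hr l))
  have key := norm_image_sub_le_of_norm_deriv_le_segment_01'
    (f := fun l => F (p l) - F (r l))
    (C := M * (‖(x' - y') - (x - y)‖ + N * ‖x' - x‖))
    (fun l _ => (hg l).hasDerivWithinAt) ?_
  · simpa [p, r] using key
  · intro l hl
    have hpB : p l ∈ B := hB.add_smul_sub_mem hx hx' ⟨hl.1, hl.2.le⟩
    have hrB : r l ∈ B := hB.add_smul_sub_mem hy hy' ⟨hl.1, hl.2.le⟩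
    have e : fderiv ℝ F (p l) (x' - x) - fderiv ℝ F (r l) (y' - y) =
        fderiv ℝ F (r l) ((x' - y') - (x - y)) +
        (fderiv ℝ F (p l) - fderiv ℝ F (r l)) (x' - x) := by
      simp only [map_sub, sub_apply]; abel
    have hd : ‖p l - r l‖ ≤ N := by
      have : p l - r l = (1 - l) • (x - y) + l • (x' - y') := by
        simp only [p, r]; module
      rw [this]
      refine (norm_add_le _ _).trans ?_
      rw [norm_smul, norm_smul, Real.norm_of_nonneg hl.1, Real.norm_of_nonneg (by linarith [hl.2])]
      nlinarith [hl.1, hl.2]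
    rw [e, mul_add]
    refine (norm_add_le _ _).trans (add_le_add ?_ ?_)
    · exact ContinuousLinearMap.le_of_opNorm_le _ (hM _ hrB) _
    · rw [← mul_assoc]
      refine ContinuousLinearMap.le_of_opNorm_le _ ((hL _ hpB _ hrB).trans ?_) _
      gcongr

variable {τ : ℝ} {A : ℝ → V → V}

lemma RegField.contDiff_inc (hA : RegField τ A) {s t : ℝ} (hs : 0 ≤ s) (hst : s ≤ t)
    (ht : t ≤ τ) : ContDiff ℝ ∞ (inc A s t) :=
  (hA.smooth t (hs.trans hst) ht).sub (hA.smooth s hs (hst.trans ht))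

lemma RegField.incBound (hA : RegField τ A) (R : ℝ) : ∃ C, IncBound τ R C A := by
  obtain ⟨C₀, h₀⟩ := hA.bound 0 R
  obtain ⟨C₁, h₁⟩ := hA.bound 1 R
  obtain ⟨C₂, h₂⟩ := hA.bound 2 R
  set C := max |C₀| (max |C₁| |C₂|)
  have e₀ : C₀ ≤ C := (le_abs_self _).trans (le_max_left _ _)
  have e₁ : C₁ ≤ C := (le_abs_self _).trans ((le_max_left _ _).trans (le_max_right _ _))
  have e₂ : C₂ ≤ C := (le_abs_self _).trans ((le_max_right _ _).trans (le_max_right _ _))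
  have hC : 0 ≤ C := (abs_nonneg _).trans (le_max_left _ _)
  have hB : Convex ℝ (Metric.closedBall (0 : V) R) := convex_closedBall 0 R
  have mem : ∀ {x : V}, ‖x‖ ≤ R → x ∈ Metric.closedBall (0 : V) R := fun h => by simpa using h
  have hd : ∀ s t, 0 ≤ s → s ≤ t → t ≤ τ → ∀ x ∈ Metric.closedBall (0 : V) R,
      ‖fderiv ℝ (inc A s t) x‖ ≤ C * gauge (t - s) := by
    intro s t hs hst ht x hx
    have := h₁ s t hs hst ht x (by simpa using hx)
    rw [norm_iteratedFDeriv_one] at this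
    refine this.trans (mul_le_mul_of_nonneg_right e₁ (gauge_nonneg (by linarith)))
  have hdiff : ∀ s t, 0 ≤ s → s ≤ t → t ≤ τ → Differentiable ℝ (inc A s t) := fun s t hs hst ht =>
    (hA.contDiff_inc hs hst ht).differentiable (by simp)
  refine ⟨C, hC, ?_, ?_, ?_⟩
  · intro s t hs hst ht x hx
    have := h₀ s t hs hst ht x hx
    rw [norm_iteratedFDeriv_zero] at this
    exact this.trans (mul_le_mul_of_nonneg_right e₀ (gauge_nonneg (by linarith)))
  · intro s t hs hst ht x x' hx hx'
    exact hB.norm_image_sub_le_of_norm_fderiv_le (fun z _ => hdiff s t hs hst ht z)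
      (hd s t hs hst ht) (mem hx) (mem hx')
  · intro s t hs hst ht x x' y y' hx hx' hy hy' N hN hN'
    refine four_point hB (hdiff s t hs hst ht) (hd s t hs hst ht) ?_ (mem hx) (mem hx') (mem hy)
      (mem hy') hN hN'
    intro z hz z' hz'
    have hsm : ContDiff ℝ ∞ (fderiv ℝ (inc A s t)) :=
      (hA.contDiff_inc hs hst ht).fderiv_right (by simp)
    refine hB.norm_image_sub_le_of_norm_fderiv_le
      (fun z _ => hsm.differentiable (by simp) z) ?_ hz' hz
    intro v hv
    have := h₂ s t hs hst ht v (by simpa using hv)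
    rw [← norm_iteratedFDeriv_fderiv, norm_iteratedFDeriv_one] at this
    exact this.trans (mul_le_mul_of_nonneg_right e₂ (gauge_nonneg (by linarith)))

/-- The tangent lift of a time-dependent vector field. -/
def tang (A : ℝ → V → V) (t : ℝ) (p : V × V) : V × V := (A t p.1, fderiv ℝ (A t) p.1 p.2)

lemma RegField.inc_tang (hA : RegField τ A) {s t : ℝ} (hs : 0 ≤ s) (hst : s ≤ t) (ht : t ≤ τ) :
    inc (tang A) s t = fun p => (inc A s t p.1, fderiv ℝ (inc A s t) p.1 p.2) := by
  funext p
  have h1 := (hA.smooth t (hs.trans hst) ht).differentiable (by simp) p.1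
  have h2 := (hA.smooth s hs (hst.trans ht)).differentiable (by simp) p.1
  have e : fderiv ℝ (inc A s t) p.1 = fderiv ℝ (A t) p.1 - fderiv ℝ (A s) p.1 := fderiv_sub h1 h2
  rw [e]
  simp [inc, tang]

lemma contDiff_fderiv_apply_snd {F : V → V} (hF : ContDiff ℝ ∞ F) :
    ContDiff ℝ ∞ (fun p : V × V => fderiv ℝ F p.1 p.2) :=
  ((hF.fderiv_right (m := ∞) (by simp)).comp contDiff_fst).clm_apply contDiff_snd

lemma norm_iteratedFDeriv_comp_fst_le {W : Type*} [NormedAddCommGroup W] [NormedSpace ℝ W]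
    {F : V → W} (hF : ContDiff ℝ ∞ F) (n : ℕ) (p : V × V) :
    ‖iteratedFDeriv ℝ n (fun p : V × V => F p.1) p‖ ≤ ‖iteratedFDeriv ℝ n F p.1‖ := by
  have h := (ContinuousLinearMap.fst ℝ V V).iteratedFDeriv_comp_right hF p (i := n)
    (mod_cast le_top)
  have e : (F ∘ (ContinuousLinearMap.fst ℝ V V)) = fun p : V × V => F p.1 := rfl
  rw [e] at h
  rw [h]
  refine (ContinuousMultilinearMap.norm_compContinuousLinearMap_le _ _).trans ?_
  refine mul_le_of_le_one_right (norm_nonneg _) ?_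
  exact Finset.prod_le_one (fun _ _ => norm_nonneg _)
    (fun _ _ => ContinuousLinearMap.norm_fst_le ℝ V V)

lemma RegField.tang [FiniteDimensional ℝ V] (hA : RegField τ A) : RegField τ (tang A) := by
  refine ⟨fun t h0 ht => ((hA.smooth t h0 ht).comp contDiff_fst).prodMk
    (contDiff_fderiv_apply_snd (hA.smooth t h0 ht)), ?_⟩
  intro n R
  choose C hC using fun m => hA.bound m R
  have hsnd : ∀ m : ℕ, ∃ M, ∀ p : V × V, ‖p‖ ≤ R →
      ‖iteratedFDeriv ℝ m (Prod.snd : V × V → V) p‖ ≤ M := by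
    intro m
    obtain ⟨M, hM⟩ := (isCompact_closedBall (0 : V × V) R).exists_bound_of_continuousOn
      ((contDiff_snd (𝕜 := ℝ) (E := V) (F := V) (n := ∞)).continuous_iteratedFDeriv (m := m)
        (mod_cast le_top)).continuousOn
    exact ⟨M, fun p hp => hM p (by simpa using hp)⟩
  choose M hM using hsnd
  refine ⟨|C n| + ∑ i ∈ Finset.range (n + 1), (n.choose i) * |C (i + 1)| * |M (n - i)|, ?_⟩
  intro s t hs hst ht p hp
  have hg := gauge_nonneg (h := t - s) (by linarith)
  have hp1 : ‖p.1‖ ≤ R := (norm_fst_le p).trans hp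
  have hF := hA.contDiff_inc hs hst ht
  have hDF : ContDiff ℝ ∞ (fderiv ℝ (inc A s t)) := hF.fderiv_right (by simp)
  rw [hA.inc_tang hs hst ht, iteratedFDeriv_prodMk
    (f := fun p : V × V => inc A s t p.1) (hF.comp contDiff_fst).contDiffAt (contDiff_fderiv_apply_snd hF).contDiffAt
    (mod_cast le_top), ContinuousMultilinearMap.opNorm_prod]
  have b1 : ‖iteratedFDeriv ℝ n (fun p : V × V => inc A s t p.1) p‖ ≤ |C n| * gauge (t - s) := by
    refine (norm_iteratedFDeriv_comp_fst_le hF n p).trans ((hC n s t hs hst ht _ hp1).trans ?_)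
    gcongr
    exact le_abs_self _
  have b2 : ‖iteratedFDeriv ℝ n (fun p : V × V => fderiv ℝ (inc A s t) p.1 p.2) p‖ ≤
      (∑ i ∈ Finset.range (n + 1), (n.choose i) * |C (i + 1)| * |M (n - i)|) * gauge (t - s) := by
    refine (norm_iteratedFDeriv_clm_apply (hDF.comp contDiff_fst) contDiff_snd p
      (n := n) (mod_cast le_top)).trans ?_
    rw [Finset.sum_mul]
    refine Finset.sum_le_sum fun i _ => ?_
    have c1 : ‖iteratedFDeriv ℝ i (fderiv ℝ (inc A s t) ∘ Prod.fst) p‖ ≤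
        |C (i + 1)| * gauge (t - s) := by
      refine (norm_iteratedFDeriv_comp_fst_le hDF i p).trans ?_
      rw [norm_iteratedFDeriv_fderiv]
      refine (hC (i + 1) s t hs hst ht _ hp1).trans ?_
      gcongr
      exact le_abs_self _
    have c2 := (hM (n - i) p hp).trans (le_abs_self _)
    calc _ ≤ (n.choose i) * (|C (i + 1)| * gauge (t - s)) * |M (n - i)| := by gcongr
      _ = _ := by ring
  rw [add_mul]
  refine max_le (b1.trans ?_) (b2.trans ?_)
  · have : 0 ≤ ∑ i ∈ Finset.range (n + 1), (n.choose i) * |C (i + 1)| * |M (n - i)| :=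
      Finset.sum_nonneg fun i _ => by positivity
    have := mul_nonneg this hg
    linarith
  · have : 0 ≤ |C n| * gauge (t - s) := by positivity
    linarith

end Regular

section Solutions

variable {V : Type*} [NormedAddCommGroup V] [NormedSpace ℝ V]

/-- `y` solves `y_t = x + ∫₀ᵗ A(dr, y_r)` on `[0, τ]`, formulated through its Euler remainders. -/
def IsSol (τ : ℝ) (A : ℝ → V → V) (x : V) (y : ℝ → V) : Prop :=
  y 0 = x ∧ ∃ R K, SolOn A 0 τ R K y

variable {τ : ℝ} {A : ℝ → V → V} {x : V} {y z : ℝ → V}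

lemma RegField.isSol_of_local (hA : RegField τ A) {R K η : ℝ} (hη : 0 < η) (h0 : y 0 = x)
    (hR : ∀ t, 0 ≤ t → t ≤ τ → ‖y t‖ ≤ R)
    (hK : ∀ s t, 0 ≤ s → s ≤ t → t ≤ τ → t - s ≤ η → ‖rem A y s t‖ ≤ K * gauge (t - s) ^ 2) :
    IsSol τ A x y := by
  obtain ⟨C, hC⟩ := hA.incBound R
  refine ⟨h0, R, max K ((2 * R + C * gauge τ) / gauge η ^ 2), hR, ?_⟩
  intro s t hs hst ht
  rcases le_total (t - s) η with h | h
  · exact (hK s t hs hst ht h).trans (mul_le_mul_of_nonneg_right (le_max_left _ _) (sq_nonneg _))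
  · have hg := gauge_pos hη
    have h1 := hR s hs (hst.trans ht)
    have h2 := hR t (hs.trans hst) ht
    have h3 := hC.bound s t hs hst ht (y s) h1
    have h4 := gauge_mono (h := t - s) (k := τ) (by linarith) (by linarith)
    have h5 := gauge_mono hη.le h
    have h6 : C * gauge (t - s) ≤ C * gauge τ := mul_le_mul_of_nonneg_left h4 hC.nonneg
    have h7 : ‖rem A y s t‖ ≤ 2 * R + C * gauge τ := by
      refine (norm_sub_le _ _).trans ?_
      have := norm_sub_le (y t) (y s)
      linarith
    have h8 : 0 ≤ 2 * R + C * gauge τ := (norm_nonneg _).trans h7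
    calc ‖rem A y s t‖ ≤ 2 * R + C * gauge τ := h7
      _ = (2 * R + C * gauge τ) / gauge η ^ 2 * gauge η ^ 2 := by field_simp
      _ ≤ (2 * R + C * gauge τ) / gauge η ^ 2 * gauge (t - s) ^ 2 := by gcongr
      _ ≤ _ := mul_le_mul_of_nonneg_right (le_max_right _ _) (sq_nonneg _)

lemma RegField.continuousOn_of_isSol (hA : RegField τ A) (hy : IsSol τ A x y) :
    ContinuousOn y (Icc 0 τ) := by
  obtain ⟨_, R, K, h⟩ := hy
  obtain ⟨C, hC⟩ := hA.incBound R
  exact hC.continuousOn_sol h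

lemma RegField.isSol_unique (hA : RegField τ A) (hy : IsSol τ A x y) (hz : IsSol τ A x z)
    {t : ℝ} (h0 : 0 ≤ t) (ht : t ≤ τ) : z t = y t := by
  obtain ⟨hy0, R, K, hy⟩ := hy
  obtain ⟨hz0, R', K', hz⟩ := hz
  obtain ⟨C, hC⟩ := hA.incBound (max R R')
  obtain ⟨L, η, -, -, h⟩ := hC.stability
  have := (h τ le_rfl _ _ z y (hz.mono_radius (le_max_right _ _))
    (hy.mono_radius (le_max_left _ _))).1 t h0 ht
  rw [hz0, hy0, sub_self, norm_zero, mul_zero] at this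
  exact sub_eq_zero.1 (norm_le_zero_iff.1 this)

/-- Local Lipschitz dependence of solutions on the initial value. -/
lemma RegField.local_lipschitz (hA : RegField τ A) (hy : IsSol τ A x y) :
    ∃ r L η : ℝ, 0 < r ∧ 0 ≤ L ∧ 0 < η ∧ ∀ x' z, IsSol τ A x' z → ‖x' - x‖ ≤ r →
      (∀ t, 0 ≤ t → t ≤ τ → ‖z t - y t‖ ≤ L * ‖x' - x‖) ∧
      ∀ s t, 0 ≤ s → s ≤ t → t ≤ τ → t - s ≤ η →
        ‖(z t - y t) - (z s - y s)‖ ≤ L * ‖x' - x‖ * gauge (t - s) ∧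
        ‖rem A z s t - rem A y s t‖ ≤ L * ‖x' - x‖ * gauge (t - s) ^ 2 := by
  have hyc := hA.continuousOn_of_isSol hy
  obtain ⟨hy0, R, K, hy⟩ := hy
  obtain ⟨C, hC⟩ := hA.incBound (R + 1)
  obtain ⟨L, η, hL, hη, h⟩ := hC.stability
  refine ⟨1 / (2 * (L + 1)), L, η, by positivity, hL, hη, ?_⟩
  intro x' z hz hx'
  have hzc := hA.continuousOn_of_isSol hz
  obtain ⟨hz0, R', K', hz⟩ := hz
  have hsmall : (L + 1) * ‖x' - x‖ ≤ 1 / 2 := by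
    rw [le_div_iff₀ (by positivity)] at hx'
    linarith
  have hyR : SolOn A 0 τ (R + 1) K y := hy.mono_radius (by linarith)
  have hfar : ∀ t, 0 ≤ t → t ≤ τ → ‖z t - y t‖ < 1 := by
    by_contra! hcon
    obtain ⟨t₀, ht₀, ht₀τ, ht₁⟩ := hcon
    have hfc : ContinuousOn (fun t => ‖z t - y t‖) (Icc 0 τ) := (hzc.sub hyc).norm
    have hS : IsCompact (Icc 0 τ ∩ (fun t => ‖z t - y t‖) ⁻¹' Ici 1) :=
      isCompact_Icc.of_isClosed_subset
        (hfc.preimage_isClosed_of_isClosed isClosed_Icc isClosed_Ici) inter_subset_left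
    obtain ⟨t₁, ⟨ht₁m, ht₁v⟩, hleast⟩ := hS.exists_isLeast ⟨t₀, ⟨ht₀, ht₀τ⟩, ht₁⟩
    have hf0 : ‖z 0 - y 0‖ ≤ 3 / 4 := by
      rw [hz0, hy0]; nlinarith [norm_nonneg (x' - x)]
    obtain ⟨c, hc, hcv⟩ := intermediate_value_Icc ht₁m.1
      (hfc.mono (Icc_subset_Icc_right ht₁m.2))
      (show (3 / 4 : ℝ) ∈ Icc _ _ from ⟨hf0, by
        have : (1 : ℝ) ≤ ‖z t₁ - y t₁‖ := ht₁v
        linarith⟩)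
    dsimp only at hcv
    have hct : c < t₁ := lt_of_le_of_ne hc.2 (by
      rintro rfl
      have : (1 : ℝ) ≤ ‖z c - y c‖ := ht₁v
      linarith)
    have hzR : SolOn A 0 c (R + 1) K' z := by
      refine ⟨fun t h1 h2 => ?_, (hz.mono le_rfl (hc.2.trans ht₁m.2)).rem_le⟩
      have h3 : ‖z t - y t‖ < 1 := by
        by_contra! h4
        exact absurd (hleast ⟨⟨h1, h2.trans (hc.2.trans ht₁m.2)⟩, h4⟩) (by linarith)
      have h4 := hy.bound t h1 (h2.trans (hc.2.trans ht₁m.2))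
      have h5 := norm_le_norm_add_norm_sub' (z t) (y t)
      linarith
    have := (h c (hc.2.trans ht₁m.2) _ _ z y hzR
      (hyR.mono le_rfl (hc.2.trans ht₁m.2))).1 c hc.1 le_rfl
    rw [hz0, hy0] at this
    nlinarith [norm_nonneg (x' - x)]
  have hzR : SolOn A 0 τ (R + 1) K' z := by
    refine ⟨fun t h1 h2 => ?_, hz.rem_le⟩
    have h3 := hfar t h1 h2
    have h4 := hy.bound t h1 h2
    have h5 := norm_le_norm_add_norm_sub' (z t) (y t)
    linarith
  have := h τ le_rfl _ _ z y hzR hyR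
  rwa [hz0, hy0] at this

/-- Limits of difference quotients of solutions solve the tangent equation. -/
lemma RegField.tangent_limit [FiniteDimensional ℝ V] (hA : RegField τ A) {U : Set V}
    (hU : IsOpen U) {y : V → ℝ → V} (hy : ∀ x ∈ U, IsSol τ A x (y x)) (hx : x ∈ U)
    {ι : Type*} (g : Ultrafilter ι) {v : ι → V} {c : ι → ℝ} {h : V} (hτ : 0 ≤ τ)
    (hv : Tendsto v g (𝓝 0)) (hcv : Tendsto (fun a => c a • v a) g (𝓝 h)) :
    ∃ k : ℝ → V, (∀ t, 0 ≤ t → t ≤ τ →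
        Tendsto (fun a => c a • (y (x + v a) t - y x t)) g (𝓝 (k t))) ∧
      IsSol τ (NLYoung.tang A) (x, h) (fun t => (y x t, k t)) := by
  obtain ⟨r, L, η, hr, hL, hη, H⟩ := hA.local_lipschitz (hy x hx)
  have hxv : Tendsto (fun a => x + v a) g (𝓝 x) := by simpa using hv.const_add x
  have e1 : ∀ᶠ a in (g : Filter ι), x + v a ∈ U := hxv.eventually (hU.mem_nhds hx)
  have e2 : ∀ᶠ a in (g : Filter ι), ‖v a‖ ≤ r := by
    have := hv.norm
    rw [norm_zero] at this
    exact this.eventually (Iic_mem_nhds hr)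
  have e3 : ∀ᶠ a in (g : Filter ι), ‖c a • v a‖ ≤ ‖h‖ + 1 :=
    hcv.norm.eventually (Iic_mem_nhds (lt_add_one _))
  have hM : 0 ≤ L * (‖h‖ + 1) := by positivity
  have scale : ∀ a, ‖c a • v a‖ ≤ ‖h‖ + 1 → ∀ (w : V) (m : ℝ), 0 ≤ m →
      ‖w‖ ≤ L * ‖v a‖ * m → ‖c a • w‖ ≤ L * (‖h‖ + 1) * m := by
    intro a ha w m hm hw
    rw [norm_smul] at ha ⊢
    calc ‖c a‖ * ‖w‖ ≤ ‖c a‖ * (L * ‖v a‖ * m) := by gcongr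
      _ = L * (‖c a‖ * ‖v a‖) * m := by ring
      _ ≤ _ := by gcongr
  have bd : ∀ t, 0 ≤ t → t ≤ τ → ∀ᶠ a in (g : Filter ι),
      ‖c a • (y (x + v a) t - y x t)‖ ≤ L * (‖h‖ + 1) := by
    intro t h0 ht
    filter_upwards [e1, e2, e3] with a h1 h2 h3
    have := (H (x + v a) _ (hy _ h1) (by simpa using h2)).1 t h0 ht
    rw [add_sub_cancel_left] at this
    simpa using scale a h3 _ 1 zero_le_one (by simpa using this)
  have ex : ∀ t, ∃ k, 0 ≤ t → t ≤ τ →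
      (Tendsto (fun a => c a • (y (x + v a) t - y x t)) g (𝓝 k) ∧ ‖k‖ ≤ L * (‖h‖ + 1)) := by
    intro t
    by_cases ht : 0 ≤ t ∧ t ≤ τ
    · obtain ⟨k, hk, hlim⟩ := (isCompact_closedBall (0 : V) (L * (‖h‖ + 1))).ultrafilter_le_nhds'
        (g.map fun a => c a • (y (x + v a) t - y x t)) (by
          refine Ultrafilter.mem_map.2 ?_
          have := bd t ht.1 ht.2
          refine Filter.mem_of_superset this fun a ha => ?_
          simpa using ha)
      exact ⟨k, fun _ _ => ⟨hlim, by simpa using hk⟩⟩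
    · exact ⟨0, fun h1 h2 => absurd ⟨h1, h2⟩ ht⟩
  choose k hk using ex
  refine ⟨k, fun t h1 h2 => (hk t h1 h2).1, ?_⟩
  obtain ⟨hy0, R, K, hyx⟩ := hy x hx
  have hRn : 0 ≤ R := (norm_nonneg _).trans (hyx.bound 0 le_rfl hτ)
  refine hA.tang.isSol_of_local (R := R + L * (‖h‖ + 1)) (K := |K| + L * (‖h‖ + 1)) hη ?_ ?_ ?_
  · have h1 := (hk 0 le_rfl hτ).1
    have h2 : Tendsto (fun a => c a • (y (x + v a) 0 - y x 0)) g (𝓝 h) := by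
      refine hcv.congr' ?_
      filter_upwards [e1] with a ha
      rw [(hy _ ha).1, hy0, add_sub_cancel_left]
    rw [hy0, tendsto_nhds_unique h1 h2]
  · intro t h1 h2
    have h3 := hyx.bound t h1 h2
    have h4 := (hk t h1 h2).2
    exact max_le (h3.trans (by linarith)) (h4.trans (by linarith))
  · intro s t hs hst ht hts
    have hg : 0 ≤ gauge (t - s) ^ 2 := sq_nonneg _
    have hF := (hA.contDiff_inc hs hst ht).differentiable (by simp) (y x s)
    have ks := (hk s hs (hst.trans ht)).1
    have kt := (hk t (hs.trans hst) ht).1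
    have hds : Tendsto (fun a => y (x + v a) s - y x s) g (𝓝 0) := by
      have hLv : Tendsto (fun a => L * ‖v a‖) g (𝓝 0) := by simpa using hv.norm.const_mul L
      refine squeeze_zero_norm' ?_ hLv
      filter_upwards [e1, e2] with a h1 h2
      have := (H (x + v a) _ (hy _ h1) (by simpa using h2)).1 s hs (hst.trans ht)
      rwa [add_sub_cancel_left] at this
    have hinc := hF.hasFDerivAt.hasFDerivWithinAt.lim (s := univ) hds (by simp) ks
    have hlim : Tendsto (fun a => c a • (rem A (y (x + v a)) s t - rem A (y x) s t)) g
        (𝓝 (k t - k s - fderiv ℝ (inc A s t) (y x s) (k s))) := by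
      refine ((kt.sub ks).sub hinc).congr fun a => ?_
      rw [add_sub_cancel]
      simp only [rem]
      module
    have h5 : ‖k t - k s - fderiv ℝ (inc A s t) (y x s) (k s)‖ ≤
        L * (‖h‖ + 1) * gauge (t - s) ^ 2 := by
      refine le_of_tendsto hlim.norm ?_
      filter_upwards [e1, e2, e3] with a h1 h2 h3
      have := ((H (x + v a) _ (hy _ h1) (by simpa using h2)).2 s t hs hst ht hts).2
      rw [add_sub_cancel_left] at this
      exact scale a h3 _ _ hg this
    have h6 := hyx.rem_le s t hs hst ht
    have h7 : K * gauge (t - s) ^ 2 ≤ |K| * gauge (t - s) ^ 2 := by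
      gcongr; exact le_abs_self K
    have h8 : 0 ≤ |K| * gauge (t - s) ^ 2 := by positivity
    have h9 : 0 ≤ L * (‖h‖ + 1) * gauge (t - s) ^ 2 := by positivity
    have e : rem (NLYoung.tang A) (fun t => (y x t, k t)) s t =
        (rem A (y x) s t, k t - k s - fderiv ℝ (inc A s t) (y x s) (k s)) := by
      simp [rem, hA.inc_tang hs hst ht]
    rw [e, add_mul]
    exact max_le (by dsimp only; linarith) (by dsimp only; linarith)

lemma RegField.exists_tangent [FiniteDimensional ℝ V] (hA : RegField τ A) {U : Set V}
    (hU : IsOpen U) {y : V → ℝ → V} (hy : ∀ x ∈ U, IsSol τ A x (y x)) (hx : x ∈ U) (hτ : 0 ≤ τ)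
    (h : V) : ∃ k : ℝ → V, IsSol τ (NLYoung.tang A) (x, h) (fun t => (y x t, k t)) := by
  obtain ⟨g, hg⟩ := Ultrafilter.exists_le (𝓝[>] (0 : ℝ))
  have hv : Tendsto (fun ε : ℝ => ε • h) g (𝓝 0) := by
    have : Tendsto (fun ε : ℝ => ε • h) (𝓝 0) (𝓝 ((0 : ℝ) • h)) :=
      (continuous_id.smul continuous_const).tendsto 0
    rw [zero_smul] at this
    exact this.mono_left (hg.trans nhdsWithin_le_nhds)
  have hcv : Tendsto (fun ε : ℝ => ε⁻¹ • ε • h) g (𝓝 h) := by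
    refine tendsto_const_nhds.congr' ?_
    filter_upwards [hg self_mem_nhdsWithin] with ε hε
    rw [inv_smul_smul₀ (ne_of_gt hε)]
  obtain ⟨k, -, hk⟩ := hA.tangent_limit hU hy hx g hτ hv hcv
  exact ⟨k, hk⟩

lemma RegField.tangent_linear (hA : RegField τ A) {y : ℝ → V} {h h' : V} {k k' : ℝ → V} (a : ℝ)
    (hk : IsSol τ (NLYoung.tang A) (x, h) (fun t => (y t, k t)))
    (hk' : IsSol τ (NLYoung.tang A) (x, h') (fun t => (y t, k' t))) :
    IsSol τ (NLYoung.tang A) (x, a • h + h') (fun t => (y t, a • k t + k' t)) := by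
  obtain ⟨h0, R, K, hs⟩ := hk
  obtain ⟨h0', R', K', hs'⟩ := hk'
  have e : ∀ k : ℝ → V, ∀ s t, 0 ≤ s → s ≤ t → t ≤ τ →
      rem (NLYoung.tang A) (fun t => (y t, k t)) s t =
        (rem A y s t, k t - k s - fderiv ℝ (inc A s t) (y s) (k s)) := by
    intro k s t hs hst ht
    simp [rem, hA.inc_tang hs hst ht]
  refine ⟨?_, |a| * |R| + |R'| + |R|, |a| * |K| + |K'| + |K|, ?_, ?_⟩
  · simp only [Prod.mk.injEq] at h0 h0' ⊢
    exact ⟨h0.1, by rw [h0.2, h0'.2]⟩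
  · intro t h1 h2
    have b1 := hs.bound t h1 h2
    have b2 := hs'.bound t h1 h2
    have c1 : ‖y t‖ ≤ |R| := ((le_max_left _ _).trans b1).trans (le_abs_self R)
    have c2 : ‖k t‖ ≤ |R| := ((le_max_right _ _).trans b1).trans (le_abs_self R)
    have c3 : ‖k' t‖ ≤ |R'| := ((le_max_right _ _).trans b2).trans (le_abs_self R')
    refine max_le ?_ ?_
    · have : 0 ≤ |a| * |R| + |R'| := by positivity
      dsimp only; linarith
    · refine (norm_add_le _ _).trans ?_
      rw [norm_smul, Real.norm_eq_abs]
      have : |a| * ‖k t‖ ≤ |a| * |R| := by gcongr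
      have := abs_nonneg R
      linarith
  · intro s t hs0 hst ht
    have b1 := hs.rem_le s t hs0 hst ht
    have b2 := hs'.rem_le s t hs0 hst ht
    rw [e _ s t hs0 hst ht] at b1 b2 ⊢
    set G := gauge (t - s) ^ 2
    have hG : 0 ≤ G := sq_nonneg _
    have d1 : K * G ≤ |K| * G := by gcongr; exact le_abs_self K
    have d2 : K' * G ≤ |K'| * G := by gcongr; exact le_abs_self K'
    have c1 := ((le_max_left _ _).trans b1).trans d1
    have c2 := ((le_max_right _ _).trans b1).trans d1
    have c3 := ((le_max_right _ _).trans b2).trans d2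
    dsimp only at c1 c2 c3
    have hKG : 0 ≤ |K| * G := by positivity
    refine max_le ?_ ?_
    · have : 0 ≤ (|a| * |K| + |K'|) * G := by positivity
      dsimp only; linarith
    · have e2 : a • k t + k' t - (a • k s + k' s) -
          fderiv ℝ (inc A s t) (y s) (a • k s + k' s) =
          a • (k t - k s - fderiv ℝ (inc A s t) (y s) (k s)) +
          (k' t - k' s - fderiv ℝ (inc A s t) (y s) (k' s)) := by
        rw [map_add, map_smul]; module
      dsimp only
      rw [e2]
      refine (norm_add_le _ _).trans ?_
      rw [norm_smul, Real.norm_eq_abs]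
      have := mul_le_mul_of_nonneg_left c2 (abs_nonneg a)
      linarith

end Solutions

section Flow

variable {V : Type*} [NormedAddCommGroup V]

open Classical in
/-- The restriction of `f` to `[0, τ]` as a continuous map, when it is continuous there. -/
def toPath (τ : ℝ) (f : ℝ → V) : C(Icc (0 : ℝ) τ, V) :=
  if h : ContinuousOn f (Icc 0 τ) then ⟨(Icc 0 τ).domRestrict f, h.domRestrict⟩ else 0

lemma toPath_apply {τ : ℝ} {f : ℝ → V} (h : ContinuousOn f (Icc 0 τ)) (t : Icc (0 : ℝ) τ) :
    toPath τ f t = f t := by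
  rw [toPath, dif_pos h]; rfl

/-- Pointwise convergence of an eventually equi-Hölder family of paths is uniform. -/
lemma tendsto_path_of_pointwise {ι : Type*} {l : Filter ι} {τ M η : ℝ} (hη : 0 < η)
    {F : ι → C(Icc (0 : ℝ) τ, V)} {G : C(Icc (0 : ℝ) τ, V)}
    (hF : ∀ᶠ a in l, ∀ s t : Icc (0 : ℝ) τ, s ≤ t → (t : ℝ) - s ≤ η →
      ‖F a t - F a s‖ ≤ M * gauge (t - s))
    (hG : ∀ t, Tendsto (fun a => F a t) l (𝓝 (G t))) : Tendsto F l (𝓝 G) := by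
  classical
  let P : ι → Prop := fun a => ∀ s t : Icc (0 : ℝ) τ, s ≤ t → (t : ℝ) - s ≤ η →
      ‖F a t - F a s‖ ≤ M * gauge (t - s)
  let F' : ι → Icc (0 : ℝ) τ → V := fun a => if P a then F a else 0
  have hFF : ∀ᶠ a in l, F' a = F a := by
    filter_upwards [hF] with a ha
    exact if_pos ha
  have heq : Equicontinuous F' := by
    intro t₀
    have hg : Continuous fun t : Icc (0 : ℝ) τ => |M| * gauge |(t : ℝ) - t₀| :=
      continuous_const.mul (continuous_gauge.comp
        (continuous_abs.comp (continuous_subtype_val.sub continuous_const)))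
    refine Metric.equicontinuousAt_of_continuity_modulus
      (fun t : Icc (0 : ℝ) τ => |M| * gauge |(t : ℝ) - t₀|) (by simpa using hg.tendsto t₀) _ ?_
    have hnear : ∀ᶠ t : Icc (0 : ℝ) τ in 𝓝 t₀, |(t : ℝ) - t₀| < η := by
      have hc : Continuous fun t : Icc (0 : ℝ) τ => |(t : ℝ) - t₀| :=
        continuous_abs.comp (continuous_subtype_val.sub continuous_const)
      exact (hc.tendsto t₀).eventually (gt_mem_nhds (by simpa using hη))
    filter_upwards [hnear] with t ht a
    have hn := gauge_nonneg (abs_nonneg ((t : ℝ) - t₀))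
    by_cases ha : P a
    · have e : F' a = F a := if_pos ha
      rw [e]
      rcases le_total t₀ t with h | h
      · have h' : (t₀ : ℝ) ≤ t := h
        rw [abs_of_nonneg (sub_nonneg.2 h')] at ht hn ⊢
        rw [dist_comm, dist_eq_norm]
        exact (ha t₀ t h ht.le).trans (mul_le_mul_of_nonneg_right (le_abs_self M) hn)
      · have h' : (t : ℝ) ≤ t₀ := h
        rw [abs_sub_comm (t : ℝ), abs_of_nonneg (sub_nonneg.2 h')] at ht hn ⊢
        rw [dist_eq_norm]
        exact (ha t t₀ h ht.le).trans (mul_le_mul_of_nonneg_right (le_abs_self M) hn)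
    · have e : F' a = 0 := if_neg ha
      simp only [e, Pi.zero_apply, dist_self]
      positivity
  rw [ContinuousMap.tendsto_iff_tendstoUniformly]
  have h1 : Tendsto F' l (𝓝 (G : Icc (0 : ℝ) τ → V)) := by
    rw [tendsto_pi_nhds]
    intro t
    refine (hG t).congr' ?_
    filter_upwards [hFF] with a ha
    rw [ha]
  have h2 : TendstoUniformly F' G l := UniformFun.tendsto_iff_tendstoUniformly.1 ((heq.tendsto_uniformFun_iff_pi l _).2 h1)
  intro u hu
  filter_upwards [hFF, h2 u hu] with a ha hau t
  rw [← ha]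
  exact hau t

variable [NormedSpace ℝ V] {τ : ℝ} {A : ℝ → V → V} {x : V} [FiniteDimensional ℝ V]

lemma RegField.exists_tangent_clm (hA : RegField τ A) {y : ℝ → V} {k : V → ℝ → V}
    (hk : ∀ h, IsSol τ (NLYoung.tang A) (x, h) (fun t => (y t, k h t))) :
    ∃ D : V →L[ℝ] C(Icc (0 : ℝ) τ, V), ∀ h t, D h t = k h t := by
  have hc : ∀ h, ContinuousOn (k h) (Icc 0 τ) := fun h =>
    (continuous_snd.comp_continuousOn (hA.tang.continuousOn_of_isSol (hk h)) :)
  have lin : ∀ (a : ℝ) h h' (t : Icc (0 : ℝ) τ), k (a • h + h') t = a • k h t + k h' t := by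
    intro a h h' t
    exact (Prod.ext_iff.1 (hA.tang.isSol_unique (hA.tangent_linear a (hk h) (hk h'))
      (hk (a • h + h')) t.2.1 t.2.2)).2
  have h0 : ∀ t : Icc (0 : ℝ) τ, k 0 t = 0 := by
    intro t
    simpa using lin 1 0 0 t
  let D : V →ₗ[ℝ] C(Icc (0 : ℝ) τ, V) :=
    { toFun := fun h => toPath τ (k h)
      map_add' := fun h h' => by
        ext t
        have := lin 1 h h' t
        simp only [one_smul] at this
        simp [toPath_apply (hc _), this]
      map_smul' := fun a h => by
        ext t
        have := lin a h 0 t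
        rw [add_zero, h0, add_zero] at this
        simp [toPath_apply (hc _), this] }
  exact ⟨LinearMap.toContinuousLinearMap D, fun h t => toPath_apply (hc h) t⟩

/-- The flow is Fréchet differentiable, its derivative being given by the tangent equation. -/
lemma RegField.hasFDerivAt_flow (hA : RegField τ A) (hτ : 0 ≤ τ) {U : Set V} (hU : IsOpen U)
    {y : V → ℝ → V} (hy : ∀ x ∈ U, IsSol τ A x (y x)) {Φ : V → C(Icc (0 : ℝ) τ, V)}
    (hΦ : ∀ x ∈ U, ∀ t, Φ x t = y x t) (hx : x ∈ U) {k : V → ℝ → V}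
    (hk : ∀ h, IsSol τ (NLYoung.tang A) (x, h) (fun t => (y x t, k h t)))
    {D : V →L[ℝ] C(Icc (0 : ℝ) τ, V)} (hD : ∀ h t, D h t = k h t) : HasFDerivAt Φ D x := by
  rw [hasFDerivAt_iff_tendsto, tendsto_iff_ultrafilter]
  intro g hg
  have hv : Tendsto (fun x' => x' - x) g (𝓝 0) := by
    have : Tendsto (fun x' => x' - x) (𝓝 x) (𝓝 (x - x)) := tendsto_id.sub_const x
    rw [sub_self] at this
    exact this.mono_left hg
  have hn : ∀ x', ‖(‖x' - x‖⁻¹) • (x' - x)‖ ≤ 1 := by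
    intro x'
    rw [norm_smul, norm_inv, norm_norm]
    exact inv_mul_le_one
  obtain ⟨h, -, hh⟩ := (isCompact_closedBall (0 : V) 1).ultrafilter_le_nhds'
    (g.map fun x' => (‖x' - x‖⁻¹) • (x' - x))
    (Ultrafilter.mem_map.2 (Filter.mem_of_superset univ_mem fun x' _ => by simpa using hn x'))
  have hcv : Tendsto (fun x' => (‖x' - x‖⁻¹) • (x' - x)) g (𝓝 h) := hh
  obtain ⟨k', hlim, hk'⟩ := hA.tangent_limit hU hy hx g hτ hv hcv
  have hkk : ∀ t : Icc (0 : ℝ) τ, k' t = k h t := fun t =>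
    (Prod.ext_iff.1 (hA.tang.isSol_unique (hk h) hk' t.2.1 t.2.2)).2
  obtain ⟨r, L, η, hr, hL, hη, H⟩ := hA.local_lipschitz (hy x hx)
  have eU : ∀ᶠ x' in (g : Filter V), x' ∈ U := hg (hU.mem_nhds hx)
  have er : ∀ᶠ x' in (g : Filter V), ‖x' - x‖ ≤ r := by
    have := hv.norm
    rw [norm_zero] at this
    exact this.eventually (Iic_mem_nhds hr)
  have hF : Tendsto (fun x' => (‖x' - x‖⁻¹) • (Φ x' - Φ x)) g (𝓝 (D h)) := by
    refine tendsto_path_of_pointwise (M := L) hη ?_ ?_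
    · filter_upwards [eU, er] with x' h1 h2 s t hst hη'
      have h3 := ((H x' _ (hy _ h1) h2).2 s t s.2.1 hst t.2.2 hη').1
      have h4 : ((‖x' - x‖⁻¹) • (Φ x' - Φ x)) t - ((‖x' - x‖⁻¹) • (Φ x' - Φ x)) s =
          (‖x' - x‖⁻¹) • ((y x' t - y x t) - (y x' s - y x s)) := by
        simp [hΦ _ h1, hΦ _ hx, smul_sub]
      rw [h4, norm_smul, norm_inv, norm_norm]
      have h5 := gauge_nonneg (sub_nonneg.2 (show (s : ℝ) ≤ t from hst))
      calc ‖x' - x‖⁻¹ * ‖y x' t - y x t - (y x' s - y x s)‖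
          ≤ ‖x' - x‖⁻¹ * (L * ‖x' - x‖ * gauge (t - s)) := by gcongr
        _ = (‖x' - x‖⁻¹ * ‖x' - x‖) * (L * gauge (t - s)) := by ring
        _ ≤ 1 * (L * gauge (t - s)) := by gcongr; exact inv_mul_le_one
        _ = _ := one_mul _
    · intro t
      rw [hD, ← hkk]
      refine (hlim t t.2.1 t.2.2).congr' ?_
      filter_upwards [eU] with x' h1
      simp [hΦ _ h1, hΦ _ hx]
  have hDv : Tendsto (fun x' => D ((‖x' - x‖⁻¹) • (x' - x))) g (𝓝 (D h)) :=
    (D.continuous.tendsto h).comp hcv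
  have := (hF.sub hDv).norm
  rw [sub_self, norm_zero] at this
  refine this.congr fun x' => ?_
  rw [map_smul, ← smul_sub, norm_smul, norm_inv, norm_norm]

end Flow

/-- The flow of a regular field is of class `C^n` for every `n`. -/
theorem contDiffOn_flow_nat (n : ℕ) : ∀ {V : Type} [NormedAddCommGroup V] [NormedSpace ℝ V]
    [FiniteDimensional ℝ V] {τ : ℝ} {A : ℝ → V → V}, RegField τ A → 0 ≤ τ →
    ∀ {U : Set V}, IsOpen U → ∀ {y : V → ℝ → V}, (∀ x ∈ U, IsSol τ A x (y x)) →
    ∀ {Φ : V → C(Icc (0 : ℝ) τ, V)}, (∀ x ∈ U, ∀ t, Φ x t = y x t) → ContDiffOn ℝ n Φ U := by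
  induction n with
  | zero =>
    intro V _ _ _ τ A hA hτ U hU y hy Φ hΦ
    rw [Nat.cast_zero, contDiffOn_zero]
    intro x hx
    choose k hk using fun h => hA.exists_tangent hU hy hx hτ h
    obtain ⟨D, hD⟩ := hA.exists_tangent_clm hk
    exact (hA.hasFDerivAt_flow hτ hU hy hΦ hx hk hD).continuousAt.continuousWithinAt
  | succ n ih =>
    intro V _ _ _ τ A hA hτ U hU y hy Φ hΦ
    have ex : ∀ p : V × V, ∃ k : ℝ → V, p.1 ∈ U →
        IsSol τ (NLYoung.tang A) p (fun t => (y p.1 t, k t)) := by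
      intro p
      by_cases hp : p.1 ∈ U
      · obtain ⟨k, hk⟩ := hA.exists_tangent hU hy hp hτ p.2
        exact ⟨k, fun _ => hk⟩
      · exact ⟨0, fun h => absurd h hp⟩
    choose k hk using ex
    have hd : ∀ x ∈ U, ∃ D : V →L[ℝ] C(Icc (0 : ℝ) τ, V),
        (∀ h t, D h t = k (x, h) t) ∧ HasFDerivAt Φ D x := by
      intro x hx
      have hkx : ∀ h, IsSol τ (NLYoung.tang A) (x, h) (fun t => (y x t, k (x, h) t)) :=
        fun h => hk (x, h) hx
      obtain ⟨D, hD⟩ := hA.exists_tangent_clm hkx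
      exact ⟨D, hD, hA.hasFDerivAt_flow hτ hU hy hΦ hx hkx hD⟩
    have hU' : IsOpen (U ×ˢ (univ : Set V)) := hU.prod isOpen_univ
    have hsol : ∀ p ∈ U ×ˢ (univ : Set V),
        IsSol τ (NLYoung.tang A) p (fun t => (y p.1 t, k p t)) := fun p hp => hk p hp.1
    have hΨ := ih hA.tang hτ hU' hsol (Φ := fun p => toPath τ (fun t => (y p.1 t, k p t)))
      (fun p hp t => toPath_apply (hA.tang.continuousOn_of_isSol (hsol p hp)) t)
    rw [Nat.cast_succ, contDiffOn_succ_iff_fderiv_of_isOpen hU]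
    refine ⟨fun x hx => ?_, by simp, ?_⟩
    · obtain ⟨D, -, h⟩ := hd x hx
      exact h.differentiableAt.differentiableWithinAt
    rw [contDiffOn_clm_apply]
    intro h
    have hcomp : ContDiffOn ℝ n
        (((ContinuousLinearMap.snd ℝ V V).compLeftContinuous ℝ (Icc (0 : ℝ) τ)) ∘
          (fun p : V × V => toPath τ (fun t => (y p.1 t, k p t))) ∘ fun x => (x, h)) U :=
      (ContinuousLinearMap.contDiff _).comp_contDiffOn
        (hΨ.comp (contDiff_id.prodMk contDiff_const).contDiffOn fun x hx => ⟨hx, mem_univ _⟩)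
    refine hcomp.congr fun x hx => ?_
    obtain ⟨D, hD, hx'⟩ := hd x hx
    rw [hx'.fderiv]
    ext t
    rw [hD]
    have := toPath_apply (hA.tang.continuousOn_of_isSol (hsol (x, h) ⟨hx, mem_univ _⟩)) t
    simp only [Function.comp_apply]
    erw [ContinuousLinearMap.compLeftContinuous_apply]
    simp [this]

section Taylor

variable {E : Type} [NormedAddCommGroup E] [NormedSpace ℝ E]

lemma norm_taylor_two_le {F : Type} [NormedAddCommGroup F] [NormedSpace ℝ F] {f : E → F}
    (hf : ContDiff ℝ ∞ f) {M : ℝ} (hM : ∀ z, ‖iteratedFDeriv ℝ 2 f z‖ ≤ M) (h z : E) :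
    ‖f (z - h) - f z + fderiv ℝ f z h‖ ≤ M * ‖h‖ ^ 2 := by
  have hf' : ContDiff ℝ ∞ (fderiv ℝ f) := hf.fderiv_right (by simp)
  have h2 : ∀ w, ‖fderiv ℝ (fderiv ℝ f) w‖ ≤ M := fun w => by
    rw [← norm_iteratedFDeriv_one, norm_iteratedFDeriv_fderiv]
    exact hM w
  have hM0 : 0 ≤ M := (norm_nonneg _).trans (hM z)
  have h1 : ∀ w ∈ Metric.closedBall z ‖h‖, ‖fderiv ℝ f w - fderiv ℝ f z‖ ≤ M * ‖h‖ := by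
    intro w hw
    refine (Convex.norm_image_sub_le_of_norm_fderiv_le (𝕜 := ℝ) (f := fderiv ℝ f) (C := M)
      (s := univ) (fun w _ => hf'.differentiable (by simp) w) (fun w _ => h2 w) convex_univ
      (mem_univ z) (mem_univ w)).trans ?_
    rw [mem_closedBall_iff_norm] at hw
    gcongr
  have key := Convex.norm_image_sub_le_of_norm_fderiv_le' (𝕜 := ℝ) (f := f)
    (fun w _ => hf.differentiable (by simp) w) h1 (convex_closedBall z ‖h‖)
    (Metric.mem_closedBall_self (norm_nonneg h))
    (show z - h ∈ Metric.closedBall z ‖h‖ by simp)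
  have e : z - h - z = -h := by abel
  rw [e, map_neg, sub_neg_eq_add, norm_neg] at key
  calc _ ≤ M * ‖h‖ * ‖h‖ := key
    _ = _ := by ring

lemma norm_iteratedFDeriv_taylor_two_le (j : ℕ) : ∀ {F : Type} [NormedAddCommGroup F]
    [NormedSpace ℝ F] {f : E → F}, ContDiff ℝ ∞ f → ∀ {M : ℝ},
    (∀ z, ‖iteratedFDeriv ℝ (j + 2) f z‖ ≤ M) → ∀ h z : E,
    ‖iteratedFDeriv ℝ j (fun z => f (z - h) - f z + fderiv ℝ f z h) z‖ ≤ M * ‖h‖ ^ 2 := by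
  induction j with
  | zero =>
    intro F _ _ f hf M hM h z
    rw [norm_iteratedFDeriv_zero]
    exact norm_taylor_two_le hf hM h z
  | succ j ih =>
    intro F _ _ f hf M hM h z
    have hf' : ContDiff ℝ ∞ (fderiv ℝ f) := hf.fderiv_right (by simp)
    have hd := hf.differentiable (by simp)
    have hd' := hf'.differentiable (by simp)
    have e : fderiv ℝ (fun z => f (z - h) - f z + fderiv ℝ f z h) =
        fun z => fderiv ℝ f (z - h) - fderiv ℝ f z + fderiv ℝ (fderiv ℝ f) z h := by
      funext w
      have h1 : HasFDerivAt (fun z => f (z - h)) (fderiv ℝ f (w - h)) w := by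
        have := (hd (w - h)).hasFDerivAt.comp w ((hasFDerivAt_id w).sub_const h)
        rwa [ContinuousLinearMap.comp_id] at this
      have h3 := (hd' w).hasFDerivAt.clm_apply (hasFDerivAt_const h w)
      refine ((h1.sub (hd w).hasFDerivAt).add h3).fderiv.trans ?_
      have hs := (hf.contDiffAt (x := w)).isSymmSndFDerivAt (by
        rw [minSmoothness_of_isRCLikeNormedField]
        exact WithTop.coe_le_coe.2 (le_top : (2 : ℕ∞) ≤ ⊤))
      ext k
      simp [hs.eq h k]
    rw [← norm_iteratedFDeriv_fderiv, e]
    refine ih hf' (fun z => ?_) h z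
    rw [norm_iteratedFDeriv_fderiv]
    exact hM z

end Taylor

section Pairing

variable {E : Type} [NormedAddCommGroup E] [NormedSpace ℝ E]

/-- Smooth functions vanishing outside the closed ball of radius `R`. -/
structure Bump (R : ℝ) (f : E → ℝ) : Prop where
  smooth : ContDiff ℝ ∞ f
  zero : ∀ z, R < ‖z‖ → f z = 0

lemma Bump.tsupport_subset {R : ℝ} {f : E → ℝ} (hf : Bump R f) :
    tsupport f ⊆ Metric.closedBall 0 R := by
  refine closure_minimal (fun z hz => ?_) Metric.isClosed_closedBall
  by_contra h
  exact hz (hf.zero z (by simpa using h))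

lemma Bump.fderiv_eq_zero {R : ℝ} {f : E → ℝ} (hf : Bump R f) {z : E} (hz : R < ‖z‖) :
    fderiv ℝ f z = 0 := by
  by_contra h
  have := hf.tsupport_subset (support_fderiv_subset ℝ h)
  rw [mem_closedBall_zero_iff] at this
  linarith

lemma Bump.comp_sub {R : ℝ} {f : E → ℝ} (hf : Bump R f) (x : E) :
    Bump (R + ‖x‖) (fun z => f (z - x)) where
  smooth := hf.smooth.comp (contDiff_id.sub contDiff_const)
  zero z hz := hf.zero _ (by linarith [norm_sub_norm_le z x])

lemma Bump.mono {R R' : ℝ} {f : E → ℝ} (hf : Bump R f) (h : R ≤ R') : Bump R' f :=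
  ⟨hf.smooth, fun z hz => hf.zero z (h.trans_lt hz)⟩

lemma Bump.partial {R : ℝ} {f : E → ℝ} (hf : Bump R f) (h : E) :
    Bump R (fun z => -fderiv ℝ f z h) where
  smooth := ((hf.smooth.fderiv_right (by simp)).clm_apply contDiff_const).neg
  zero z hz := by simp [hf.fderiv_eq_zero hz]

lemma Bump.norm_iteratedFDeriv_partial_le {R : ℝ} {f : E → ℝ} (hf : Bump R f) (h : E) (j : ℕ)
    (z : E) : ‖iteratedFDeriv ℝ j (fun z => -fderiv ℝ f z h) z‖ ≤
      ‖h‖ * ‖iteratedFDeriv ℝ (j + 1) f z‖ := by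
  have e : (fun z => -fderiv ℝ f z h) = -(fun z => fderiv ℝ f z h) := rfl
  rw [e, iteratedFDeriv_neg_apply, norm_neg, ← norm_iteratedFDeriv_fderiv]
  exact norm_iteratedFDeriv_clm_apply_const (N := ∞)
    (hf.smooth.fderiv_right (by simp)).contDiffAt (by exact_mod_cast le_top)

lemma Bump.taylor {R : ℝ} {f : E → ℝ} (hf : Bump R f) {h : E} (hh : ‖h‖ ≤ 1) :
    Bump (R + 1) (fun z => f (z - h) - f z + fderiv ℝ f z h) where
  smooth := ((hf.comp_sub h).smooth.sub hf.smooth).add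
    ((hf.smooth.fderiv_right (by simp)).clm_apply contDiff_const)
  zero z hz := by
    rw [hf.zero (z - h) (by linarith [norm_sub_norm_le z h]), hf.zero z (by linarith),
      hf.fderiv_eq_zero (by linarith)]
    simp

variable [FiniteDimensional ℝ E]

lemma Bump.hasCompactSupport {R : ℝ} {f : E → ℝ} (hf : Bump R f) : HasCompactSupport f :=
  (isCompact_closedBall 0 R).of_isClosed_subset (isClosed_tsupport f) hf.tsupport_subset

lemma Bump.exists_bound {R : ℝ} {f : E → ℝ} (hf : Bump R f) (N : ℕ) :
    ∃ M, 0 ≤ M ∧ ∀ j ≤ N, ∀ z, ‖iteratedFDeriv ℝ j f z‖ ≤ M := by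
  have : ∀ j : ℕ, ∃ M, ∀ z, ‖iteratedFDeriv ℝ j f z‖ ≤ M := fun j =>
    (hf.hasCompactSupport.iteratedFDeriv j).exists_bound_of_continuous
      (hf.smooth.continuous_iteratedFDeriv (by exact_mod_cast le_top))
  choose M hM using this
  refine ⟨∑ j ∈ Finset.range (N + 1), |M j|, by positivity, fun j hj z => ?_⟩
  exact ((hM j z).trans (le_abs_self _)).trans (Finset.single_le_sum (f := fun j => |M j|)
    (fun _ _ => abs_nonneg _) (Finset.mem_range.2 (by omega)))

open Classical in
/-- A smooth compactly supported function as a Schwartz function; zero for other functions. -/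
def toSchwartz (f : E → ℝ) : SchwartzMap E ℝ :=
  if h : HasCompactSupport f ∧ ContDiff ℝ ∞ f then h.1.toSchwartzMap h.2 else 0

lemma Bump.coe_toSchwartz {R : ℝ} {f : E → ℝ} (hf : Bump R f) : ⇑(toSchwartz f) = f := by
  rw [toSchwartz, dif_pos ⟨hf.hasCompactSupport, hf.smooth⟩]
  rfl

variable {F : Type} [NormedAddCommGroup F] [NormedSpace ℝ F] (b : SchwartzMap E ℝ →L[ℝ] F)

/-- A continuous functional on Schwartz space, restricted to functions supported in a fixed ball,
is controlled by finitely many derivatives. -/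
lemma exists_functional_bound : ∃ N : ℕ, ∀ R : ℝ, ∃ C : ℝ, 0 ≤ C ∧ ∀ f, Bump R f →
    ∀ M, (∀ j ≤ N, ∀ z, ‖iteratedFDeriv ℝ j f z‖ ≤ M) → ‖b (toSchwartz f)‖ ≤ C * M := by
  obtain ⟨s, C, -, hC⟩ := Seminorm.bound_of_continuous (schwartz_withSeminorms ℝ E ℝ)
    ((normSeminorm ℝ F).comp b.toLinearMap) (continuous_norm.comp b.continuous)
  refine ⟨∑ i ∈ s, (i.1 + i.2), fun R => ⟨C * (max 1 R) ^ (∑ i ∈ s, (i.1 + i.2)),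
    by positivity, fun f hf M hM => ?_⟩⟩
  have hM0 : 0 ≤ M := (norm_nonneg _).trans (hM 0 (Nat.zero_le _) 0)
  have h1 : ‖b (toSchwartz f)‖ ≤ C * (s.sup (schwartzSeminormFamily ℝ E ℝ)) (toSchwartz f) :=
    hC (toSchwartz f)
  refine h1.trans ?_
  rw [mul_assoc]
  refine mul_le_mul_of_nonneg_left (Seminorm.finset_sup_apply_le (by positivity) ?_) C.2
  rintro ⟨k, n⟩ hi
  have hkn : k + n ≤ ∑ i ∈ s, (i.1 + i.2) :=
    Finset.single_le_sum (f := fun i : ℕ × ℕ => i.1 + i.2) (fun _ _ => Nat.zero_le _) hi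
  rw [SchwartzMap.schwartzSeminormFamily_apply]
  refine SchwartzMap.seminorm_le_bound ℝ k n _ (by positivity) fun z => ?_
  rw [hf.coe_toSchwartz]
  by_cases hz : ‖z‖ ≤ R
  · have h2 : ‖z‖ ^ k ≤ (max 1 R) ^ (∑ i ∈ s, (i.1 + i.2)) :=
      (pow_le_pow_left₀ (norm_nonneg _) (hz.trans (le_max_right 1 R)) k).trans
        (pow_le_pow_right₀ (le_max_left _ _) (by omega))
    exact mul_le_mul h2 (hM n (by omega) z) (norm_nonneg _) (by positivity)
  · have h2 : iteratedFDeriv ℝ n f z = 0 := by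
      by_contra h
      exact hz (by simpa using hf.tsupport_subset (support_iteratedFDeriv_subset n h))
    rw [h2, norm_zero, mul_zero]
    positivity

/-- The action of the functional `b` on the translates of `f`. -/
def pairing (f : E → ℝ) (x : E) : F := b (toSchwartz fun z => f (z - x))

/-- `v ↦ (h ↦ hᵢ • v)`, with coordinates taken in the standard basis of `E`. -/
def coordSmul (E F : Type) [NormedAddCommGroup E] [NormedSpace ℝ E] [FiniteDimensional ℝ E]
    [NormedAddCommGroup F] [NormedSpace ℝ F] (i : Fin (Module.finrank ℝ E)) : F →L[ℝ] E →L[ℝ] F :=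
  ContinuousLinearMap.smulRightL ℝ E F
    (LinearMap.toContinuousLinearMap ((Module.finBasis ℝ E).coord i))

lemma pairing_taylor {R : ℝ} {f : E → ℝ} (hf : Bump R f) (x : E) {h : E} (hh : ‖h‖ ≤ 1) :
    pairing b f (x + h) - pairing b f x - (∑ i, coordSmul E F i
        (pairing b (fun z => -fderiv ℝ f z (Module.finBasis ℝ E i)) x)) h =
      b (toSchwartz fun z => f (z - x - h) - f (z - x) + fderiv ℝ f (z - x) h) := by
  have e : (∑ i, coordSmul E F i
      (pairing b (fun z => -fderiv ℝ f z (Module.finBasis ℝ E i)) x)) h =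
      b (∑ i, (Module.finBasis ℝ E).repr h i •
        toSchwartz (fun z => -fderiv ℝ f (z - x) (Module.finBasis ℝ E i))) := by
    simp [coordSmul, pairing]
  rw [e, pairing, pairing, ← map_sub, ← map_sub]
  congr 1
  ext z
  have hq := ((hf.taylor hh).comp_sub x).coe_toSchwartz
  have hs : ∀ i, ⇑(toSchwartz (fun z => -fderiv ℝ f (z - x) (Module.finBasis ℝ E i))) = _ :=
    fun i => ((hf.partial (Module.finBasis ℝ E i)).comp_sub x).coe_toSchwartz
  have hz : fderiv ℝ f (z - x) h = ∑ i, (Module.finBasis ℝ E).repr h i *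
      fderiv ℝ f (z - x) (Module.finBasis ℝ E i) := by
    conv_lhs => rw [← (Module.finBasis ℝ E).sum_repr h]
    rw [map_sum]
    simp only [map_smul, smul_eq_mul]
  simp only [sub_apply, sum_apply, smul_apply]
  rw [(hf.comp_sub (x + h)).coe_toSchwartz, (hf.comp_sub x).coe_toSchwartz, hq]
  simp only [hz, hs, smul_eq_mul, mul_neg, Finset.sum_neg_distrib, sub_add_eq_sub_sub]
  ring

lemma hasFDerivAt_pairing {R : ℝ} {f : E → ℝ} (hf : Bump R f) (x : E) :
    HasFDerivAt (pairing b f) (∑ i, coordSmul E F i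
      (pairing b (fun z => -fderiv ℝ f z (Module.finBasis ℝ E i)) x)) x := by
  obtain ⟨N, hN⟩ := exists_functional_bound b
  obtain ⟨C, hC0, hC⟩ := hN (R + 1 + ‖x‖)
  obtain ⟨M, hM0, hM⟩ := hf.exists_bound (N + 2)
  rw [hasFDerivAt_iff_isLittleO_nhds_zero]
  refine Asymptotics.IsBigO.trans_isLittleO (g := fun h : E => ‖h‖ ^ 2) ?_
    (Asymptotics.isLittleO_norm_pow_id one_lt_two)
  refine Asymptotics.IsBigO.of_bound (C * M) ?_
  filter_upwards [Metric.closedBall_mem_nhds (0 : E) one_pos] with h hh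
  rw [mem_closedBall_zero_iff] at hh
  rw [pairing_taylor b hf x hh, norm_pow, norm_norm, mul_assoc]
  refine hC _ ((hf.taylor hh).comp_sub x) _ fun j hj z => ?_
  rw [iteratedFDeriv_comp_sub (f := fun z => f (z - h) - f z + fderiv ℝ f z h)]
  exact norm_iteratedFDeriv_taylor_two_le j hf.smooth (fun z => hM (j + 2) (by omega) z) h _

lemma fderiv_pairing {R : ℝ} {f : E → ℝ} (hf : Bump R f) :
    fderiv ℝ (pairing b f) = fun x => ∑ i, (coordSmul E F i ∘
      pairing b (fun z => -fderiv ℝ f z (Module.finBasis ℝ E i))) x :=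
  funext fun x => (hasFDerivAt_pairing b hf x).fderiv

lemma contDiff_pairing_nat (n : ℕ) : ∀ {R : ℝ} {f : E → ℝ}, Bump R f →
    ContDiff ℝ n (pairing b f) := by
  induction n with
  | zero =>
    intro R f hf
    rw [Nat.cast_zero, contDiff_zero, continuous_iff_continuousAt]
    exact fun x => (hasFDerivAt_pairing b hf x).continuousAt
  | succ n ih =>
    intro R f hf
    rw [Nat.cast_succ, contDiff_succ_iff_fderiv]
    refine ⟨fun x => (hasFDerivAt_pairing b hf x).differentiableAt, by simp, ?_⟩
    rw [fderiv_pairing b hf]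
    exact ContDiff.sum fun i _ => (ContinuousLinearMap.contDiff _).comp (ih (hf.partial _))

lemma contDiff_pairing {R : ℝ} {f : E → ℝ} (hf : Bump R f) : ContDiff ℝ ∞ (pairing b f) :=
  contDiff_infty.2 fun n => contDiff_pairing_nat b n hf

/-- Local bounds for the derivatives of a pairing in terms of finitely many derivatives of the
test function. -/
lemma exists_pairing_bound (R R' : ℝ) (n : ℕ) : ∃ (N : ℕ) (C : ℝ), ∀ f, Bump R f →
    ∀ M, (∀ j ≤ N, ∀ z, ‖iteratedFDeriv ℝ j f z‖ ≤ M) → ∀ x, ‖x‖ ≤ R' →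
      ‖iteratedFDeriv ℝ n (pairing b f) x‖ ≤ C * M := by
  induction n with
  | zero =>
    obtain ⟨N, hN⟩ := exists_functional_bound b
    obtain ⟨C, -, hC⟩ := hN (R + R')
    refine ⟨N, C, fun f hf M hM x hx => ?_⟩
    rw [norm_iteratedFDeriv_zero]
    refine hC _ ((hf.comp_sub x).mono (by linarith)) M fun j hj z => ?_
    rw [iteratedFDeriv_comp_sub]
    exact hM j hj _
  | succ n ih =>
    obtain ⟨N, C, hC⟩ := ih
    refine ⟨N + 1, ∑ i, ‖coordSmul E F i‖ * (C * ‖Module.finBasis ℝ E i‖),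
      fun f hf M hM x hx => ?_⟩
    have hcd := fun i => contDiff_pairing_nat b n (hf.partial (Module.finBasis ℝ E i))
    rw [← norm_iteratedFDeriv_fderiv, fderiv_pairing b hf,
      iteratedFDeriv_sum fun i _ => (ContinuousLinearMap.contDiff _).comp (hcd i),
      Finset.sum_apply, Finset.sum_mul]
    refine norm_sum_le_of_le _ fun i _ => ?_
    refine ((coordSmul E F i).norm_iteratedFDeriv_comp_left (hcd i).contDiffAt le_rfl).trans ?_
    rw [mul_assoc, mul_assoc]
    refine mul_le_mul_of_nonneg_left (hC _ (hf.partial _) _ (fun j hj z => ?_) x hx)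
      (norm_nonneg _)
    exact (hf.norm_iteratedFDeriv_partial_le _ j z).trans
      (mul_le_mul_of_nonneg_left (hM (j + 1) (by omega) z) (norm_nonneg _))

end Pairing

section Riemann

variable {V : Type*} [NormedAddCommGroup V] {Xi : ℝ → ℝ → V}

/-- `S` is a Riemann sum of the germ `Xi` over a partition of `[s, t]` of mesh at most `δ`. -/
def IsRiemannSum (Xi : ℝ → ℝ → V) (δ s t : ℝ) (S : V) : Prop :=
  ∃ (k : ℕ) (p : ℕ → ℝ), p 0 = s ∧ p k = t ∧ (∀ i < k, p i ≤ p (i + 1)) ∧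
    (∀ i < k, p (i + 1) - p i ≤ δ) ∧ ∑ i ∈ Finset.range k, Xi (p i) (p (i + 1)) = S

lemma IsRiemannSum.mono {δ δ' s t : ℝ} {S : V} (h : IsRiemannSum Xi δ s t S) (hδ : δ ≤ δ') :
    IsRiemannSum Xi δ' s t S := by
  obtain ⟨k, p, h0, hk, hm, hδ', hS⟩ := h
  exact ⟨k, p, h0, hk, hm, fun i hi => (hδ' i hi).trans hδ, hS⟩

lemma isRiemannSum_single {s t : ℝ} (hst : s ≤ t) : IsRiemannSum Xi (t - s) s t (Xi s t) := by
  refine ⟨1, fun i => if i = 0 then s else t, by simp, by simp, ?_, ?_, by simp⟩ <;>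
  · intro i hi
    obtain rfl : i = 0 := by omega
    simp [hst]

lemma IsRiemannSum.add {δ s u t : ℝ} {S S' : V} (h : IsRiemannSum Xi δ s u S)
    (h' : IsRiemannSum Xi δ u t S') : IsRiemannSum Xi δ s t (S + S') := by
  obtain ⟨k, p, h0, hk, hm, hδ, hS⟩ := h
  obtain ⟨k', p', h0', hk', hm', hδ', hS'⟩ := h'
  let r : ℕ → ℝ := fun i => if i ≤ k then p i else p' (i - k)
  have r1 : ∀ i ≤ k, r i = p i := fun i hi => if_pos hi
  have r2 : ∀ i, r (k + i) = p' i := by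
    intro i
    rcases Nat.eq_zero_or_pos i with rfl | hi
    · rw [add_zero, r1 k le_rfl, hk, h0']
    · have : ¬ k + i ≤ k := by omega
      simp [r, this]
  have step : ∀ i < k + k', (i < k ∧ r i = p i ∧ r (i + 1) = p (i + 1)) ∨
      ∃ j < k', r i = p' j ∧ r (i + 1) = p' (j + 1) := by
    intro i hi
    by_cases hik : i < k
    · exact Or.inl ⟨hik, r1 i hik.le, r1 (i + 1) hik⟩
    · obtain ⟨j, rfl⟩ := Nat.exists_eq_add_of_le (not_lt.1 hik)
      exact Or.inr ⟨j, by omega, r2 j, r2 (j + 1)⟩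
  refine ⟨k + k', r, by rw [r1 0 (Nat.zero_le _), h0], by rw [r2, hk'], ?_, ?_, ?_⟩
  · intro i hi
    rcases step i hi with ⟨h1, h2, h3⟩ | ⟨j, h1, h2, h3⟩ <;> rw [h2, h3]
    exacts [hm i h1, hm' j h1]
  · intro i hi
    rcases step i hi with ⟨h1, h2, h3⟩ | ⟨j, h1, h2, h3⟩ <;> rw [h2, h3]
    exacts [hδ i h1, hδ' j h1]
  · rw [Finset.sum_range_add, ← hS, ← hS']
    congr 1
    · refine Finset.sum_congr rfl fun i hi => ?_
      have := Finset.mem_range.1 hi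
      rw [r1 i this.le, r1 (i + 1) this]
    · refine Finset.sum_congr rfl fun i _ => ?_
      rw [r2, add_assoc, r2]

/-- Riemann sums over the dyadic partitions of `[s, t]`. -/
def dyadicSum (Xi : ℝ → ℝ → V) : ℕ → ℝ → ℝ → V
  | 0, s, t => Xi s t
  | k + 1, s, t => dyadicSum Xi k s ((s + t) / 2) + dyadicSum Xi k ((s + t) / 2) t

lemma isRiemannSum_dyadicSum (k : ℕ) : ∀ {s t : ℝ}, s ≤ t →
    IsRiemannSum Xi ((t - s) / 2 ^ k) s t (dyadicSum Xi k s t) := by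
  induction k with
  | zero =>
    intro s t hst
    simpa [dyadicSum] using isRiemannSum_single (Xi := Xi) hst
  | succ k ih =>
    intro s t hst
    have h1 := ih (s := s) (t := (s + t) / 2) (by linarith)
    have h2 := ih (s := (s + t) / 2) (t := t) (by linarith)
    have e1 : ((s + t) / 2 - s) / 2 ^ k = (t - s) / 2 ^ (k + 1) := by rw [pow_succ]; field_simp; ring
    have e2 : (t - (s + t) / 2) / 2 ^ k = (t - s) / 2 ^ (k + 1) := by rw [pow_succ]; field_simp; ring
    rw [e1] at h1
    rw [e2] at h2
    exact h1.add h2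

lemma norm_dyadicSum_sub_le {a b M : ℝ} (hM : 0 ≤ M)
    (h : ∀ s u t, a ≤ s → s ≤ u → u ≤ t → t ≤ b →
      ‖Xi s t - Xi s u - Xi u t‖ ≤ M * gauge (t - s) ^ 2) (k : ℕ) : ∀ {s t : ℝ}, a ≤ s → s ≤ t →
    t ≤ b → ‖dyadicSum Xi k s t - Xi s t‖ ≤ 4 * M * gauge (t - s) ^ 2 := by
  induction k with
  | zero =>
    intro s t _ _ _
    simp only [dyadicSum, sub_self, norm_zero]
    positivity
  | succ k ih =>
    intro s t hs hst ht
    have h1 := ih (s := s) (t := (s + t) / 2) hs (by linarith) (by linarith)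
    have h2 := ih (s := (s + t) / 2) (t := t) (by linarith) (by linarith) ht
    have h3 := h s ((s + t) / 2) t hs (by linarith) (by linarith) ht
    have h4 := two_mul_gauge_half_sq (h := t - s) (by linarith)
    have e1 : (s + t) / 2 - s = (t - s) / 2 := by ring
    have e2 : t - (s + t) / 2 = (t - s) / 2 := by ring
    rw [e1] at h1
    rw [e2] at h2
    have e : dyadicSum Xi (k + 1) s t - Xi s t =
        (dyadicSum Xi k s ((s + t) / 2) - Xi s ((s + t) / 2)) +
        (dyadicSum Xi k ((s + t) / 2) t - Xi ((s + t) / 2) t) -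
        (Xi s t - Xi s ((s + t) / 2) - Xi ((s + t) / 2) t) := by
      simp only [dyadicSum]; abel
    rw [e]
    refine (norm_sub_le _ _).trans ((add_le_add (norm_add_le _ _) le_rfl).trans ?_)
    nlinarith

/-- If the Riemann sums over `[0, s]` and `[0, t]` converge, the limits differ by a quantity close
to the germ at `(s, t)`. -/
lemma norm_sub_germ_le_of_riemannConv {b M s t : ℝ} {I J : V} (hM : 0 ≤ M)
    (h : ∀ s u t, 0 ≤ s → s ≤ u → u ≤ t → t ≤ b →
      ‖Xi s t - Xi s u - Xi u t‖ ≤ M * gauge (t - s) ^ 2)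
    (hs : 0 ≤ s) (hst : s ≤ t) (ht : t ≤ b) (hI : RiemannConv Xi 0 s I)
    (hJ : RiemannConv Xi 0 t J) : ‖J - I - Xi s t‖ ≤ 4 * M * gauge (t - s) ^ 2 := by
  refine le_of_forall_pos_le_add fun ε hε => ?_
  obtain ⟨δ, hδ, hI⟩ := hI (ε / 2) (by linarith)
  obtain ⟨δ', hδ', hJ⟩ := hJ (ε / 2) (by linarith)
  have small : ∀ᶠ k : ℕ in atTop, t / 2 ^ k < min δ δ' := by
    have : Tendsto (fun k : ℕ => t / 2 ^ k) atTop (𝓝 0) := by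
      have := (tendsto_pow_atTop_nhds_zero_of_lt_one (r := (1 / 2 : ℝ)) (by norm_num)
        (by norm_num)).const_mul t
      rw [mul_zero] at this
      refine this.congr fun k => ?_
      rw [one_div, inv_pow, div_eq_mul_inv]
    exact this.eventually (gt_mem_nhds (lt_min hδ hδ'))
  obtain ⟨k, hk⟩ := small.exists
  have p2 : (0 : ℝ) < 2 ^ k := by positivity
  have q1 : (s - 0) / 2 ^ k ≤ min δ δ' :=
    (div_le_div_of_nonneg_right (by linarith) p2.le).trans hk.le
  have q2 : (t - s) / 2 ^ k ≤ min δ δ' :=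
    (div_le_div_of_nonneg_right (by linarith) p2.le).trans hk.le
  have s1 := (isRiemannSum_dyadicSum (Xi := Xi) k hs).mono q1
  have s2 := s1.add ((isRiemannSum_dyadicSum (Xi := Xi) k hst).mono q2)
  have b1 : ‖dyadicSum Xi k 0 s - I‖ < ε / 2 := by
    obtain ⟨n, p, h0, hn, hm, hd, hS⟩ := s1.mono (min_le_left δ δ')
    rw [← hS]
    exact hI n p h0 hn hm hd
  have b2 : ‖dyadicSum Xi k 0 s + dyadicSum Xi k s t - J‖ < ε / 2 := by
    obtain ⟨n, p, h0, hn, hm, hd, hS⟩ := s2.mono (min_le_right δ δ')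
    rw [← hS]
    exact hJ n p h0 hn hm hd
  have b3 := norm_dyadicSum_sub_le hM h k hs hst ht
  have e : J - I - Xi s t = (dyadicSum Xi k 0 s - I) -
      (dyadicSum Xi k 0 s + dyadicSum Xi k s t - J) + (dyadicSum Xi k s t - Xi s t) := by abel
  rw [e]
  refine (norm_add_le _ _).trans ((add_le_add (norm_sub_le _ _) le_rfl).trans ?_)
  linarith

end Riemann

/-- Solutions in the sense of Riemann sums are solutions in the sense of Euler remainders. -/
lemma RegField.isSol_of_isNLYoungSolution {V : Type*} [NormedAddCommGroup V] [NormedSpace ℝ V]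
    {T τ : ℝ} {A : ℝ → V → V} (hA : RegField τ A) (hτ : 0 ≤ τ) (hτT : τ ≤ T) {x : V}
    {Tstar : ℝ≥0∞} {y : ℝ → V} (hy : IsNLYoungSolution T (Ioo (1 / 2 : ℝ) 1) (inc A) x Tstar y)
    (hlt : ENNReal.ofReal τ < Tstar) : IsSol τ A x y := by
  obtain ⟨h0, hH, hR⟩ := hy
  obtain ⟨H, hH⟩ := hH τ hτ hτT hlt (3 / 4) (by constructor <;> norm_num)
  have hHy : ∀ s t, 0 ≤ s → s ≤ t → t ≤ τ → ‖y t - y s‖ ≤ |H| * gauge (t - s) := by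
    intro s t hs hst ht
    have := hH s ⟨hs, hst.trans ht⟩ t ⟨hs.trans hst, ht⟩
    rw [abs_of_nonneg (by linarith)] at this
    exact this.trans (mul_le_mul_of_nonneg_right (le_abs_self H) (gauge_nonneg (by linarith)))
  have hb : ∀ t, 0 ≤ t → t ≤ τ → ‖y t‖ ≤ ‖x‖ + |H| * gauge τ := by
    intro t ht htτ
    have h1 := hHy 0 t le_rfl ht htτ
    rw [h0, sub_zero] at h1
    have h2 := norm_le_norm_add_norm_sub' (y t) x
    have h3 := mul_le_mul_of_nonneg_left (gauge_mono ht htτ) (abs_nonneg H)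
    linarith
  obtain ⟨C, hC⟩ := hA.incBound (‖x‖ + |H| * gauge τ)
  have hC0 := hC.nonneg
  have hM : 0 ≤ C * |H| := mul_nonneg hC0 (abs_nonneg H)
  have hδ : ∀ s u t, 0 ≤ s → s ≤ u → u ≤ t → t ≤ τ →
      ‖inc A s t (y s) - inc A s u (y s) - inc A u t (y u)‖ ≤ C * |H| * gauge (t - s) ^ 2 := by
    intro s u t hs hsu hut ht
    have e : inc A s t (y s) - inc A s u (y s) - inc A u t (y u) =
        inc A u t (y s) - inc A u t (y u) := by
      rw [← inc_add A s u t]; abel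
    have h1 := hC.lip u t (by linarith) hut ht (y u) (y s) (hb u (by linarith) (by linarith))
      (hb s hs (by linarith))
    have h2 := hHy s u hs hsu (by linarith)
    rw [norm_sub_rev] at h2
    have g1 := gauge_mono (h := u - s) (k := t - s) (by linarith) (by linarith)
    have g2 := gauge_mono (h := t - u) (k := t - s) (by linarith) (by linarith)
    have g3 := gauge_nonneg (h := u - s) (by linarith)
    have g4 := gauge_nonneg (h := t - u) (by linarith)
    have g5 := g4.trans g2
    rw [e]
    calc _ ≤ C * gauge (t - u) * ‖y s - y u‖ := h1
      _ ≤ C * gauge (t - s) * (|H| * gauge (t - s)) := by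
        gcongr
        exact h2.trans (by gcongr)
      _ = _ := by ring
  have hlt' : ∀ s t, 0 ≤ s → s ≤ t → t ≤ τ → t < T →
      ‖rem A y s t‖ ≤ 4 * (C * |H|) * gauge (t - s) ^ 2 := by
    intro s t hs hst ht htT
    have h1 := norm_sub_germ_le_of_riemannConv hM hδ hs hst ht
      (hR s hs (hst.trans_lt htT) ((ENNReal.ofReal_le_ofReal (hst.trans ht)).trans_lt hlt))
      (hR t (hs.trans hst) htT ((ENNReal.ofReal_le_ofReal ht).trans_lt hlt))
    have e : rem A y s t = y t - x - (y s - x) - inc A s t (y s) := by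
      simp only [rem]; abel
    rw [e]
    exact h1
  refine ⟨h0, _, 4 * (C * |H|), hb, fun s t hs hst ht => ?_⟩
  rcases hst.eq_or_lt with rfl | hst'
  · simp [rem, inc]
  refine le_of_forall_pos_le_add fun ε hε => ?_
  obtain ⟨η, hη, hηε⟩ := exists_mul_gauge_le (|H| + C) hε
  obtain ⟨u, hu1, hu2⟩ := exists_between (max_lt hst' (sub_lt_self t hη))
  have hsu : s ≤ u := ((le_max_left _ _).trans_lt hu1).le
  have htu : t - u ≤ η := by linarith [(le_max_right s (t - η)).trans_lt hu1]
  have h1 := hlt' s u hs hsu (by linarith) (by linarith)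
  have h2 := hHy u t (by linarith) hu2.le ht
  have h3 := hC.bound u t (by linarith) hu2.le ht (y s) (hb s hs (by linarith))
  have h4 : gauge (u - s) ^ 2 ≤ gauge (t - s) ^ 2 :=
    pow_le_pow_left₀ (gauge_nonneg (by linarith)) (gauge_mono (by linarith) (by linarith)) 2
  have h5 := gauge_mono (h := t - u) (k := η) (by linarith) htu
  have h6 : 4 * (C * |H|) * gauge (u - s) ^ 2 ≤ 4 * (C * |H|) * gauge (t - s) ^ 2 := by gcongr
  have h7 : (|H| + C) * gauge (t - u) ≤ (|H| + C) * gauge η := by gcongr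
  have e : rem A y s t = rem A y s u + (y t - y u) - inc A u t (y s) := by
    simp only [rem, ← inc_add A s u t]; abel
  rw [e]
  refine (norm_sub_le _ _).trans ((add_le_add (norm_add_le _ _) le_rfl).trans ?_)
  linarith

/-- Pairing a tempered distribution with the translates of a smooth local time yields a regular
field. -/
lemma regField_of_localTime {E : Type} [NormedAddCommGroup E] [NormedSpace ℝ E]
    [FiniteDimensional ℝ E] {T τ : ℝ} (hτT : τ ≤ T) {ℓ : ℝ → E → ℝ}
    (hsmooth : ∀ t ∈ Icc (0 : ℝ) T, ContDiff ℝ ∞ (ℓ t))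
    (hsupp : ∃ K : Set E, IsCompact K ∧ ∀ t ∈ Icc (0 : ℝ) T, tsupport (ℓ t) ⊆ K)
    (hHol : ∀ n : ℕ, ∃ C : ℝ, ∀ s t : ℝ, 0 ≤ s → s ≤ t → t ≤ T →
      ∀ x : E, ‖iteratedFDeriv ℝ n (fun z => ℓ t z - ℓ s z) x‖ ≤ C * gauge (t - s))
    {Ltr : ℝ → E → SchwartzMap E ℝ} (hLtr : ∀ t x z, Ltr t x z = ℓ t (z - x))
    (b : SchwartzMap E ℝ →L[ℝ] E) : RegField τ (fun t x => b (Ltr t x)) := by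
  obtain ⟨K, hK, hKs⟩ := hsupp
  obtain ⟨R, hKR⟩ := hK.isBounded.subset_closedBall 0
  have hbump : ∀ t, 0 ≤ t → t ≤ τ → Bump R (ℓ t) := fun t h0 ht =>
    ⟨hsmooth t ⟨h0, ht.trans hτT⟩, fun z hz => image_eq_zero_of_notMem_tsupport fun hzs => by
      have := hKR (hKs t ⟨h0, ht.trans hτT⟩ hzs)
      rw [mem_closedBall_zero_iff] at this
      linarith⟩
  have hsub : ∀ s t, 0 ≤ s → s ≤ t → t ≤ τ → Bump R (fun z => ℓ t z - ℓ s z) := by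
    intro s t hs hst ht
    have h1 := hbump s hs (hst.trans ht)
    have h2 := hbump t (hs.trans hst) ht
    exact ⟨h2.smooth.sub h1.smooth, fun z hz => by rw [h1.zero z hz, h2.zero z hz, sub_zero]⟩
  refine ⟨fun t h0 ht => ?_, fun n R' => ?_⟩
  · have e : (fun x => b (Ltr t x)) = pairing b (ℓ t) := by
      funext x
      rw [pairing]
      congr 1
      ext z
      rw [((hbump t h0 ht).comp_sub x).coe_toSchwartz, hLtr]
    exact e ▸ contDiff_pairing b (hbump t h0 ht)
  · obtain ⟨N, C, hC⟩ := exists_pairing_bound b R R' n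
    choose H hH using hHol
    refine ⟨C * ∑ j ∈ Finset.range (N + 1), |H j|, fun s t hs hst ht x hx => ?_⟩
    have e : inc (fun t x => b (Ltr t x)) s t = pairing b (fun z => ℓ t z - ℓ s z) := by
      funext x
      rw [pairing, inc, ← map_sub]
      congr 1
      ext z
      rw [((hsub s t hs hst ht).comp_sub x).coe_toSchwartz, sub_apply, hLtr, hLtr]
    rw [e, mul_assoc]
    refine hC _ (hsub s t hs hst ht) _ (fun j hj z => ?_) x hx
    refine (hH j s t hs hst (ht.trans hτT) z).trans
      (mul_le_mul_of_nonneg_right ?_ (gauge_nonneg (by linarith)))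
    exact (le_abs_self _).trans (Finset.single_le_sum (f := fun j => |H j|)
      (fun _ _ => abs_nonneg _) (Finset.mem_range.2 (by omega)))

end NLYoung

/-- **Smoothness of the flow.** In the setting of an infinitely regularizing path `w` (with
smooth compactly supported local time `ℓ` whose translates are packaged by `Ltr`) and a
tempered distribution `b`, let `y^x` be the unique maximal solution of
`y^x_t = x + lim ∑ T_{u,v}b(y^x_u)` with maximal existence time `T⋆(x)`.  If `U` is open and
`τ ∈ (0,T]` satisfies `τ < T⋆(x)` for all `x ∈ U`, then the flow map
`U → C([0,τ], ℝ^d)`, `x ↦ y^x`, is infinitely Fréchet differentiable on `U`. -/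
theorem stmt_1 {d : ℕ} (T : ℝ) (hT : 0 < T) (w : ℝ → Euc d)
    (hw : ContinuousOn w (Set.Icc 0 T))
    (ℓ : ℝ → Euc d → ℝ)
    (hloc : IsLocalTime T w ℓ)
    (hsmooth : ∀ t ∈ Set.Icc (0:ℝ) T, ContDiff ℝ (⊤:ℕ∞) (ℓ t))
    (hsupp : ∃ K : Set (Euc d), IsCompact K ∧ ∀ t ∈ Set.Icc (0:ℝ) T, tsupport (ℓ t) ⊆ K)
    (hHol : ∀ γ ∈ Set.Ioo (1/2:ℝ) 1, ∀ n : ℕ, ∃ C : ℝ, ∀ s t : ℝ, 0 ≤ s → s ≤ t → t ≤ T →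
      ∀ x : Euc d, ‖iteratedFDeriv ℝ n (fun z => ℓ t z - ℓ s z) x‖ ≤ C * (t - s) ^ γ)
    (Ltr : ℝ → Euc d → SchwartzMap (Euc d) ℝ)
    (hLtr : ∀ t x z, Ltr t x z = ℓ t (z - x))
    (b : SchwartzMap (Euc d) ℝ →L[ℝ] Euc d)
    (Tstar : Euc d → ℝ≥0∞) (y : Euc d → ℝ → Euc d)
    (hTstar : ∀ x, 0 < Tstar x ∧ (Tstar x ≤ ENNReal.ofReal T ∨ Tstar x = ⊤))
    (hsol : ∀ x, IsNLYoungSolution T (Set.Ioo (1/2:ℝ) 1)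
      (fun u v x' => b (Ltr v x') - b (Ltr u x')) x (Tstar x) (y x))
    (huniq : ∀ x z, IsNLYoungSolution T (Set.Ioo (1/2:ℝ) 1)
        (fun u v x' => b (Ltr v x') - b (Ltr u x')) x (Tstar x) z →
      ∀ t : ℝ, 0 ≤ t → t ≤ T → ENNReal.ofReal t < Tstar x → z t = y x t)
    (hblow : ∀ x, Tstar x ≠ ⊤ →
      Tendsto (fun t => ‖y x t‖) (nhdsWithin (Tstar x).toReal (Set.Iio (Tstar x).toReal)) atTop)
    (U : Set (Euc d)) (hU : IsOpen U) (τ : ℝ) (hτ : 0 < τ) (hτT : τ ≤ T)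
    (hτU : ∀ x ∈ U, ENNReal.ofReal τ < Tstar x) :
    ∃ Φ : Euc d → ContinuousMap (Set.Icc (0:ℝ) τ) (Euc d),
      (∀ x ∈ U, ∀ t : Set.Icc (0:ℝ) τ, Φ x t = y x t) ∧
      ContDiffOn ℝ (⊤:ℕ∞) Φ U := by
  have hA : NLYoung.RegField τ (fun t x => b (Ltr t x)) :=
    NLYoung.regField_of_localTime hτT hsmooth hsupp
      (hHol (3 / 4) (by constructor <;> norm_num)) hLtr b
  have hS : ∀ x ∈ U, NLYoung.IsSol τ (fun t x => b (Ltr t x)) x (y x) := fun x hx =>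
    hA.isSol_of_isNLYoungSolution hτ.le hτT (hsol x) (hτU x hx)
  have hΦ : ∀ x ∈ U, ∀ t : Set.Icc (0:ℝ) τ, NLYoung.toPath τ (y x) t = y x t := fun x hx t =>
    NLYoung.toPath_apply (hA.continuousOn_of_isSol (hS x hx)) t
  exact ⟨fun x => NLYoung.toPath τ (y x), hΦ,
    contDiffOn_infty.2 fun n => NLYoung.contDiffOn_flow_nat n hA hτ.le hU hS hΦ⟩
end
end

section
/- Let T>0, α∈(0,1], β∈(0,1], and let w:[0,T]→ℝ be β-Hölder continuous. If the occupation measure μ_T of w admits a density L_T that is α-Hölder continuous, then β ≤ 1/(α+1). Equivalently, if β > (α+1)^{-1}, then μ_T has no α-Hölder continuous density. -/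
noncomputable section
open MeasureTheory Set Filter
open scoped ENNReal NNReal

/-- A function satisfying on `s` a Hölder bound with positive exponent is continuous on `s`. -/
theorem continuousOn_of_abs_sub_le_rpow {s : Set ℝ} {w : ℝ → ℝ} {C β : ℝ} (hβ : 0 < β)
    (hw : ∀ x ∈ s, ∀ y ∈ s, |w y - w x| ≤ C * |y - x| ^ β) : ContinuousOn w s := by
  intro x hx
  have hlim : Tendsto (fun y : ℝ => C * |y - x| ^ β) (nhdsWithin x s) (nhds 0) := by
    have hcont : Continuous fun y : ℝ => C * |y - x| ^ β :=
      continuous_const.mul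
        ((continuous_id.sub continuous_const).abs.rpow_const fun _ => Or.inr hβ.le)
    have h := (hcont.tendsto x).mono_left (nhdsWithin_le_nhds (s := s))
    simpa [Real.zero_rpow hβ.ne'] using h
  refine tendsto_iff_dist_tendsto_zero.2
    (squeeze_zero' (Eventually.of_forall fun _ => dist_nonneg) ?_ hlim)
  filter_upwards [self_mem_nhdsWithin] with y hy
  exact hw x hx y hy

/-- If `δ ≤ K * δ ^ p` for all small positive `δ`, then `p ≤ 1`. -/
theorem le_one_of_forall_le_mul_rpow {T K p : ℝ} (hT : 0 < T)
    (h : ∀ δ, 0 < δ → δ ≤ T → δ ≤ K * δ ^ p) : p ≤ 1 := by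
  by_contra! hp
  have hlim : Tendsto (fun δ : ℝ => K * δ ^ (p - 1)) (nhdsWithin 0 (Ioi 0)) (nhds 0) := by
    have hcont : Continuous fun δ : ℝ => K * δ ^ (p - 1) :=
      continuous_const.mul (continuous_id.rpow_const fun _ => Or.inr (by linarith))
    have h0 := (hcont.tendsto 0).mono_left (nhdsWithin_le_nhds (s := Ioi 0))
    simpa [Real.zero_rpow (show p - 1 ≠ 0 by linarith)] using h0
  have hge : ∀ᶠ δ : ℝ in nhdsWithin 0 (Ioi 0), 1 ≤ K * δ ^ (p - 1) := by
    filter_upwards [Ioc_mem_nhdsGT hT] with δ hδ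
    have hδ' := h δ hδ.1 hδ.2
    rw [Real.rpow_sub hδ.1, Real.rpow_one, ← mul_div_assoc, le_div_iff₀ hδ.1]
    linarith
  linarith [ge_of_tendsto hlim hge]

/-- A nonnegative function with vanishing integral over `A` has a zero in every measurable subset
of `A` of positive measure. -/
theorem exists_eq_zero_of_setLIntegral_eq_zero {L : ℝ → ℝ} (hL : Measurable L)
    (hLpos : ∀ z, 0 ≤ L z) {A B : Set ℝ} (hB : MeasurableSet B) (hBA : B ⊆ A)
    (hB0 : volume B ≠ 0) (hA0 : ∫⁻ z in A, ENNReal.ofReal (L z) = 0) :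
    ∃ z ∈ B, L z = 0 := by
  by_contra! hne
  have hB' : ∫⁻ z in B, ENNReal.ofReal (L z) = 0 :=
    le_antisymm ((lintegral_mono_set hBA).trans hA0.le) zero_le
  rw [setLIntegral_eq_zero_iff hB hL.ennreal_ofReal] at hB'
  refine hB0 (measure_mono_null (fun z hz => ?_) hB')
  have hpos : 0 < L z := lt_of_le_of_ne (hLpos z) (hne z hz).symm
  simpa [hz] using hpos

/-- **Hölder paths with Hölder occupation density.**
Let `T > 0`, `α ∈ (0,1]`, `β ∈ (0,1]`, and let `w : [0,T] → ℝ` be `β`-Hölder continuous.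
If the occupation measure `μ_T(A) = Leb{s ∈ [0,T] : w s ∈ A}` admits a density `L_T` that is
`α`-Hölder continuous, then `β ≤ 1/(α+1)`. -/
theorem stmt_4 (T α β : ℝ) (hT : 0 < T) (hα : α ∈ Set.Ioc (0:ℝ) 1) (hβ : β ∈ Set.Ioc (0:ℝ) 1)
    (w : ℝ → ℝ)
    (hw : ∃ Cw : ℝ, ∀ s ∈ Set.Icc (0:ℝ) T, ∀ t ∈ Set.Icc (0:ℝ) T,
      |w t - w s| ≤ Cw * |t - s| ^ β)
    (L : ℝ → ℝ) (hLmeas : Measurable L) (hLpos : ∀ z, 0 ≤ L z)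
    (hLdens : ∀ A : Set ℝ, MeasurableSet A →
      volume {s : ℝ | s ∈ Set.Icc 0 T ∧ w s ∈ A} = ∫⁻ z in A, ENNReal.ofReal (L z))
    (hLHolder : ∃ CL : ℝ, ∀ x y : ℝ, |L x - L y| ≤ CL * |x - y| ^ α) :
    β ≤ 1 / (α + 1) := by
  obtain ⟨Cw, hCw⟩ := hw
  obtain ⟨CL, hCL⟩ := hLHolder
  have hα0 : 0 < α := hα.1
  have hCL0 : 0 ≤ CL := by simpa using (abs_nonneg _).trans (hCL 1 0)
  obtain ⟨t₀, ht₀, hmax⟩ := isCompact_Icc.exists_isMaxOn (nonempty_Icc.2 hT.le)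
    (continuousOn_of_abs_sub_le_rpow hβ.1 hCw)
  set b := w t₀
  have hwb : ∀ s ∈ Icc (0:ℝ) T, w s ≤ b := fun s hs => hmax hs
  have hnull : ∫⁻ z in Ioi b, ENNReal.ofReal (L z) = 0 := by
    rw [← hLdens _ measurableSet_Ioi]
    convert measure_empty (μ := (volume : Measure ℝ))
    ext s
    simp only [mem_ofPred_eq, mem_Ioi, mem_empty_iff_false, iff_false, not_and, not_lt]
    exact hwb s
  -- The density is small just below the maximum of the path.
  have hLsmall : ∀ ε, 0 < ε → ∀ z ∈ Icc (b - ε) b, L z ≤ CL * (2 * ε) ^ α := by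
    intro ε hε z hz
    obtain ⟨y, hy, hy0⟩ := exists_eq_zero_of_setLIntegral_eq_zero hLmeas hLpos
      (B := Ioo b (b + ε)) measurableSet_Ioo (fun y hy => hy.1) (by simp [hε]) hnull
    have h := hCL z y
    rw [hy0, sub_zero, abs_of_nonneg (hLpos z)] at h
    have hzy : |z - y| ≤ 2 * ε := abs_le.2 ⟨by linarith [hz.1, hy.2], by linarith [hz.2, hy.1]⟩
    exact h.trans (by gcongr)
  set C := max Cw 1
  have hC : 0 < C := lt_max_of_lt_right one_pos
  have hkey : ∀ δ, 0 < δ → δ ≤ T → δ ≤ CL * 2 ^ α * C ^ (α + 1) * δ ^ (β * (α + 1)) := by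
    intro δ hδ hδT
    set ε := C * δ ^ β with hεdef
    have hε : 0 < ε := by positivity
    set c := max 0 (t₀ - δ)
    have hsub : Icc c (c + δ) ⊆ {s : ℝ | s ∈ Icc 0 T ∧ w s ∈ Icc (b - ε) b} := by
      intro s hs
      have hc0 : 0 ≤ c := le_max_left _ _
      have hc1 : t₀ - δ ≤ c := le_max_right _ _
      have hct : c ≤ t₀ := max_le ht₀.1 (by linarith)
      have hcT : c ≤ T - δ := max_le (by linarith) (by linarith [ht₀.2])
      have hsT : s ∈ Icc 0 T := ⟨by linarith [hs.1], by linarith [hs.2]⟩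
      have hst : |s - t₀| ≤ δ := abs_le.2 ⟨by linarith [hs.1], by linarith [hs.2]⟩
      have hws : |w s - b| ≤ ε := by
        refine (hCw t₀ ht₀ s hsT).trans ?_
        have := hβ.1.le
        rw [hεdef]
        gcongr
        exact le_max_left _ _
      exact ⟨hsT, by linarith [(abs_le.1 hws).1], hwb s hsT⟩
    have hmeas : ENNReal.ofReal δ ≤ ENNReal.ofReal (CL * (2 * ε) ^ α * ε) := calc
      ENNReal.ofReal δ = volume (Icc c (c + δ)) := by simp
      _ ≤ volume {s : ℝ | s ∈ Icc 0 T ∧ w s ∈ Icc (b - ε) b} := measure_mono hsub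
      _ = ∫⁻ z in Icc (b - ε) b, ENNReal.ofReal (L z) := hLdens _ measurableSet_Icc
      _ ≤ ∫⁻ _ in Icc (b - ε) b, ENNReal.ofReal (CL * (2 * ε) ^ α) :=
        setLIntegral_mono measurable_const fun z hz =>
          ENNReal.ofReal_le_ofReal (hLsmall ε hε z hz)
      _ = ENNReal.ofReal (CL * (2 * ε) ^ α * ε) := by
        rw [setLIntegral_const, Real.volume_Icc, sub_sub_cancel,
          ENNReal.ofReal_mul (p := CL * (2 * ε) ^ α) (by positivity)]
    have hle := (ENNReal.ofReal_le_ofReal_iff (by positivity)).1 hmeas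
    refine hle.trans_eq ?_
    rw [Real.mul_rpow zero_le_two hε.le, mul_assoc, mul_assoc, ← Real.rpow_add_one hε.ne',
      hεdef, Real.mul_rpow hC.le (by positivity), ← Real.rpow_mul hδ.le]
    ring
  rw [le_div_iff₀ (by linarith)]
  exact le_one_of_forall_le_mul_rpow hT hkey
end
end
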